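/- Fix s₀ > 0 and s > 1, and let v : ℤ² → ℝ satisfy Σ_{n∈ℤ²} (1+|n|²)^{s₀} v_n² < ∞ (i.e. V ∈ H^{s₀}(𝕋²) with real Fourier coefficients). Then there exist constants c > 0 and σ > 0 such that for every sufficiently large K > 1 there exist a Fourier-side solution a of the cubic defocusing NLS with convolution potential, defined for all t ∈ ℝ and with ‖a(t)‖_{H^s} < ∞ for all t and ‖a(0)‖_{H^s} > 0, and a time T with 0 < T ≤ K^c, such that ‖a(T)‖_{H^s} ≥ K·‖a(0)‖_{H^s} and ‖a(0)‖_{L²} ≤ K^{−σ}. -/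

import Mathlib

noncomputable section

open scoped BigOperators

/-- We identify the two-torus side with the Fourier side: modes are indexed by `ℤ × ℤ`. -/
abbrev Z2 := ℤ × ℤ

/-- The squared Euclidean norm `|n|²` of a mode `n ∈ ℤ²`, as a real number. -/
def nsq (n : Z2) : ℝ := (n.1 : ℝ) ^ 2 + (n.2 : ℝ) ^ 2

/-- Triples of modes. -/
abbrev Triple := Z2 × Z2 × Z2

/-- The cubic nonlinearity term `a_{n₁} ⋅ conj(a_{n₂}) ⋅ a_{n₃}` attached to a triple. -/
def cubicTerm (a : Z2 → ℂ) (p : Triple) : ℂ :=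
  a p.1 * (starRingEnd ℂ) (a p.2.1) * a p.2.2

/-- A Fourier-side solution of the cubic defocusing NLS with convolution potential `V`,
whose (real) Fourier coefficients are `v`: for every `n` and `t`, the sum over triples
`n₁ - n₂ + n₃ = n` converges absolutely, `a_n` is differentiable in `t`, and
`-i a_n'(t) = (|n|² + v_n) a_n(t) + ∑_{n₁-n₂+n₃=n} a_{n₁} conj(a_{n₂}) a_{n₃}`. -/
def IsSolutionV (v : Z2 → ℝ) (a : ℝ → Z2 → ℂ) : Prop :=
  ∀ (n : Z2) (t : ℝ),
    Summable (fun p : {p : Triple // p.1 - p.2.1 + p.2.2 = n} => ‖cubicTerm (a t) p.1‖) ∧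
    ∃ d : ℂ, HasDerivAt (fun τ : ℝ => a τ n) d t ∧
      -Complex.I * d =
        ((nsq n + v n : ℝ) : ℂ) * a t n +
          ∑' p : {p : Triple // p.1 - p.2.1 + p.2.2 = n}, cubicTerm (a t) p.1

/-- The square of the `H^s` Sobolev norm `∑ (1+|n|²)^s |a_n|²`. -/
def HsNormSq (s : ℝ) (a : Z2 → ℂ) : ℝ := ∑' n : Z2, (1 + nsq n) ^ s * ‖a n‖ ^ 2

/-- Finiteness of the `H^s` norm. -/
def HsFinite (s : ℝ) (a : Z2 → ℂ) : Prop :=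
  Summable fun n : Z2 => (1 + nsq n) ^ s * ‖a n‖ ^ 2

/-- The `H^s` Sobolev norm. -/
def HsNorm (s : ℝ) (a : Z2 → ℂ) : ℝ := HsNormSq s a ^ (1 / 2 : ℝ)

/-- The `L²` (mass) norm. -/
def L2Norm (a : Z2 → ℂ) : ℝ := (∑' n : Z2, ‖a n‖ ^ 2) ^ (1 / 2 : ℝ)

/-! ### Global flows of bounded Lipschitz vector fields -/

theorem exists_global_flow_of_lipschitz {E : Type*} [NormedAddCommGroup E] [NormedSpace ℝ E]
    [CompleteSpace E] (X : E → E) (k : NNReal) (hX : LipschitzWith k X) (C : ℝ)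
    (hC : ∀ x, ‖X x‖ ≤ C) (x₀ : E) :
    ∃ γ : ℝ → E, γ 0 = x₀ ∧ ∀ t, HasDerivAt γ (X (γ t)) t := by
  have hC0 : 0 ≤ C := (norm_nonneg _).trans (hC x₀)
  have local_sol : ∀ m : ℕ, ∃ γ : ℝ → E, γ 0 = x₀ ∧
      ∀ t ∈ Set.Ioo (-(m + 1 : ℝ)) (m + 1), HasDerivAt γ (X (γ t)) t := by
    intro m
    have hm : (0 : ℝ) ≤ m := Nat.cast_nonneg m
    have h0 : (0 : ℝ) ∈ Set.Icc (-(m + 1 : ℝ)) (m + 1) := ⟨by linarith, by linarith⟩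
    have hpl : IsPicardLindelof (fun _ : ℝ => X) (tmin := -(m + 1 : ℝ)) (tmax := m + 1)
        ⟨0, h0⟩ x₀ (Real.toNNReal (C * (m + 1))) 0 (Real.toNNReal C) k := by
      refine ⟨fun t _ => hX.lipschitzOnWith, fun x _ => continuousOn_const,
        fun t _ x _ => (hC x).trans (Real.le_coe_toNNReal C), ?_⟩
      rw [Real.coe_toNNReal _ hC0, Real.coe_toNNReal _ (by positivity)]
      simp
    obtain ⟨γ, h1, h2⟩ := hpl.exists_eq_forall_mem_Icc_hasDerivWithinAt₀
    exact ⟨γ, h1, fun t ht => (h2 t ⟨ht.1.le, ht.2.le⟩).hasDerivAt (Icc_mem_nhds ht.1 ht.2)⟩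
  choose γ hγ0 hγ using local_sol
  have agree : ∀ m m' : ℕ, m ≤ m' →
      Set.EqOn (γ m) (γ m') (Set.Ioo (-(m + 1 : ℝ)) (m + 1)) := by
    intro m m' hmm
    have hm : (0 : ℝ) ≤ m := Nat.cast_nonneg m
    have hmm' : (m : ℝ) ≤ m' := Nat.cast_le.mpr hmm
    refine ODE_solution_unique_of_mem_Ioo (v := fun _ => X) (s := fun _ => Set.univ) (K := k)
      (t₀ := 0) (fun t _ => hX.lipschitzOnWith) ⟨by linarith, by linarith⟩
      (fun t ht => ⟨hγ m t ht, trivial⟩)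
      (fun t ht => ⟨hγ m' t ⟨by linarith [ht.1], by linarith [ht.2]⟩, trivial⟩) ?_
    rw [hγ0, hγ0]
  refine ⟨fun t => γ ⌈|t|⌉₊ t, by simp [hγ0], fun t => ?_⟩
  have key : ∀ τ ∈ Set.Ioo (t - 1) (t + 1), γ ⌈|τ|⌉₊ τ = γ (⌈|t|⌉₊ + 1) τ := by
    intro τ hτ
    have h1 : |τ| < |t| + 1 := by
      have := abs_sub_abs_le_abs_sub τ t
      have h2 : |τ - t| < 1 := abs_lt.mpr ⟨by linarith [hτ.1], by linarith [hτ.2]⟩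
      linarith
    have h2 : ⌈|τ|⌉₊ ≤ ⌈|t|⌉₊ + 1 := by
      rw [Nat.ceil_le]; push_cast
      linarith [Nat.le_ceil |t|]
    refine agree _ _ h2 ?_
    have := Nat.le_ceil |τ|
    rw [Set.mem_Ioo, ← abs_lt]
    linarith
  have h3 : |t| < ((⌈|t|⌉₊ + 1 : ℕ) : ℝ) + 1 := by
    push_cast; linarith [Nat.le_ceil |t|]
  have h4 := hγ (⌈|t|⌉₊ + 1) t (abs_lt.mp h3)
  have h5 : (fun τ => γ ⌈|τ|⌉₊ τ) =ᶠ[nhds t] γ (⌈|t|⌉₊ + 1) :=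
    Filter.eventually_of_mem (Ioo_mem_nhds (by linarith) (by linarith)) key
  have h6 := key t ⟨by linarith, by linarith⟩
  rw [← h6] at h4
  exact h4.congr_of_eventuallyEq h5

/-! ### Cubic interactions on a finite set of modes -/

section Cubic

open scoped Classical in
/-- The trilinear interaction `∑ a_x conj(b_y) c_z` over the triples of `F` related to `n`. -/
def cub {α : Type*} (R : α → α → α → α → Prop) (F : Finset α) (a b c : α → ℂ) (n : α) : ℂ :=
  ∑ x ∈ F, ∑ y ∈ F, ∑ z ∈ F,
    if R x y z n then a x * (starRingEnd ℂ) (b y) * c z else 0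

/-- The quadrilinear form `∑ conj(d_w) a_x conj(b_y) c_z` attached to an interaction. -/
def quad {α : Type*} (R : α → α → α → α → Prop) (F : Finset α) (d a b c : α → ℂ) : ℂ :=
  ∑ w ∈ F, (starRingEnd ℂ) (d w) * cub R F a b c w

/-- The symmetries of an interaction relation. -/
structure SymmRel {α : Type*} (R : α → α → α → α → Prop) : Prop where
  outer : ∀ x y z w, R x y z w → R z y x w
  conj : ∀ x y z w, R x y z w → R y x w z

variable {α : Type*} {R : α → α → α → α → Prop} {F : Finset α}

open scoped Classical in
theorem quad_eq (d a b c : α → ℂ) : quad R F d a b c =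
    ∑ w ∈ F, ∑ x ∈ F, ∑ y ∈ F, ∑ z ∈ F,
      if R x y z w then
        (starRingEnd ℂ) (d w) * (a x * (starRingEnd ℂ) (b y) * c z) else 0 := by
  simp only [quad, cub, Finset.mul_sum, mul_ite, mul_zero]

theorem cub_swap (hR : SymmRel R) (a b c : α → ℂ) (n : α) :
    cub R F a b c n = cub R F c b a n := by
  unfold cub
  rw [Finset.sum_comm]
  conv_lhs => enter [2, y]; rw [Finset.sum_comm]
  rw [Finset.sum_comm]
  refine Finset.sum_congr rfl fun z _ => Finset.sum_congr rfl fun y _ =>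
    Finset.sum_congr rfl fun x _ => ?_
  by_cases h : R x y z n
  · rw [if_pos h, if_pos (hR.outer _ _ _ _ h)]; ring
  · rw [if_neg h, if_neg (mt (hR.outer _ _ _ _) h)]

theorem quad_swap (hR : SymmRel R) (d a b c : α → ℂ) :
    quad R F d a b c = quad R F d c b a := by
  simp only [quad, cub_swap hR a b c]

theorem quad_conj (hR : SymmRel R) (d a b c : α → ℂ) :
    quad R F d a b c = (starRingEnd ℂ) (quad R F c b a d) := by
  rw [quad_eq, quad_eq]
  simp only [map_sum]
  have rev : ∀ f : α → α → α → α → ℂ, ∑ w ∈ F, ∑ x ∈ F, ∑ y ∈ F, ∑ z ∈ F, f w x y z =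
      ∑ z ∈ F, ∑ y ∈ F, ∑ x ∈ F, ∑ w ∈ F, f w x y z := by
    intro f
    have h3 : ∀ g : α → α → α → ℂ, ∑ x ∈ F, ∑ y ∈ F, ∑ z ∈ F, g x y z =
        ∑ z ∈ F, ∑ y ∈ F, ∑ x ∈ F, g x y z := by
      intro g
      rw [Finset.sum_comm]
      conv_lhs => enter [2, y]; rw [Finset.sum_comm]
      rw [Finset.sum_comm]
    conv_lhs => enter [2, w]; rw [h3]
    rw [Finset.sum_comm]
    refine Finset.sum_congr rfl fun z _ => ?_
    rw [Finset.sum_comm]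
    refine Finset.sum_congr rfl fun y _ => ?_
    rw [Finset.sum_comm]
  rw [rev]
  refine Finset.sum_congr rfl fun z _ => Finset.sum_congr rfl fun y _ =>
    Finset.sum_congr rfl fun x _ => Finset.sum_congr rfl fun w _ => ?_
  by_cases h : R x y z w
  · rw [if_pos h, if_pos (hR.conj _ _ _ _ h)]
    simp only [map_mul, Complex.conj_conj]; ring
  · rw [if_neg h, if_neg (mt (hR.conj _ _ _ _) h), map_zero]

theorem quad_self_im (hR : SymmRel R) (a : α → ℂ) : (quad R F a a a a).im = 0 :=
  Complex.conj_eq_iff_im.mp (quad_conj hR a a a a).symm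

theorem HasDerivAt.cub {a a' : ℝ → α → ℂ} {t : ℝ}
    (ha : ∀ n ∈ F, HasDerivAt (fun τ => a τ n) (a' t n) t) (n : α) :
    HasDerivAt (fun τ => cub R F (a τ) (a τ) (a τ) n)
      (cub R F (a' t) (a t) (a t) n + cub R F (a t) (a' t) (a t) n
        + cub R F (a t) (a t) (a' t) n) t := by
  unfold _root_.cub
  simp only [← Finset.sum_add_distrib]
  refine HasDerivAt.fun_sum fun x hx => HasDerivAt.fun_sum fun y hy =>
    HasDerivAt.fun_sum fun z hz => ?_
  split_ifs with h
  · have hy' : HasDerivAt (fun τ => (starRingEnd ℂ) (a τ y)) ((starRingEnd ℂ) (a' t y)) t :=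
      (ha y hy).star
    convert! ((ha x hx).mul hy').mul (ha z hz) using 1
    simp only [Pi.mul_apply]; ring
  · simpa using hasDerivAt_const t (0 : ℂ)

/-- The vector field `I (ω a + cub a a a)`. -/
def field (R : α → α → α → α → Prop) (F : Finset α) (ω : α → ℝ) (a : α → ℂ) (n : α) : ℂ :=
  Complex.I * ((ω n : ℂ) * a n + cub R F a a a n)

theorem HasDerivAt.sum_weight_normSq {a : ℝ → α → ℂ} {t : ℝ} {d : α → ℂ}
    (ha : ∀ n ∈ F, HasDerivAt (fun τ => a τ n) (d n) t) (w : α → ℝ) :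
    HasDerivAt (fun τ => ∑ n ∈ F, w n * ‖a τ n‖ ^ 2)
      (∑ n ∈ F, w n * (2 * ((starRingEnd ℂ) (a t n) * d n).re)) t := by
  refine HasDerivAt.fun_sum fun n hn => HasDerivAt.const_mul _ ?_
  have := (ha n hn).norm_sq
  rw [Complex.inner] at this
  rwa [mul_comm (d n)] at this

theorem mass_deriv_zero (hR : SymmRel R) (ω : α → ℝ) (a : α → ℂ) :
    ∑ n ∈ F, (2 * ((starRingEnd ℂ) (a n) * field R F ω a n).re) = 0 := by
  have h : ∀ n, (starRingEnd ℂ) (a n) * field R F ω a n =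
      Complex.I * ((ω n * ‖a n‖ ^ 2 : ℝ) : ℂ)
        + Complex.I * ((starRingEnd ℂ) (a n) * cub R F a a a n) := by
    intro n
    unfold field
    push_cast
    rw [← Complex.conj_mul']
    ring
  simp only [h]
  rw [← Finset.mul_sum, ← Complex.re_sum, Finset.sum_add_distrib, ← Finset.mul_sum,
    ← Finset.mul_sum, ← Complex.ofReal_sum]
  have := quad_self_im (F := F) hR a
  unfold quad at this
  rw [Complex.add_re, Complex.I_mul_re, Complex.I_mul_re, this, Complex.ofReal_im]
  simp

end Cubic

section Flow

variable {α : Type*} {R : α → α → α → α → Prop} {F : Finset α} {ω : α → ℝ}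

/-- Global solutions of `a' = field R F ω a` supported on `F`. -/
structure IsFlow (R : α → α → α → α → Prop) (F : Finset α) (ω : α → ℝ)
    (A : ℝ → α → ℂ) : Prop where
  zero : ∀ t, ∀ n ∉ F, A t n = 0
  deriv : ∀ t, ∀ n ∈ F, HasDerivAt (fun τ => A τ n) (field R F ω (A t) n) t

open scoped Classical in
/-- Extension by zero of a function on a finite set. -/
def extendZero (F : Finset α) (g : F → ℂ) (n : α) : ℂ := if h : n ∈ F then g ⟨n, h⟩ else 0

theorem extendZero_of_mem (g : F → ℂ) {n : α} (h : n ∈ F) : extendZero F g n = g ⟨n, h⟩ :=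
  dif_pos h

theorem contDiff_extendZero (n : α) : ContDiff ℝ 1 (fun g : F → ℂ => extendZero F g n) := by
  unfold extendZero
  split_ifs with h
  · exact contDiff_apply ℝ ℂ (⟨n, h⟩ : F)
  · exact contDiff_const

theorem contDiff_field (n : α) :
    ContDiff ℝ 1 (fun g : F → ℂ => field R F ω (extendZero F g) n) := by
  unfold field cub
  refine contDiff_const.mul ((contDiff_const.mul (contDiff_extendZero n)).add
    (ContDiff.sum fun x _ => ContDiff.sum fun y _ => ContDiff.sum fun z _ => ?_))
  split_ifs
  · exact ((contDiff_extendZero x).mul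
      (Complex.conjCLE.contDiff.comp (contDiff_extendZero y))).mul (contDiff_extendZero z)
  · exact contDiff_const

theorem exists_isFlow (hR : SymmRel R) (ω : α → ℝ) (a₀ : α → ℂ) (ha₀ : ∀ n ∉ F, a₀ n = 0) :
    ∃ A : ℝ → α → ℂ, A 0 = a₀ ∧ IsFlow R F ω A := by
  set X : (F → ℂ) → (F → ℂ) := fun g i => field R F ω (extendZero F g) i with hXdef
  have hX : ContDiff ℝ 1 X := contDiff_pi.mpr fun i => contDiff_field (i : α)
  set m : (F → ℂ) → ℝ := fun g => ∑ i, ‖g i‖ ^ 2 with hm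
  have hmC : ContDiff ℝ 1 m :=
    ContDiff.sum fun i _ => (contDiff_apply ℝ ℂ i).norm_sq ℝ
  set g₀ : F → ℂ := fun i => a₀ i
  set χ : (F → ℂ) → ℝ := fun g => Real.smoothTransition (m g₀ + 2 - m g) with hχ
  have hχC : ContDiff ℝ 1 χ := Real.smoothTransition.contDiff.comp (contDiff_const.sub hmC)
  set Y : (F → ℂ) → (F → ℂ) := fun g => χ g • X g with hY
  have hYC : ContDiff ℝ 1 Y := hχC.smul hX
  have hsupp : HasCompactSupport Y := by
    refine HasCompactSupport.of_support_subset_isCompact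
      (isCompact_closedBall (0 : F → ℂ) (m g₀ + 3)) fun g hg => ?_
    have hm0 : 0 ≤ m g₀ := Finset.sum_nonneg fun i _ => by positivity
    have h1 : m g < m g₀ + 2 := by
      by_contra hcon
      exact hg (by
        simp only [hY, hχ]
        rw [Real.smoothTransition.zero_of_nonpos (by linarith), zero_smul])
    rw [mem_closedBall_zero_iff, pi_norm_le_iff_of_nonneg (by linarith)]
    intro i
    have h2 : ‖g i‖ ^ 2 ≤ m g :=
      Finset.single_le_sum (f := fun i => ‖g i‖ ^ 2) (fun i _ => by positivity)
        (Finset.mem_univ i)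
    nlinarith [norm_nonneg (g i)]
  obtain ⟨k, hk⟩ := hYC.lipschitzWith_of_hasCompactSupport hsupp one_ne_zero
  obtain ⟨C, hC⟩ := hsupp.exists_bound_of_continuous hYC.continuous
  obtain ⟨γ, hγ0, hγ⟩ := exists_global_flow_of_lipschitz Y k hk C hC g₀
  have hγi : ∀ t i, HasDerivAt (fun τ => γ τ i) (Y (γ t) i) t := fun t =>
    hasDerivAt_pi.mp (hγ t)
  have hmass : ∀ t, HasDerivAt (fun τ => m (γ τ)) 0 t := by
    intro t
    have h1 := HasDerivAt.sum_weight_normSq (F := F) (a := fun τ => extendZero F (γ τ))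
      (d := fun n => (χ (γ t) : ℂ) * field R F ω (extendZero F (γ t)) n) (t := t)
      (fun n hn => by
        simp only [extendZero_of_mem _ hn]
        simpa only [hY, hXdef, Pi.smul_apply, Complex.real_smul] using hγi t ⟨n, hn⟩)
      (fun _ => 1)
    have h2 : (fun τ => ∑ n ∈ F, (1 : ℝ) * ‖extendZero F (γ τ) n‖ ^ 2) = fun τ => m (γ τ) := by
      funext τ
      rw [hm]
      simp only [one_mul]
      rw [← Finset.sum_coe_sort]
      exact Finset.sum_congr rfl fun i _ => by rw [extendZero_of_mem _ i.2]
    rw [h2] at h1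
    convert h1 using 1
    have h3 := mass_deriv_zero (F := F) hR ω (extendZero F (γ t))
    have h4 : ∀ n, (1 : ℝ) * (2 * ((starRingEnd ℂ) (extendZero F (γ t) n) *
        ((χ (γ t) : ℂ) * field R F ω (extendZero F (γ t)) n)).re) = χ (γ t) *
        (2 * ((starRingEnd ℂ) (extendZero F (γ t) n) *
          field R F ω (extendZero F (γ t)) n).re) := by
      intro n
      rw [mul_left_comm ((starRingEnd ℂ) _), Complex.re_ofReal_mul]; ring
    simp only [h4]
    rw [← Finset.mul_sum, h3, mul_zero]
  have hconst : ∀ t, m (γ t) = m g₀ := by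
    intro t
    rw [← hγ0]
    exact is_const_of_deriv_eq_zero (fun t => (hmass t).differentiableAt)
      (fun t => (hmass t).deriv) t 0
  have hχ1 : ∀ t, χ (γ t) = 1 := fun t =>
    Real.smoothTransition.one_of_one_le (by rw [hconst]; linarith)
  refine ⟨fun t => extendZero F (γ t), ?_, ⟨fun t n hn => dif_neg hn, fun t n hn => ?_⟩⟩
  · funext n
    change extendZero F (γ 0) n = a₀ n
    by_cases hn : n ∈ F
    · rw [extendZero_of_mem _ hn, hγ0]
    · rw [ha₀ n hn]
      exact dif_neg hn
  · simp only [extendZero_of_mem _ hn]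
    simpa only [hY, hXdef, hχ1, one_smul] using hγi t ⟨n, hn⟩

namespace IsFlow

variable {A : ℝ → α → ℂ}

theorem mass_eq (hR : SymmRel R) (hA : IsFlow R F ω A) (t : ℝ) :
    ∑ n ∈ F, ‖A t n‖ ^ 2 = ∑ n ∈ F, ‖A 0 n‖ ^ 2 := by
  have h : ∀ t, HasDerivAt (fun τ => ∑ n ∈ F, ‖A τ n‖ ^ 2) 0 t := by
    intro t
    have h1 := HasDerivAt.sum_weight_normSq (F := F) (hA.deriv t) (fun _ => 1)
    simp only [one_mul] at h1
    rwa [mass_deriv_zero hR] at h1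
  exact is_const_of_deriv_eq_zero (fun t => (h t).differentiableAt)
      (fun t => (h t).deriv) t 0

/-- Conservation of the energy. -/
theorem energy_eq (hR : SymmRel R) (hA : IsFlow R F ω A) (t : ℝ) :
    ∑ n ∈ F, ω n * ‖A t n‖ ^ 2 + (quad R F (A t) (A t) (A t) (A t)).re / 2 =
      ∑ n ∈ F, ω n * ‖A 0 n‖ ^ 2 + (quad R F (A 0) (A 0) (A 0) (A 0)).re / 2 := by
  have h : ∀ t, HasDerivAt (fun τ => ∑ n ∈ F, ω n * ‖A τ n‖ ^ 2 +
      (quad R F (A τ) (A τ) (A τ) (A τ)).re / 2) 0 t := by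
    intro t
    have h1 := HasDerivAt.sum_weight_normSq (F := F) (hA.deriv t) ω
    set D : α → ℂ := field R F ω (A t) with hD
    have h2 : HasDerivAt (fun τ => quad R F (A τ) (A τ) (A τ) (A τ))
        (quad R F D (A t) (A t) (A t) + (quad R F (A t) D (A t) (A t) +
          quad R F (A t) (A t) D (A t) + quad R F (A t) (A t) (A t) D)) t := by
      unfold quad
      simp only [← Finset.sum_add_distrib]
      refine HasDerivAt.fun_sum fun w hw => ?_
      have h3 : HasDerivAt (fun τ => (starRingEnd ℂ) (A τ w)) ((starRingEnd ℂ) (D w)) t :=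
        (hA.deriv t w hw).star
      have h4 := HasDerivAt.cub (R := R) (F := F) (a := A) (a' := fun _ => D) (hA.deriv t) w
      convert! h3.mul h4 using 1
      ring
    set S := quad R F D (A t) (A t) (A t) with hS
    have e1 : quad R F (A t) (A t) (A t) D = (starRingEnd ℂ) S := quad_conj hR _ _ _ _
    have e2 : quad R F (A t) D (A t) (A t) = (starRingEnd ℂ) S := by
      rw [quad_swap hR, e1]
    have e3 : quad R F (A t) (A t) D (A t) = S := by
      rw [quad_conj hR, e2, Complex.conj_conj]
    rw [e1, e2, e3] at h2
    have h5 : HasDerivAt (fun τ => (quad R F (A τ) (A τ) (A τ) (A τ)).re) (4 * S.re) t := by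
      have := Complex.reCLM.hasFDerivAt.comp_hasDerivAt t h2
      convert! this using 1
      simp only [Complex.reCLM_apply, Complex.add_re, Complex.conj_re]; ring
    have h6 := h1.add (h5.div_const 2)
    convert! h6 using 1
    have h7 : S.re = - ∑ n ∈ F, ω n * ((starRingEnd ℂ) (A t n) * D n).re := by
      rw [hS, quad, Complex.re_sum, ← Finset.sum_neg_distrib]
      refine Finset.sum_congr rfl fun n _ => ?_
      have h8 : cub R F (A t) (A t) (A t) n = -Complex.I * D n - ω n * A t n := by
        rw [hD, field, ← mul_assoc, neg_mul, Complex.I_mul_I]; ring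
      rw [h8]
      simp only [Complex.mul_re, Complex.sub_re, Complex.sub_im, Complex.mul_im,
        Complex.conj_re, Complex.conj_im, Complex.ofReal_re, Complex.ofReal_im, Complex.neg_re,
        Complex.neg_im, Complex.I_re, Complex.I_im]
      ring
    rw [h7]
    have h9 : ∀ n, ω n * (2 * ((starRingEnd ℂ) (A t n) * D n).re) =
        2 * (ω n * ((starRingEnd ℂ) (A t n) * D n).re) := fun n => by ring
    simp only [h9]
    rw [← Finset.mul_sum]
    ring
  exact is_const_of_deriv_eq_zero (fun t => (h t).differentiableAt)
      (fun t => (h t).deriv) t 0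

end IsFlow

end Flow

/-! ### Estimates for the convolution interaction -/

/-- The interaction relation of the cubic equation. -/
def ConvRel (x y z w : Z2) : Prop := x - y + z = w

theorem symmRel_convRel : SymmRel ConvRel where
  outer x y z w h := by unfold ConvRel at *; rw [← h]; abel
  conj x y z w h := by unfold ConvRel at *; rw [← h]; abel

theorem nsq_nonneg (n : Z2) : 0 ≤ nsq n := by unfold nsq; positivity

/-- A fencing principle for the `ℓ¹` norm of a finite family of curves. -/
theorem sum_norm_le_of_deriv_lt {ι : Type*} (s : Finset ι) (f f' : ι → ℝ → ℂ)
    (hf : ∀ n ∈ s, ∀ t, HasDerivAt (f n) (f' n t) t) {B B' : ℝ → ℝ}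
    (hB : ∀ t, HasDerivAt B (B' t) t) (h0 : ∑ n ∈ s, ‖f n 0‖ ≤ B 0) {T : ℝ}
    (bound : ∀ t ∈ Set.Ico 0 T, ∑ n ∈ s, ‖f n t‖ = B t → ∑ n ∈ s, ‖f' n t‖ < B' t)
    {t : ℝ} (ht : t ∈ Set.Icc 0 T) : ∑ n ∈ s, ‖f n t‖ ≤ B t := by
  let e := (PiLp.continuousLinearEquiv 1 ℝ (fun _ : s => ℂ)).symm
  let g : ℝ → PiLp 1 (fun _ : s => ℂ) := fun t => e (fun i => f i t)
  let g' : ℝ → PiLp 1 (fun _ : s => ℂ) := fun t => e (fun i => f' i t)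
  have hg : ∀ t, HasDerivAt g (g' t) t := fun t =>
    e.toContinuousLinearMap.hasFDerivAt.comp_hasDerivAt t
      (hasDerivAt_pi.mpr fun i : s => hf i i.2 t)
  have hn : ∀ t, ‖g t‖ = ∑ n ∈ s, ‖f n t‖ := fun t => by
    rw [PiLp.norm_eq_of_L1, ← Finset.sum_coe_sort s]; rfl
  have hn' : ∀ t, ‖g' t‖ = ∑ n ∈ s, ‖f' n t‖ := fun t => by
    rw [PiLp.norm_eq_of_L1, ← Finset.sum_coe_sort s]; rfl
  have := image_norm_le_of_norm_deriv_right_lt_deriv_boundary (f := g) (f' := g') (a := 0)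
    (b := T) (fun t _ => (hg t).continuousAt.continuousWithinAt)
    (fun t _ => (hg t).hasDerivWithinAt) (by rw [hn]; exact h0) hB
    (fun t ht h => by rw [hn] at h; rw [hn']; exact bound t ht h) ht
  rwa [hn] at this

/-- Young's inequality for the convolution interaction, with a quasi-subadditive weight. -/
theorem sum_weight_norm_cub_le (F S : Finset Z2) (a b c : Z2 → ℂ) (u : Z2 → ℝ)
    (C : ℝ) (hu0 : ∀ n, 0 ≤ u n) (hu : ∀ x y z, u (x - y + z) ≤ C * (u x + u y + u z)) :
    ∑ n ∈ S, u n * ‖cub ConvRel F a b c n‖ ≤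
      C * ((∑ n ∈ F, u n * ‖a n‖) * (∑ n ∈ F, ‖b n‖) * (∑ n ∈ F, ‖c n‖)
        + (∑ n ∈ F, ‖a n‖) * (∑ n ∈ F, u n * ‖b n‖) * (∑ n ∈ F, ‖c n‖)
        + (∑ n ∈ F, ‖a n‖) * (∑ n ∈ F, ‖b n‖) * (∑ n ∈ F, u n * ‖c n‖)) := by
  classical
  have h1 : ∀ n, u n * ‖cub ConvRel F a b c n‖ ≤ ∑ x ∈ F, ∑ y ∈ F, ∑ z ∈ F,
      if x - y + z = n then u (x - y + z) * (‖a x‖ * ‖b y‖ * ‖c z‖) else 0 := by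
    intro n
    have h2 : ‖cub ConvRel F a b c n‖ ≤ ∑ x ∈ F, ∑ y ∈ F, ∑ z ∈ F,
        if x - y + z = n then (‖a x‖ * ‖b y‖ * ‖c z‖) else 0 := by
      unfold cub
      refine (norm_sum_le _ _).trans (Finset.sum_le_sum fun x _ => (norm_sum_le _ _).trans
        (Finset.sum_le_sum fun y _ => (norm_sum_le _ _).trans
        (Finset.sum_le_sum fun z _ => ?_)))
      by_cases h : x - y + z = n
      · rw [if_pos h, if_pos (show ConvRel x y z n from h)]
        simp
      · rw [if_neg h, if_neg (show ¬ ConvRel x y z n from h)]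
        simp
    refine (mul_le_mul_of_nonneg_left h2 (hu0 n)).trans (le_of_eq ?_)
    simp only [Finset.mul_sum]
    refine Finset.sum_congr rfl fun x _ => Finset.sum_congr rfl fun y _ =>
      Finset.sum_congr rfl fun z _ => ?_
    split_ifs with h
    · rw [h]
    · simp
  have h3 : ∑ n ∈ S, u n * ‖cub ConvRel F a b c n‖ ≤
      ∑ x ∈ F, ∑ y ∈ F, ∑ z ∈ F, u (x - y + z) * (‖a x‖ * ‖b y‖ * ‖c z‖) := by
    refine (Finset.sum_le_sum fun n _ => h1 n).trans ?_
    rw [Finset.sum_comm]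
    refine Finset.sum_le_sum fun x _ => ?_
    rw [Finset.sum_comm]
    refine Finset.sum_le_sum fun y _ => ?_
    rw [Finset.sum_comm]
    refine Finset.sum_le_sum fun z _ => ?_
    rw [Finset.sum_ite_eq]
    split_ifs
    · exact le_rfl
    · exact mul_nonneg (hu0 _) (by positivity)
  refine h3.trans ?_
  have h4 : ∑ x ∈ F, ∑ y ∈ F, ∑ z ∈ F, u (x - y + z) * (‖a x‖ * ‖b y‖ * ‖c z‖) ≤
      ∑ x ∈ F, ∑ y ∈ F, ∑ z ∈ F, C * ((u x * ‖a x‖) * ‖b y‖ * ‖c z‖ +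
        ‖a x‖ * (u y * ‖b y‖) * ‖c z‖ + ‖a x‖ * ‖b y‖ * (u z * ‖c z‖)) := by
    refine Finset.sum_le_sum fun x _ => Finset.sum_le_sum fun y _ =>
      Finset.sum_le_sum fun z _ => ?_
    have := mul_le_mul_of_nonneg_right (hu x y z)
      (show 0 ≤ ‖a x‖ * ‖b y‖ * ‖c z‖ by positivity)
    linarith
  refine h4.trans (le_of_eq ?_)
  simp only [← Finset.mul_sum, ← Finset.sum_mul, Finset.sum_add_distrib]

theorem sum_norm_cub_le (F S : Finset Z2) (a b c : Z2 → ℂ) :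
    ∑ n ∈ S, ‖cub ConvRel F a b c n‖ ≤
      (∑ n ∈ F, ‖a n‖) * (∑ n ∈ F, ‖b n‖) * (∑ n ∈ F, ‖c n‖) := by
  have := sum_weight_norm_cub_le F S a b c (fun _ => 1) (1 / 3) (fun _ => zero_le_one)
    (fun _ _ _ => by norm_num)
  simp only [one_mul] at this
  linarith

/-- The polynomial weights `(1+|n|²)^k`. -/
def wt (k : ℕ) (n : Z2) : ℝ := (1 + nsq n) ^ k

theorem one_le_wt (k : ℕ) (n : Z2) : 1 ≤ wt k n :=
  one_le_pow₀ (by linarith [nsq_nonneg n])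

theorem wt_nonneg (k : ℕ) (n : Z2) : 0 ≤ wt k n := zero_le_one.trans (one_le_wt k n)

theorem wt_conv_le (k : ℕ) (x y z : Z2) :
    wt k (x - y + z) ≤ 9 ^ k * (wt k x + wt k y + wt k z) := by
  have hx := nsq_nonneg x
  have hy := nsq_nonneg y
  have hz := nsq_nonneg z
  have h1 : 1 + nsq (x - y + z) ≤ 3 * ((1 + nsq x) + (1 + nsq y) + (1 + nsq z)) := by
    unfold nsq
    simp only [Prod.fst_add, Prod.fst_sub, Prod.snd_add, Prod.snd_sub, Int.cast_add,
      Int.cast_sub]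
    nlinarith [sq_nonneg ((x.1 : ℝ) + y.1), sq_nonneg ((x.1 : ℝ) - z.1),
      sq_nonneg ((y.1 : ℝ) + z.1), sq_nonneg ((x.2 : ℝ) + y.2), sq_nonneg ((x.2 : ℝ) - z.2),
      sq_nonneg ((y.2 : ℝ) + z.2)]
  have h0 : 0 ≤ 1 + nsq (x - y + z) := by linarith [nsq_nonneg (x - y + z)]
  have key : ∀ p : Z2, 1 + nsq (x - y + z) ≤ 9 * (1 + nsq p) →
      wt k (x - y + z) ≤ 9 ^ k * wt k p := by
    intro p hp
    unfold wt
    rw [← mul_pow]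
    exact pow_le_pow_left₀ h0 hp k
  have h9 : (0 : ℝ) ≤ 9 ^ k := by positivity
  have wx := mul_nonneg h9 (wt_nonneg k x)
  have wy := mul_nonneg h9 (wt_nonneg k y)
  have wz := mul_nonneg h9 (wt_nonneg k z)
  rcases le_total (nsq x) (nsq y) with hxy | hxy <;> rcases le_total (nsq y) (nsq z) with hyz | hyz
    <;> rcases le_total (nsq x) (nsq z) with hxz | hxz
  all_goals first
    | (have := key x (by linarith); linarith)
    | (have := key y (by linarith); linarith)
    | (have := key z (by linarith); linarith)

/-! ### Square boxes and the logarithmic sum -/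

/-- The modes of sup norm at most `N`. -/
def sqBox (N : ℕ) : Finset Z2 := Finset.Icc (-(N : Z2)) (N : Z2)

theorem mem_sqBox {N : ℕ} {n : Z2} : n ∈ sqBox N ↔ |n.1| ≤ N ∧ |n.2| ≤ N := by
  simp only [sqBox, Finset.mem_Icc, Prod.le_def, abs_le]
  simp
  tauto

theorem sqBox_mono : Monotone sqBox := by
  intro N M h n hn
  rw [mem_sqBox] at *
  have : (N : ℤ) ≤ M := by exact_mod_cast h
  exact ⟨hn.1.trans this, hn.2.trans this⟩

theorem sq_le_nsq_of_notMem_sqBox {N : ℕ} {n : Z2} (h : n ∉ sqBox N) : (N : ℝ) ^ 2 ≤ nsq n := by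
  rw [mem_sqBox, not_and_or, not_le, not_le] at h
  unfold nsq
  have key : ∀ m : ℤ, (N : ℤ) < |m| → (N : ℝ) ^ 2 ≤ (m : ℝ) ^ 2 := by
    intro m hm
    rw [← sq_abs (m : ℝ)]
    have : (N : ℝ) ≤ |(m : ℝ)| := by exact_mod_cast hm.le
    exact pow_le_pow_left₀ (Nat.cast_nonneg N) this 2
  rcases h with h | h
  · nlinarith [key _ h, sq_nonneg (n.2 : ℝ)]
  · nlinarith [key _ h, sq_nonneg (n.1 : ℝ)]

theorem exists_subset_sqBox (Λ : Finset Z2) : ∃ N, ∀ M, N ≤ M → Λ ⊆ sqBox M := by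
  classical
  refine ⟨∑ n ∈ Λ, (n.1.natAbs + n.2.natAbs), fun M hM n hn => ?_⟩
  have h1 : n.1.natAbs + n.2.natAbs ≤ M :=
    (Finset.single_le_sum (f := fun n : Z2 => n.1.natAbs + n.2.natAbs)
      (fun _ _ => Nat.zero_le _) hn).trans hM
  rw [mem_sqBox, Int.abs_eq_natAbs, Int.abs_eq_natAbs]
  omega

theorem sum_inv_one_add_nsq_le (N : ℕ) :
    ∑ n ∈ sqBox N, (1 + nsq n)⁻¹ ≤ 1 + 8 * ∑ i ∈ Finset.range N, ((i : ℝ) + 1)⁻¹ := by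
  induction N with
  | zero =>
    have : sqBox 0 = {0} := by simp [sqBox]
    simp [this, nsq]
  | succ N ih =>
    have h := Finset.box_succ_disjUnion (α := Z2) N
    have hd : Disjoint (Finset.box (N + 1)) (sqBox N) := Finset.disjoint_box_succ_prod N
    have h' : sqBox (N + 1) = (Finset.box (N + 1)).disjUnion (sqBox N) hd := h.symm
    rw [h', Finset.sum_disjUnion, Finset.sum_range_succ]
    have h2 : ∑ n ∈ (Finset.box (N + 1) : Finset Z2), (1 + nsq n)⁻¹ ≤
        ∑ n ∈ (Finset.box (N + 1) : Finset Z2), ((N + 1 : ℝ) ^ 2)⁻¹ := by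
      refine Finset.sum_le_sum fun n hn => ?_
      have h3 : n ∉ sqBox N := fun hn' =>
        Finset.disjoint_left.mp (Finset.disjoint_box_succ_prod N) hn hn'
      rw [Int.mem_box] at hn
      have h4 : (N + 1 : ℝ) ^ 2 ≤ nsq n := by
        unfold nsq
        have key : ∀ m : ℤ, m.natAbs = N + 1 → (N + 1 : ℝ) ^ 2 = (m : ℝ) ^ 2 := by
          intro m hm
          rw [← sq_abs (m : ℝ), ← Int.cast_abs, Int.abs_eq_natAbs, hm]; push_cast; ring
        rcases le_total n.1.natAbs n.2.natAbs with hle | hle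
        · rw [max_eq_right hle] at hn
          nlinarith [key _ hn, sq_nonneg (n.1 : ℝ)]
        · rw [max_eq_left hle] at hn
          nlinarith [key _ hn, sq_nonneg (n.2 : ℝ)]
      exact inv_anti₀ (by positivity) (by linarith)
    rw [Finset.sum_const, Int.card_box (Nat.succ_ne_zero N), nsmul_eq_mul] at h2
    have h5 : ((8 * (N + 1) : ℕ) : ℝ) * ((N + 1 : ℝ) ^ 2)⁻¹ = 8 * ((N : ℝ) + 1)⁻¹ := by
      push_cast; field_simp
    rw [h5] at h2
    linarith

theorem sum_inv_one_add_nsq_le_log (N : ℕ) :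
    ∑ n ∈ sqBox N, (1 + nsq n)⁻¹ ≤ 9 + 8 * Real.log N := by
  have h1 := harmonic_le_one_add_log N
  have h2 := sum_inv_one_add_nsq_le N
  unfold harmonic at h1
  push_cast at h1
  linarith

section SolutionBounds

/-! ### A priori bounds for the truncated equations -/

/-- The unimodular factor `exp(-i ω t)`. -/
def phase (ω t : ℝ) : ℂ := Complex.exp (((-(ω * t) : ℝ) : ℂ) * Complex.I)

theorem norm_phase (ω t : ℝ) : ‖phase ω t‖ = 1 := Complex.norm_exp_ofReal_mul_I _

theorem phase_zero (ω : ℝ) : phase ω 0 = 1 := by simp [phase]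

theorem hasDerivAt_phase (ω t : ℝ) :
    HasDerivAt (fun τ => phase ω τ) (phase ω t * (-(ω : ℂ) * Complex.I)) t := by
  unfold phase
  have h1 : HasDerivAt (fun τ : ℝ => -(ω * τ)) (-ω) t := by
    simpa using! ((hasDerivAt_id t).const_mul ω).neg
  have h2 := (h1.ofReal_comp.mul_const Complex.I).cexp
  simpa using h2

section Apriori

variable {α : Type*} {R : α → α → α → α → Prop} {F : Finset α} {ω : α → ℝ} {A : ℝ → α → ℂ}

theorem IsFlow.hasDerivAt_phase_mul (hA : IsFlow R F ω A) {n : α} (hn : n ∈ F) (t : ℝ) :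
    HasDerivAt (fun τ => phase (ω n) τ * A τ n)
      (phase (ω n) t * (Complex.I * cub R F (A t) (A t) (A t) n)) t := by
  convert! (hasDerivAt_phase (ω n) t).mul (hA.deriv t n hn) using 1
  simp only [field]; ring

/-- Time reversal. -/
theorem IsFlow.reverse (hA : IsFlow R F ω A) :
    IsFlow R F ω (fun t n => (starRingEnd ℂ) (A (-t) n)) := by
  refine ⟨fun t n hn => by rw [hA.zero _ n hn, map_zero], fun t n hn => ?_⟩
  have h1 := (HasDerivAt.scomp t (hA.deriv (-t) n hn) (hasDerivAt_neg t)).star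
  convert! h1 using 1
  simp only [field, cub, neg_smul, one_smul, star_neg, star_mul']
  rw [Complex.star_def]
  simp only [map_add, map_mul, map_sum, Complex.conj_I, Complex.conj_ofReal, apply_ite, map_zero,
    Complex.conj_conj]
  ring

end Apriori

variable {F : Finset Z2} {ω : Z2 → ℝ} {A : ℝ → Z2 → ℂ}

theorem quad_convRel_nonneg (a : Z2 → ℂ) : 0 ≤ (quad ConvRel F a a a a).re := by
  classical
  let P := (F ×ˢ F).image fun p => p.1 + p.2
  let S : Z2 → ℂ := fun k => ∑ x ∈ F, ∑ z ∈ F, if x + z = k then a x * a z else 0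
  have h : quad ConvRel F a a a a = ∑ k ∈ P, (starRingEnd ℂ) (S k) * S k := by
    have h1 : ∀ k ∈ P, (starRingEnd ℂ) (S k) * S k = ∑ w ∈ F, ∑ x ∈ F, ∑ y ∈ F, ∑ z ∈ F,
        if w + y = k then (if x + z = k then
          (starRingEnd ℂ) (a w) * (a x * (starRingEnd ℂ) (a y) * a z) else 0) else 0 := by
      intro k _
      simp only [S, map_sum, Finset.sum_mul]
      refine Finset.sum_congr rfl fun w _ => ?_
      simp only [Finset.mul_sum]
      rw [Finset.sum_comm]
      refine Finset.sum_congr rfl fun x _ => Finset.sum_congr rfl fun y _ =>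
        Finset.sum_congr rfl fun z _ => ?_
      split_ifs <;> simp <;> ring
    rw [Finset.sum_congr rfl h1, quad_eq]
    symm
    rw [Finset.sum_comm]
    refine Finset.sum_congr rfl fun w hw => ?_
    rw [Finset.sum_comm]
    refine Finset.sum_congr rfl fun x hx => ?_
    rw [Finset.sum_comm]
    refine Finset.sum_congr rfl fun y hy => ?_
    rw [Finset.sum_comm]
    refine Finset.sum_congr rfl fun z hz => ?_
    rw [Finset.sum_ite_eq, if_pos (Finset.mem_image.mpr ⟨(w, y), by simp [hw, hy], rfl⟩)]
    have : ConvRel x y z w ↔ x + z = w + y := by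
      unfold ConvRel
      constructor
      · intro h; rw [← h]; abel
      · intro h; rw [sub_add_eq_add_sub, h]; abel
    by_cases hc : x + z = w + y
    · rw [if_pos hc, if_pos (this.mpr hc)]
    · rw [if_neg hc, if_neg (mt this.mp hc)]
  rw [h, Complex.re_sum]
  refine Finset.sum_nonneg fun k _ => ?_
  rw [← Complex.normSq_eq_conj_mul_self, Complex.ofReal_re]
  exact Complex.normSq_nonneg _

theorem norm_quad_convRel_le (a : Z2 → ℂ) :
    ‖quad ConvRel F a a a a‖ ≤ (∑ n ∈ F, ‖a n‖) ^ 4 := by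
  unfold quad
  have h1 : ∀ w ∈ F, ‖(starRingEnd ℂ) (a w) * cub ConvRel F a a a w‖ ≤
      (∑ n ∈ F, ‖a n‖) * ‖cub ConvRel F a a a w‖ := by
    intro w hw
    rw [norm_mul, RCLike.norm_conj]
    exact mul_le_mul_of_nonneg_right
      (Finset.single_le_sum (f := fun n => ‖a n‖) (fun _ _ => norm_nonneg _) hw) (norm_nonneg _)
  refine (norm_sum_le _ _).trans ((Finset.sum_le_sum h1).trans ?_)
  rw [← Finset.mul_sum]
  have h2 := sum_norm_cub_le F F a a a
  have h0 : 0 ≤ ∑ n ∈ F, ‖a n‖ := Finset.sum_nonneg fun _ _ => norm_nonneg _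
  calc _ ≤ (∑ n ∈ F, ‖a n‖) * ((∑ n ∈ F, ‖a n‖) * (∑ n ∈ F, ‖a n‖) * (∑ n ∈ F, ‖a n‖)) :=
        mul_le_mul_of_nonneg_left h2 h0
    _ = _ := by ring

theorem IsFlow.energy_bound (hA : IsFlow ConvRel F ω A) {b H : ℝ}
    (hω : ∀ n, |ω n - nsq n| ≤ b)
    (hH : (1 + 2 * b) * (∑ n ∈ F, (1 + nsq n) * ‖A 0 n‖ ^ 2) + (∑ n ∈ F, ‖A 0 n‖) ^ 4 / 2 ≤ H)
    (t : ℝ) : ∑ n ∈ F, (1 + nsq n) * ‖A t n‖ ^ 2 ≤ H := by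
  have hb : 0 ≤ b := (abs_nonneg _).trans (hω 0)
  have hM := hA.mass_eq symmRel_convRel t
  have hE := hA.energy_eq symmRel_convRel t
  have hq := quad_convRel_nonneg (F := F) (A t)
  have hq0 := (Complex.re_le_norm _).trans (norm_quad_convRel_le (F := F) (A 0))
  have h1 : ∑ n ∈ F, (1 + nsq n) * ‖A t n‖ ^ 2 ≤
      ∑ n ∈ F, ω n * ‖A t n‖ ^ 2 + (1 + b) * ∑ n ∈ F, ‖A t n‖ ^ 2 := by
    rw [Finset.mul_sum, ← Finset.sum_add_distrib]
    refine Finset.sum_le_sum fun n _ => ?_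
    have := (abs_le.mp (hω n)).1
    nlinarith [sq_nonneg ‖A t n‖]
  have h2 : ∑ n ∈ F, ω n * ‖A 0 n‖ ^ 2 + (1 + b) * ∑ n ∈ F, ‖A 0 n‖ ^ 2 ≤
      (1 + 2 * b) * (∑ n ∈ F, (1 + nsq n) * ‖A 0 n‖ ^ 2) := by
    rw [Finset.mul_sum, Finset.mul_sum, ← Finset.sum_add_distrib]
    refine Finset.sum_le_sum fun n _ => ?_
    have h3 := (abs_le.mp (hω n)).2
    have h4 : ω n + (1 + b) ≤ (1 + 2 * b) * (1 + nsq n) := by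
      nlinarith [nsq_nonneg n, mul_nonneg hb (nsq_nonneg n)]
    nlinarith [sq_nonneg ‖A 0 n‖]
  rw [hM] at h1
  linarith

theorem sq_sum_norm_le_log (k : ℕ) (hk : k ≠ 0) (a : Z2 → ℂ) {H B : ℝ}
    (hH : ∑ n ∈ F, (1 + nsq n) * ‖a n‖ ^ 2 ≤ H) (hB : Real.exp 1 ≤ B)
    (hW : ∑ n ∈ F, wt k n * ‖a n‖ ≤ B) :
    (∑ n ∈ F, ‖a n‖) ^ 2 ≤ (50 * H + 2) * Real.log B := by
  classical
  have he : (2 : ℝ) < Real.exp 1 := by have := Real.exp_one_gt_d9; linarith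
  have hB1 : 1 ≤ B := by linarith
  have hlog : 1 ≤ Real.log B := by
    rw [Real.le_log_iff_exp_le (by linarith)]; exact hB
  set N := ⌈B⌉₊ with hN
  have hBN : B ≤ N := Nat.le_ceil B
  have hNB : (N : ℝ) ≤ B * Real.exp 1 := by
    have := (Nat.ceil_lt_add_one (by linarith : (0 : ℝ) ≤ B)).le
    nlinarith
  have hlogN : Real.log N ≤ Real.log B + 1 := by
    refine (Real.log_le_log (by linarith) hNB).trans (le_of_eq ?_)
    rw [Real.log_mul (by linarith) (by linarith), Real.log_exp]
  have hH0 : 0 ≤ H := le_trans (Finset.sum_nonneg fun n _ =>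
    mul_nonneg (by linarith [nsq_nonneg n]) (sq_nonneg _)) hH
  rw [← Finset.sum_filter_add_sum_filter_not F (fun n => n ∈ sqBox N)]
  set head := ∑ n ∈ F with n ∈ sqBox N, ‖a n‖
  set tail := ∑ n ∈ F with n ∉ sqBox N, ‖a n‖
  have htail0 : 0 ≤ tail := Finset.sum_nonneg fun _ _ => norm_nonneg _
  have htail : tail ≤ 1 := by
    have h1 : B * tail ≤ B := by
      refine le_trans ?_ hW
      refine le_trans ?_ (Finset.sum_le_sum_of_subset_of_nonneg
        (Finset.filter_subset (fun n => n ∉ sqBox N) F)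
        (fun n _ _ => mul_nonneg (wt_nonneg k n) (norm_nonneg _)))
      rw [Finset.mul_sum]
      refine Finset.sum_le_sum fun n hn => mul_le_mul_of_nonneg_right ?_ (norm_nonneg _)
      have h2 := sq_le_nsq_of_notMem_sqBox (Finset.mem_filter.mp hn).2
      have h3 : 1 + nsq n ≤ wt k n := le_self_pow₀ (by linarith [nsq_nonneg n]) hk
      nlinarith
    by_contra hcon
    push Not at hcon
    nlinarith
  have hhead : head ^ 2 ≤ H * (9 + 8 * Real.log N) := by
    have h1 := Finset.sum_mul_sq_le_sq_mul_sq (F.filter fun n => n ∈ sqBox N)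
      (fun n => √(1 + nsq n) * ‖a n‖) (fun n => (√(1 + nsq n))⁻¹)
    have h2 : ∀ n : Z2, 0 < √(1 + nsq n) := fun n =>
      Real.sqrt_pos.mpr (by linarith [nsq_nonneg n])
    have h3 : ∀ n : Z2, √(1 + nsq n) ^ 2 = 1 + nsq n := fun n =>
      Real.sq_sqrt (by linarith [nsq_nonneg n])
    have h4 : ∀ n : Z2, √(1 + nsq n) * ‖a n‖ * (√(1 + nsq n))⁻¹ = ‖a n‖ := fun n => by
      have := (h2 n).ne'
      field_simp
    simp only [h4, mul_pow, inv_pow, h3] at h1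
    refine h1.trans (mul_le_mul ?_ ?_ ?_ hH0)
    · refine le_trans (Finset.sum_le_sum_of_subset_of_nonneg (Finset.filter_subset _ F)
        (fun n _ _ => mul_nonneg (by linarith [nsq_nonneg n]) (sq_nonneg _))) hH
    · refine le_trans (Finset.sum_le_sum_of_subset_of_nonneg
        (fun n hn => (Finset.mem_filter.mp hn).2)
        (fun n _ _ => inv_nonneg.mpr (by linarith [nsq_nonneg n])))
        (sum_inv_one_add_nsq_le_log N)
    · exact Finset.sum_nonneg fun n _ => inv_nonneg.mpr (by linarith [nsq_nonneg n])
  have h5 : H * (9 + 8 * Real.log N) ≤ H * (25 * Real.log B) :=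
    mul_le_mul_of_nonneg_left (by linarith) hH0
  nlinarith [sq_nonneg (head - tail)]

/-- Double exponential bound for the weighted `ℓ¹` norm, uniform in the truncation. -/
theorem IsFlow.weighted_bound (hA : IsFlow ConvRel F ω A) (k : ℕ) (hk : k ≠ 0) {H D : ℝ}
    (hH : ∀ t, ∑ n ∈ F, (1 + nsq n) * ‖A t n‖ ^ 2 ≤ H) (hD : 0 ≤ D)
    (h0 : ∑ n ∈ F, wt k n * ‖A 0 n‖ ≤ Real.exp (Real.exp D)) {t : ℝ} (ht : 0 ≤ t) :
    ∑ n ∈ F, wt k n * ‖A t n‖ ≤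
      Real.exp (Real.exp ((3 * 9 ^ k * (50 * H + 2) + 1) * t + D)) := by
  set C := 3 * 9 ^ k * (50 * H + 2) + 1 with hC
  have hn : ∀ τ n, ‖(wt k n : ℂ) * (phase (ω n) τ * A τ n)‖ = wt k n * ‖A τ n‖ := by
    intro τ n
    rw [norm_mul, norm_mul, norm_phase, one_mul, Complex.norm_of_nonneg (wt_nonneg k n)]
  have hH0 : 0 ≤ H := le_trans (Finset.sum_nonneg fun n _ =>
    mul_nonneg (by linarith [nsq_nonneg n]) (sq_nonneg _)) (hH 0)
  have h9 : (0 : ℝ) < 9 ^ k := by positivity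
  have hC0 : 0 < C := by positivity
  have key := sum_norm_le_of_deriv_lt F (fun n τ => (wt k n : ℂ) * (phase (ω n) τ * A τ n))
    (fun n τ => (wt k n : ℂ) * (phase (ω n) τ *
      (Complex.I * cub ConvRel F (A τ) (A τ) (A τ) n)))
    (fun n hn τ => (hA.hasDerivAt_phase_mul hn τ).const_mul _)
    (B := fun τ => Real.exp (Real.exp (C * τ + D)))
    (B' := fun τ => Real.exp (Real.exp (C * τ + D)) * (Real.exp (C * τ + D) * C))
    (fun τ => by
      have h1 : HasDerivAt (fun τ => C * τ + D) C τ := by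
        simpa using ((hasDerivAt_id τ).const_mul C).add_const D
      exact h1.exp.exp)
    (by simp only [hn]; simpa using h0) (T := t) ?_ (t := t) ⟨ht, le_rfl⟩
  · simpa only [hn] using key
  · intro τ hτ heq
    simp only [hn] at heq
    have hn' : ∀ n, ‖(wt k n : ℂ) * (phase (ω n) τ *
        (Complex.I * cub ConvRel F (A τ) (A τ) (A τ) n))‖ =
        wt k n * ‖cub ConvRel F (A τ) (A τ) (A τ) n‖ := by
      intro n
      rw [norm_mul, norm_mul, norm_mul, norm_phase, one_mul, Complex.norm_I, one_mul,
        Complex.norm_of_nonneg (wt_nonneg k n)]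
    simp only [hn']
    set B := Real.exp (Real.exp (C * τ + D)) with hB
    have hE : 1 ≤ Real.exp (C * τ + D) :=
      Real.one_le_exp (by have := mul_nonneg hC0.le hτ.1; linarith)
    have hB1 : Real.exp 1 ≤ B := Real.exp_le_exp.mpr hE
    have h1 := sq_sum_norm_le_log k hk (A τ) (hH τ) hB1 heq.le
    rw [hB, Real.log_exp] at h1
    have h2 := sum_weight_norm_cub_le F F (A τ) (A τ) (A τ) (wt k) (9 ^ k) (wt_nonneg k)
      (wt_conv_le k)
    rw [heq] at h2
    refine h2.trans_lt ?_
    have hBpos : 0 < B := Real.exp_pos _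
    set L := ∑ n ∈ F, ‖A τ n‖
    set E := Real.exp (C * τ + D)
    have h3 : 9 ^ k * (B * L * L + L * B * L + L * L * B) = 3 * 9 ^ k * B * L ^ 2 := by ring
    rw [h3]
    calc 3 * 9 ^ k * B * L ^ 2 ≤ 3 * 9 ^ k * B * ((50 * H + 2) * E) :=
          mul_le_mul_of_nonneg_left h1 (by positivity)
      _ < B * (E * C) := by
          have : 0 < B * E := by positivity
          rw [hC]; nlinarith

end SolutionBounds

/-! ### Convergence of the truncated flows -/

section CubAlgebra

variable {α : Type*} {R : α → α → α → α → Prop} {F F' : Finset α}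

theorem cub_eq_of_subset (h : F ⊆ F') {a b c : α → ℂ} (ha : ∀ n ∉ F, a n = 0)
    (hb : ∀ n ∉ F, b n = 0) (hc : ∀ n ∉ F, c n = 0) (n : α) :
    cub R F' a b c n = cub R F a b c n := by
  unfold cub
  symm
  refine (Finset.sum_subset h fun x _ hx => ?_).trans (Finset.sum_congr rfl fun x _ =>
    (Finset.sum_subset h fun y _ hy => ?_).trans (Finset.sum_congr rfl fun y _ =>
      (Finset.sum_subset h fun z _ hz => ?_)))
  · simp [ha x hx]
  · simp [hb y hy]
  · simp [hc z hz]

theorem cub_sub_cub (a b : α → ℂ) (n : α) :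
    cub R F a a a n - cub R F b b b n =
      cub R F (a - b) a a n + cub R F b (a - b) a n + cub R F b b (a - b) n := by
  unfold cub
  simp only [← Finset.sum_sub_distrib, ← Finset.sum_add_distrib]
  refine Finset.sum_congr rfl fun x _ => Finset.sum_congr rfl fun y _ =>
    Finset.sum_congr rfl fun z _ => ?_
  split_ifs
  · simp only [Pi.sub_apply, map_sub]; ring
  · simp

end CubAlgebra

theorem sum_norm_cub_sub_le (F S : Finset Z2) (a b : Z2 → ℂ) {G : ℝ}
    (ha : ∑ n ∈ F, ‖a n‖ ≤ G) (hb : ∑ n ∈ F, ‖b n‖ ≤ G) :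
    ∑ n ∈ S, ‖cub ConvRel F a a a n - cub ConvRel F b b b n‖ ≤
      3 * G ^ 2 * ∑ n ∈ F, ‖a n - b n‖ := by
  have pos : ∀ c : Z2 → ℂ, 0 ≤ ∑ n ∈ F, ‖c n‖ := fun c =>
    Finset.sum_nonneg fun _ _ => norm_nonneg _
  have hG := (pos a).trans ha
  have hd := pos (a - b)
  simp only [cub_sub_cub]
  have h1 := sum_norm_cub_le F S (a - b) a a
  have h2 := sum_norm_cub_le F S b (a - b) a
  have h3 := sum_norm_cub_le F S b b (a - b)
  have h4 : ∑ n ∈ S, ‖cub ConvRel F (a - b) a a n + cub ConvRel F b (a - b) a n +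
      cub ConvRel F b b (a - b) n‖ ≤ ∑ n ∈ S, ‖cub ConvRel F (a - b) a a n‖ +
      ∑ n ∈ S, ‖cub ConvRel F b (a - b) a n‖ + ∑ n ∈ S, ‖cub ConvRel F b b (a - b) n‖ := by
    rw [← Finset.sum_add_distrib, ← Finset.sum_add_distrib]
    exact Finset.sum_le_sum fun n _ => norm_add₃_le
  have haa := mul_le_mul ha ha (pos a) hG
  have hba := mul_le_mul hb ha (pos a) hG
  have hbb := mul_le_mul hb hb (pos b) hG
  have e : ∑ n ∈ F, ‖a n - b n‖ = ∑ n ∈ F, ‖(a - b) n‖ := rfl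
  rw [e]
  have k1 := mul_le_mul_of_nonneg_left haa hd
  have k2 := mul_le_mul_of_nonneg_left hba hd
  have k3 := mul_le_mul_of_nonneg_left hbb hd
  generalize ∑ n ∈ F, ‖(a - b) n‖ = d at *
  ring_nf at k1 k2 k3 h1 h2 h3 h4 ⊢
  linarith

/-- Stability of the truncated flows. -/
theorem IsFlow.sum_norm_sub_le {F F' : Finset Z2} {ω : Z2 → ℝ} {A A' : ℝ → Z2 → ℂ}
    (hA : IsFlow ConvRel F ω A) (hA' : IsFlow ConvRel F' ω A') (hF : F ⊆ F')
    (h0 : A 0 = A' 0) {G T ε : ℝ} (hG : 0 ≤ G) (hε : 0 < ε)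
    (hb : ∀ t ∈ Set.Icc 0 T, ∑ n ∈ F, wt 1 n * ‖A t n‖ ≤ G)
    (hb' : ∀ t ∈ Set.Icc 0 T, ∑ n ∈ F', wt 1 n * ‖A' t n‖ ≤ G)
    (htail : ∀ n ∉ F, 1 ≤ ε * wt 1 n) {t : ℝ} (ht : t ∈ Set.Icc 0 T) :
    ∑ n ∈ F', ‖A' t n - A t n‖ ≤
      ε * (27 * G ^ 3 + 3 * G ^ 2 + 1) * Real.exp ((27 * G ^ 3 + 3 * G ^ 2 + 1) * t) := by
  classical
  set K := 27 * G ^ 3 + 3 * G ^ 2 + 1 with hK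
  have hK1 : 1 ≤ K := by have : 0 ≤ 27 * G ^ 3 + 3 * G ^ 2 := by positivity
                         linarith
  let f' : Z2 → ℝ → ℂ := fun n τ => phase (ω n) τ * (Complex.I *
    (cub ConvRel F' (A' τ) (A' τ) (A' τ) n - cub ConvRel F' (A τ) (A τ) (A τ) n
      + if n ∈ F then 0 else cub ConvRel F' (A τ) (A τ) (A τ) n))
  have hext : ∀ τ n, cub ConvRel F' (A τ) (A τ) (A τ) n = cub ConvRel F (A τ) (A τ) (A τ) n :=
    fun τ n => cub_eq_of_subset hF (hA.zero τ) (hA.zero τ) (hA.zero τ) n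
  have hn : ∀ τ n, ‖phase (ω n) τ * (A' τ n - A τ n)‖ = ‖A' τ n - A τ n‖ := fun τ n => by
    rw [norm_mul, norm_phase, one_mul]
  have key := sum_norm_le_of_deriv_lt F' (fun n τ => phase (ω n) τ * (A' τ n - A τ n)) f'
    (fun n hn' τ => by
      have h1 := hA'.hasDerivAt_phase_mul hn' τ
      by_cases hnF : n ∈ F
      · have h2 := hA.hasDerivAt_phase_mul hnF τ
        have h3 := h1.sub h2
        simp only [f', hnF, if_true]
        rw [hext]
        convert! h3 using 1
        · funext τ; simp only [Pi.sub_apply]; ring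
        · ring
      · have h4 : (fun τ => phase (ω n) τ * (A' τ n - A τ n)) =
            fun τ => phase (ω n) τ * A' τ n := by
          funext τ; rw [hA.zero τ n hnF, sub_zero]
        rw [h4]
        simp only [f', hnF, if_false]
        convert! h1 using 1
        ring)
    (B := fun τ => ε * K * Real.exp (K * τ)) (B' := fun τ => ε * K * (Real.exp (K * τ) * K))
    (fun τ => by
      have h1 : HasDerivAt (fun τ => K * τ) K τ := by
        simpa using (hasDerivAt_id τ).const_mul K
      exact h1.exp.const_mul _)
    (by simp only [h0, sub_self, mul_zero, norm_zero, Finset.sum_const_zero]; positivity)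
    (T := T) ?_ ht
  · simpa only [hn] using key
  · intro τ hτ heq
    simp only [hn] at heq
    have hτ' : τ ∈ Set.Icc 0 T := ⟨hτ.1, hτ.2.le⟩
    have hl : ∀ (S : Finset Z2) (a : Z2 → ℂ), ∑ n ∈ S, ‖a n‖ ≤ ∑ n ∈ S, wt 1 n * ‖a n‖ :=
      fun S a => Finset.sum_le_sum fun n _ =>
        le_mul_of_one_le_left (norm_nonneg _) (one_le_wt 1 n)
    have hAF' : ∑ n ∈ F', wt 1 n * ‖A τ n‖ ≤ G := by
      rw [← Finset.sum_subset hF fun n _ hn => by rw [hA.zero τ n hn, norm_zero, mul_zero]]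
      exact hb τ hτ'
    have h1 := sum_norm_cub_sub_le F' F' (A' τ) (A τ) ((hl _ _).trans (hb' τ hτ'))
      ((hl _ _).trans hAF')
    have h2 : ∑ n ∈ F', ‖(if n ∈ F then 0 else cub ConvRel F' (A τ) (A τ) (A τ) n : ℂ)‖ ≤
        ε * (27 * G ^ 3) := by
      have h3 := sum_weight_norm_cub_le F' F' (A τ) (A τ) (A τ) (wt 1) (9 ^ 1) (wt_nonneg 1)
        (wt_conv_le 1)
      have h4 : ∀ n ∈ F', ‖(if n ∈ F then 0 else cub ConvRel F' (A τ) (A τ) (A τ) n : ℂ)‖ ≤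
          ε * (wt 1 n * ‖cub ConvRel F' (A τ) (A τ) (A τ) n‖) := by
        intro n _
        split_ifs with hnF
        · rw [norm_zero]
          exact mul_nonneg hε.le (mul_nonneg (wt_nonneg 1 n) (norm_nonneg _))
        · rw [← mul_assoc]
          exact le_mul_of_one_le_left (norm_nonneg _) (htail n hnF)
      refine (Finset.sum_le_sum h4).trans ?_
      rw [← Finset.mul_sum]
      refine mul_le_mul_of_nonneg_left (h3.trans ?_) hε.le
      set W := ∑ n ∈ F', wt 1 n * ‖A τ n‖
      have hL : ∑ n ∈ F', ‖A τ n‖ ≤ G := (hl _ _).trans hAF'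
      have hL0 : 0 ≤ ∑ n ∈ F', ‖A τ n‖ := Finset.sum_nonneg fun _ _ => norm_nonneg _
      set L := ∑ n ∈ F', ‖A τ n‖
      have hLL : L * L ≤ G * G := mul_le_mul hL hL hL0 hG
      have hW3 : W * (L * L) ≤ G * (G * G) := mul_le_mul hAF' hLL (by positivity) hG
      nlinarith
    have h5 : ∑ n ∈ F', ‖f' n τ‖ ≤ 3 * G ^ 2 * (ε * K * Real.exp (K * τ)) +
        ε * (27 * G ^ 3) := by
      rw [heq] at h1
      refine le_trans ?_ (add_le_add h1 h2)
      rw [← Finset.sum_add_distrib]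
      refine Finset.sum_le_sum fun n _ => ?_
      simp only [f']
      rw [norm_mul, norm_phase, one_mul, norm_mul, Complex.norm_I, one_mul]
      exact norm_add_le _ _
    refine h5.trans_lt ?_
    have hE : 1 ≤ Real.exp (K * τ) := Real.one_le_exp (mul_nonneg (by linarith) hτ.1)
    set E := Real.exp (K * τ)
    have hKE : 1 ≤ K * E := one_le_mul_of_one_le_of_one_le hK1 hE
    have hG3 : 0 ≤ 27 * G ^ 3 := by positivity
    have e1 : ε * K * (E * K) = 3 * G ^ 2 * (ε * K * E) + ε * ((27 * G ^ 3 + 1) * (K * E)) := by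
      rw [hK]; ring
    rw [e1]
    have : 27 * G ^ 3 < (27 * G ^ 3 + 1) * (K * E) := by nlinarith
    have := mul_lt_mul_of_pos_left this hε
    linarith

section Limits

/-! ### Absolutely convergent cubic sums -/

open Filter Topology

theorem sum_le_sum_of_support {α : Type*} (S F : Finset α) {f : α → ℝ} (hf : ∀ n, 0 ≤ f n)
    (hF : ∀ n ∉ F, f n = 0) : ∑ n ∈ S, f n ≤ ∑ n ∈ F, f n := by
  classical
  rw [← Finset.sum_filter_add_sum_filter_not S (· ∈ F),
    Finset.sum_eq_zero (s := S.filter (· ∉ F)) fun n hn => hF n (Finset.mem_filter.mp hn).2,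
    add_zero]
  exact Finset.sum_le_sum_of_subset_of_nonneg (fun n hn => (Finset.mem_filter.mp hn).2)
    fun n _ _ => hf n

theorem hasSum_triple {f g h : Z2 → ℝ} (hf : Summable f) (hg : Summable g) (hh : Summable h)
    (f0 : ∀ n, 0 ≤ f n) (g0 : ∀ n, 0 ≤ g n) (h0 : ∀ n, 0 ≤ h n) :
    HasSum (fun p : Triple => f p.1 * (g p.2.1 * h p.2.2))
      ((∑' n, f n) * ((∑' n, g n) * ∑' n, h n)) := by
  have s1 := hg.mul_of_nonneg hh g0 h0
  have h1 : HasSum (fun p : Z2 × Z2 => g p.1 * h p.2) ((∑' n, g n) * ∑' n, h n) :=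
    hg.hasSum.mul hh.hasSum s1
  exact hf.hasSum.mul h1 (hf.mul_of_nonneg s1 f0 fun p => mul_nonneg (g0 _) (h0 _))

theorem norm_cubicTerm (a : Z2 → ℂ) (p : Triple) :
    ‖cubicTerm a p‖ = ‖a p.1‖ * (‖a p.2.1‖ * ‖a p.2.2‖) := by
  rw [cubicTerm, norm_mul, norm_mul, RCLike.norm_conj, mul_assoc]

theorem summable_norm_cubicTerm {a : Z2 → ℂ} (ha : Summable fun n => ‖a n‖) (n : Z2) :
    Summable (fun p : {p : Triple // p.1 - p.2.1 + p.2.2 = n} => ‖cubicTerm a p.1‖) := by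
  simp only [norm_cubicTerm]
  exact (hasSum_triple ha ha ha (fun _ => norm_nonneg _) (fun _ => norm_nonneg _)
    (fun _ => norm_nonneg _)).summable.comp_injective Subtype.val_injective

theorem norm_tsum_cubicTerm_sub_le {a b : Z2 → ℂ} {G δ : ℝ} (ha : Summable fun n => ‖a n‖)
    (hb : Summable fun n => ‖b n‖) (haG : ∑' n, ‖a n‖ ≤ G) (hbG : ∑' n, ‖b n‖ ≤ G)
    (hδ : ∑' n, ‖a n - b n‖ ≤ δ) (n : Z2) :
    ‖∑' p : {p : Triple // p.1 - p.2.1 + p.2.2 = n}, cubicTerm a p.1 -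
      ∑' p : {p : Triple // p.1 - p.2.1 + p.2.2 = n}, cubicTerm b p.1‖ ≤ 3 * G ^ 2 * δ := by
  have hd : Summable fun n => ‖a n - b n‖ :=
    Summable.of_nonneg_of_le (fun _ => norm_nonneg _) (fun _ => norm_sub_le _ _) (ha.add hb)
  have nn : ∀ c : Z2 → ℂ, ∀ n, 0 ≤ ‖c n‖ := fun _ _ => norm_nonneg _
  have h1 := hasSum_triple hd ha ha (nn (a - b)) (nn a) (nn a)
  have h2 := hasSum_triple hb hd ha (nn b) (nn (a - b)) (nn a)
  have h3 := hasSum_triple hb hb hd (nn b) (nn b) (nn (a - b))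
  have h4 := (h1.add h2).add h3
  rw [← ((summable_norm_cubicTerm ha n).of_norm).tsum_sub (summable_norm_cubicTerm hb n).of_norm]
  have h5 : ∀ p : Triple, ‖cubicTerm a p - cubicTerm b p‖ ≤
      ‖a p.1 - b p.1‖ * (‖a p.2.1‖ * ‖a p.2.2‖) + ‖b p.1‖ * (‖a p.2.1 - b p.2.1‖ * ‖a p.2.2‖)
        + ‖b p.1‖ * (‖b p.2.1‖ * ‖a p.2.2 - b p.2.2‖) := by
    intro p
    have e : cubicTerm a p - cubicTerm b p =
        (a p.1 - b p.1) * ((starRingEnd ℂ) (a p.2.1) * a p.2.2) +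
        b p.1 * ((starRingEnd ℂ) (a p.2.1 - b p.2.1) * a p.2.2) +
        b p.1 * ((starRingEnd ℂ) (b p.2.1) * (a p.2.2 - b p.2.2)) := by
      simp only [cubicTerm, map_sub]; ring
    rw [e]
    refine norm_add₃_le.trans (le_of_eq ?_)
    simp only [norm_mul, RCLike.norm_conj]
  have h6 : Summable fun p : {p : Triple // p.1 - p.2.1 + p.2.2 = n} =>
      ‖cubicTerm a p.1 - cubicTerm b p.1‖ :=
    (Summable.of_nonneg_of_le (fun _ => norm_nonneg _) h5 h4.summable).comp_injective
      Subtype.val_injective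
  refine (norm_tsum_le_tsum_norm h6).trans ?_
  have h7 : ∑' p : {p : Triple // p.1 - p.2.1 + p.2.2 = n},
      ‖cubicTerm a p.1 - cubicTerm b p.1‖ ≤ _ :=
    h6.tsum_le_tsum (fun p => h5 p.1) (h4.summable.comp_injective Subtype.val_injective)
  refine h7.trans ((tsum_comp_le_tsum_of_inj h4.summable (fun p => by positivity)
    Subtype.val_injective).trans ?_)
  rw [h4.tsum_eq]
  have ta : 0 ≤ ∑' n, ‖a n‖ := tsum_nonneg fun _ => norm_nonneg _
  have tb : 0 ≤ ∑' n, ‖b n‖ := tsum_nonneg fun _ => norm_nonneg _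
  have td : 0 ≤ ∑' n, ‖a n - b n‖ := tsum_nonneg fun _ => norm_nonneg _
  have hG := ta.trans haG
  have k1 := mul_le_mul hδ (mul_le_mul haG haG ta hG) (by positivity) (td.trans hδ)
  have k2 := mul_le_mul hδ (mul_le_mul hbG haG ta hG) (by positivity) (td.trans hδ)
  have k3 := mul_le_mul hδ (mul_le_mul hbG hbG tb hG) (by positivity) (td.trans hδ)
  ring_nf at k1 k2 k3 ⊢
  linarith

theorem tsum_cubicTerm_eq_cub {a : Z2 → ℂ} {F : Finset Z2} (ha : ∀ n ∉ F, a n = 0) (n : Z2) :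
    ∑' p : {p : Triple // p.1 - p.2.1 + p.2.2 = n}, cubicTerm a p.1 = cub ConvRel F a a a n := by
  classical
  have h1 := tsum_subtype {p : Triple | p.1 - p.2.1 + p.2.2 = n} (cubicTerm a)
  refine h1.trans ?_
  rw [tsum_eq_sum (s := F ×ˢ F ×ˢ F), Finset.sum_product]
  · unfold cub
    refine Finset.sum_congr rfl fun x _ => ?_
    rw [Finset.sum_product]
    refine Finset.sum_congr rfl fun y _ => Finset.sum_congr rfl fun z _ => ?_
    simp only [Set.indicator, Set.mem_ofPred_eq, ConvRel, cubicTerm]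
    congr
  · intro p hp
    have : cubicTerm a p = 0 := by
      simp only [Finset.mem_product, not_and_or] at hp
      unfold cubicTerm
      rcases hp with h | h | h <;> simp [ha _ h]
    simp [Set.indicator, this]

/-! ### Global solutions of the full equation -/

section GlobalSolution

variable {v : Z2 → ℝ} {b : ℝ} {Λ : Finset Z2} {a₀ : Z2 → ℂ} {N₀ : ℕ} {A : ℕ → ℝ → Z2 → ℂ}

/-- The Galerkin approximations obey weighted bounds uniform in the truncation. -/
theorem galerkin_weighted_bound (hv : ∀ n, |v n| ≤ b) (ha₀ : ∀ n ∉ Λ, a₀ n = 0)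
    (hN₀ : ∀ M, N₀ ≤ M → Λ ⊆ sqBox M) (h0 : ∀ N, A N 0 = a₀)
    (hA : ∀ N, IsFlow ConvRel (sqBox (N + N₀)) (fun n => nsq n + v n) (A N))
    (k : ℕ) (hk : k ≠ 0) (T : ℝ) :
    ∃ G, 0 ≤ G ∧ ∀ N t, |t| ≤ T → ∀ S : Finset Z2, ∑ n ∈ S, wt k n * ‖A N t n‖ ≤ G := by
  have red : ∀ (N : ℕ) (f : Z2 → ℝ), (∀ n ∉ Λ, f n = 0) →
      ∑ n ∈ sqBox (N + N₀), f n = ∑ n ∈ Λ, f n := fun N f hf =>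
    (Finset.sum_subset (hN₀ _ (Nat.le_add_left _ _)) fun n _ hn => hf n hn).symm
  set H := (1 + 2 * b) * (∑ n ∈ Λ, (1 + nsq n) * ‖a₀ n‖ ^ 2) + (∑ n ∈ Λ, ‖a₀ n‖) ^ 4 / 2
  set D := ∑ n ∈ Λ, wt k n * ‖a₀ n‖ with hDdef
  have hD : 0 ≤ D := Finset.sum_nonneg fun n _ => mul_nonneg (wt_nonneg k n) (norm_nonneg _)
  set C := 3 * 9 ^ k * (50 * H + 2) + 1 with hC
  have pos : ∀ (B : ℝ → Z2 → ℂ) (N : ℕ),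
      IsFlow ConvRel (sqBox (N + N₀)) (fun n => nsq n + v n) B → (∀ n, ‖B 0 n‖ = ‖a₀ n‖) →
      ∀ t, 0 ≤ t → ∑ n ∈ sqBox (N + N₀), wt k n * ‖B t n‖ ≤
        Real.exp (Real.exp (C * t + D)) := by
    intro B N hB hB0 t ht
    refine hB.weighted_bound k hk (hB.energy_bound (b := b) (fun n => by simpa using hv n) ?_) hD
      ?_ ht
    · simp only [hB0]
      rw [red N _ fun n hn => by simp [ha₀ n hn], red N _ fun n hn => by simp [ha₀ n hn]]
    · simp only [hB0]
      rw [red N _ fun n hn => by simp [ha₀ n hn]]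
      linarith [Real.add_one_le_exp D, Real.add_one_le_exp (Real.exp D)]
  have hH0 : 0 ≤ H := by
    have hb : 0 ≤ b := (abs_nonneg _).trans (hv 0)
    have : 0 ≤ ∑ n ∈ Λ, (1 + nsq n) * ‖a₀ n‖ ^ 2 := Finset.sum_nonneg fun n _ =>
      mul_nonneg (by linarith [nsq_nonneg n]) (sq_nonneg _)
    positivity
  have hC0 : 0 ≤ C := by positivity
  refine ⟨Real.exp (Real.exp (C * T + D)), by positivity, fun N t ht S => ?_⟩
  refine (sum_le_sum_of_support S (sqBox (N + N₀))
    (fun n => mul_nonneg (wt_nonneg k n) (norm_nonneg _))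
    fun n hn => by rw [(hA N).zero t n hn, norm_zero, mul_zero]).trans ?_
  have mono : Real.exp (Real.exp (C * |t| + D)) ≤ Real.exp (Real.exp (C * T + D)) := by
    gcongr
  refine le_trans ?_ mono
  rcases le_total 0 t with h | h
  · rw [abs_of_nonneg h]
    exact pos (A N) N (hA N) (fun n => by rw [h0]) t h
  · rw [abs_of_nonpos h]
    have := pos _ N (hA N).reverse (fun n => by rw [neg_zero, RCLike.norm_conj, h0]) (-t)
      (by linarith)
    simpa using this

/-- The Galerkin approximations form a Cauchy sequence in `ℓ¹`, locally uniformly in time. -/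
theorem galerkin_cauchy (hv : ∀ n, |v n| ≤ b) (ha₀ : ∀ n ∉ Λ, a₀ n = 0)
    (hN₀ : ∀ M, N₀ ≤ M → Λ ⊆ sqBox M) (h0 : ∀ N, A N 0 = a₀)
    (hA : ∀ N, IsFlow ConvRel (sqBox (N + N₀)) (fun n => nsq n + v n) (A N)) (T : ℝ) :
    ∃ C, 0 ≤ C ∧ ∀ N M t, N ≤ M → |t| ≤ T → ∀ S : Finset Z2,
      ∑ n ∈ S, ‖A M t n - A N t n‖ ≤ C * (1 / ((N : ℝ) + 1)) := by
  obtain ⟨G, hG, hb⟩ := galerkin_weighted_bound hv ha₀ hN₀ h0 hA 1 one_ne_zero T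
  set K := 27 * G ^ 3 + 3 * G ^ 2 + 1
  refine ⟨K * Real.exp (K * T), by positivity, fun N M t hNM ht S => ?_⟩
  have hsub : sqBox (N + N₀) ⊆ sqBox (M + N₀) := sqBox_mono (Nat.add_le_add_right hNM _)
  refine (sum_le_sum_of_support S (sqBox (M + N₀)) (fun n => norm_nonneg _) fun n hn => by
    rw [(hA M).zero t n hn, (hA N).zero t n fun h => hn (hsub h), sub_zero, norm_zero]).trans ?_
  have hε : (0 : ℝ) < 1 / ((N : ℝ) + 1) := by positivity
  have htail : ∀ n ∉ sqBox (N + N₀), 1 ≤ 1 / ((N : ℝ) + 1) * wt 1 n := by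
    intro n hn
    have h1 := sq_le_nsq_of_notMem_sqBox hn
    rw [one_div, ← div_eq_inv_mul, le_div_iff₀ (by positivity), wt, pow_one, one_mul]
    push_cast at h1
    have h2 : (N : ℝ) ≤ ((N : ℝ) + N₀) ^ 2 := by
      have : (N : ℝ) ≤ (N + N₀) ^ 2 := by
        exact_mod_cast (Nat.le_add_right N N₀).trans (Nat.le_self_pow two_ne_zero _)
      exact this
    linarith
  have mono : 1 / ((N : ℝ) + 1) * K * Real.exp (K * |t|) ≤
      K * Real.exp (K * T) * (1 / ((N : ℝ) + 1)) := by
    have : Real.exp (K * |t|) ≤ Real.exp (K * T) := by gcongr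
    calc _ = K * Real.exp (K * |t|) * (1 / ((N : ℝ) + 1)) := by ring
      _ ≤ _ := by gcongr
  refine le_trans ?_ mono
  rcases le_total 0 t with h | h
  · rw [abs_of_nonneg h]
    rw [abs_of_nonneg h] at ht
    refine (hA N).sum_norm_sub_le (hA M) hsub (by rw [h0, h0]) hG hε
      (fun τ hτ => hb N τ ?_ _) (fun τ hτ => hb M τ ?_ _) htail (T := T) ⟨h, ht⟩ <;>
    exact abs_le.mpr ⟨by linarith [hτ.1, hτ.2], hτ.2⟩
  · rw [abs_of_nonpos h]
    rw [abs_of_nonpos h] at ht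
    have := (hA N).reverse.sum_norm_sub_le (hA M).reverse hsub
      (by simp only [neg_zero, h0]) hG hε
      (fun τ hτ => by
        simp only [RCLike.norm_conj]
        exact hb N _ (by rw [abs_neg]; exact abs_le.mpr ⟨by linarith [hτ.1, hτ.2], hτ.2⟩) _)
      (fun τ hτ => by
        simp only [RCLike.norm_conj]
        exact hb M _ (by rw [abs_neg]; exact abs_le.mpr ⟨by linarith [hτ.1, hτ.2], hτ.2⟩) _)
      htail (T := T) (t := -t) ⟨by linarith, ht⟩
    simpa only [neg_neg, ← map_sub, RCLike.norm_conj] using this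

end GlobalSolution

/-- Finitely supported data launch global smooth solutions, which are limits of their Galerkin
approximations. -/
theorem exists_global_solution {v : Z2 → ℝ} {b : ℝ} (hv : ∀ n, |v n| ≤ b) (Λ : Finset Z2)
    {a₀ : Z2 → ℂ} (ha₀ : ∀ n ∉ Λ, a₀ n = 0) :
    ∃ (a : ℝ → Z2 → ℂ) (A : ℕ → ℝ → Z2 → ℂ) (N₀ : ℕ), a 0 = a₀ ∧ IsSolutionV v a ∧
      (∀ s t, HsFinite s (a t)) ∧
      (∀ N, A N 0 = a₀ ∧ IsFlow ConvRel (sqBox (N + N₀)) (fun n => nsq n + v n) (A N)) ∧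
      ∀ t n, Tendsto (fun N => A N t n) atTop (𝓝 (a t n)) := by
  obtain ⟨N₀, hN₀⟩ := exists_subset_sqBox Λ
  choose A h0 hA using fun N : ℕ => exists_isFlow (F := sqBox (N + N₀)) symmRel_convRel
    (fun n => nsq n + v n) a₀ fun n hn => ha₀ n fun h => hn (hN₀ _ (Nat.le_add_left _ _) h)
  have hlim : ∀ t n, ∃ z, Tendsto (fun N => A N t n) atTop (𝓝 z) := by
    intro t n
    obtain ⟨C, hC, hb⟩ := galerkin_cauchy hv ha₀ hN₀ h0 hA |t|
    refine cauchySeq_tendsto_of_complete (cauchySeq_of_le_tendsto_0'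
      (fun N : ℕ => C * (1 / ((N : ℝ) + 1))) (fun N M hNM => ?_) ?_)
    · rw [dist_comm, dist_eq_norm]
      simpa using hb N M t hNM le_rfl {n}
    · simpa using tendsto_one_div_add_atTop_nhds_zero_nat.const_mul C
  choose a ha using hlim
  have hwt : ∀ k, k ≠ 0 → ∀ T, ∃ G, 0 ≤ G ∧ ∀ t, |t| ≤ T → ∀ S : Finset Z2,
      ∑ n ∈ S, wt k n * ‖a t n‖ ≤ G := by
    intro k hk T
    obtain ⟨G, hG, hb⟩ := galerkin_weighted_bound hv ha₀ hN₀ h0 hA k hk T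
    refine ⟨G, hG, fun t ht S => ?_⟩
    refine le_of_tendsto (tendsto_finsetSum S fun n _ => ((ha t n).norm.const_mul (wt k n)))
      (Eventually.of_forall fun N => hb N t ht S)
  have hsumk : ∀ k, k ≠ 0 → ∀ t, Summable fun n => wt k n * ‖a t n‖ := by
    intro k hk t
    obtain ⟨G, hG, hb⟩ := hwt k hk |t|
    exact summable_of_sum_le (fun n => mul_nonneg (wt_nonneg k n) (norm_nonneg _))
      (hb t le_rfl)
  have hle : ∀ (c : Z2 → ℂ) (S : Finset Z2), ∑ n ∈ S, ‖c n‖ ≤ ∑ n ∈ S, wt 1 n * ‖c n‖ :=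
    fun c S => Finset.sum_le_sum fun n _ =>
      le_mul_of_one_le_left (norm_nonneg _) (one_le_wt 1 n)
  have hsum : ∀ t, Summable fun n => ‖a t n‖ := fun t =>
    Summable.of_nonneg_of_le (fun n => norm_nonneg _)
      (fun n => le_mul_of_one_le_left (norm_nonneg _) (one_le_wt 1 n)) (hsumk 1 one_ne_zero t)
  have hsumA : ∀ N t, Summable fun n => ‖A N t n‖ := fun N t =>
    summable_of_ne_finset_zero (s := sqBox (N + N₀)) fun n hn => by
      rw [(hA N).zero t n hn, norm_zero]
  refine ⟨a, A, N₀, ?_, ?_, ?_, fun N => ⟨h0 N, hA N⟩, ha⟩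
  · funext n
    refine tendsto_nhds_unique (ha 0 n) ?_
    simp only [h0]
    exact tendsto_const_nhds
  · intro n t
    set g' : ℝ → ℂ := fun t => Complex.I * (((nsq n + v n : ℝ) : ℂ) * a t n +
      ∑' p : {p : Triple // p.1 - p.2.1 + p.2.2 = n}, cubicTerm (a t) p.1) with hg'
    refine ⟨summable_norm_cubicTerm (hsum t) n, g' t, ?_, by
      rw [hg', ← mul_assoc, neg_mul, Complex.I_mul_I, neg_neg, one_mul]⟩
    obtain ⟨G, hG, hbA⟩ := galerkin_weighted_bound hv ha₀ hN₀ h0 hA 1 one_ne_zero (|t| + 1)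
    obtain ⟨C, hC, hcau⟩ := galerkin_cauchy hv ha₀ hN₀ h0 hA (|t| + 1)
    have haG : ∀ τ, |τ| ≤ |t| + 1 → ∑' n, ‖a τ n‖ ≤ G := fun τ hτ =>
      (hsum τ).tsum_le_of_sum_le fun S => le_of_tendsto
        (tendsto_finsetSum S fun n _ => (ha τ n).norm)
        (Eventually.of_forall fun N => (hle _ S).trans (hbA N τ hτ S))
    have hAG : ∀ N τ, |τ| ≤ |t| + 1 → ∑' n, ‖A N τ n‖ ≤ G := fun N τ hτ =>
      (hsumA N τ).tsum_le_of_sum_le fun S => (hle _ S).trans (hbA N τ hτ S)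
    have hdiff : ∀ N τ, |τ| ≤ |t| + 1 → ∀ S : Finset Z2,
        ∑ n ∈ S, ‖a τ n - A N τ n‖ ≤ C * (1 / ((N : ℝ) + 1)) := fun N τ hτ S =>
      le_of_tendsto (tendsto_finsetSum S fun n _ => ((ha τ n).sub_const (A N τ n)).norm)
        (eventually_atTop.mpr ⟨N, fun M hM => hcau N M τ hM hτ S⟩)
    have hsumd : ∀ N τ, Summable fun n => ‖a τ n - A N τ n‖ := fun N τ =>
      Summable.of_nonneg_of_le (fun _ => norm_nonneg _) (fun _ => norm_sub_le _ _)
        ((hsum τ).add (hsumA N τ))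
    have hopen : IsOpen (Set.Ioo (-(|t| + 1)) (|t| + 1)) := isOpen_Ioo
    have hmem : ∀ τ ∈ Set.Ioo (-(|t| + 1)) (|t| + 1), |τ| ≤ |t| + 1 := fun τ hτ =>
      abs_le.mpr ⟨hτ.1.le, hτ.2.le⟩
    refine hasDerivAt_of_tendstoUniformlyOn (l := atTop)
      (f := fun N τ => A N τ n)
      (f' := fun N τ => field ConvRel (sqBox (N + N₀)) (fun n => nsq n + v n) (A N τ) n)
      hopen ?_ ?_ (fun τ _ => ha τ n) (abs_lt.mp (lt_add_one |t|))
    · set B := (|nsq n + v n| + 3 * G ^ 2) * C with hB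
      have hB0 : Tendsto (fun N : ℕ => B * (1 / ((N : ℝ) + 1))) atTop (𝓝 0) := by
        simpa using tendsto_one_div_add_atTop_nhds_zero_nat.const_mul B
      rw [Metric.tendstoUniformlyOn_iff]
      intro ε hε
      filter_upwards [hB0.eventually_lt_const hε] with N hN τ hτ
      refine lt_of_le_of_lt ?_ hN
      have hτ' := hmem τ hτ
      rw [dist_eq_norm, field, ← tsum_cubicTerm_eq_cub ((hA N).zero τ) n, hg', ← mul_sub,
        norm_mul, Complex.norm_I, one_mul]
      have h1 := norm_tsum_cubicTerm_sub_le (hsum τ) (hsumA N τ) (haG τ hτ') (hAG N τ hτ')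
        ((hsumd N τ).tsum_le_of_sum_le (hdiff N τ hτ')) n
      have h2 : ‖a τ n - A N τ n‖ ≤ C * (1 / ((N : ℝ) + 1)) := by
        simpa using hdiff N τ hτ' {n}
      rw [add_sub_add_comm, ← mul_sub]
      refine (norm_add_le _ _).trans ?_
      rw [norm_mul, Complex.norm_real, Real.norm_eq_abs]
      calc _ ≤ |nsq n + v n| * (C * (1 / ((N : ℝ) + 1))) +
            3 * G ^ 2 * (C * (1 / ((N : ℝ) + 1))) :=
          add_le_add (mul_le_mul_of_nonneg_left h2 (abs_nonneg _)) h1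
        _ = B * (1 / ((N : ℝ) + 1)) := by rw [hB]; ring
    · obtain ⟨N₁, hN₁⟩ := exists_subset_sqBox {n}
      filter_upwards [eventually_ge_atTop N₁] with N hN τ _
      exact (hA N).deriv τ n (hN₁ _ (hN.trans (Nat.le_add_right _ _)) (Finset.mem_singleton_self n))
  · intro s t
    obtain ⟨k, hk⟩ := exists_nat_ge s
    have h2 := hsumk (k + 1) (Nat.succ_ne_zero k) t
    obtain ⟨G, hG, hb⟩ := hwt (k + 1) (Nat.succ_ne_zero k) |t|
    refine Summable.of_nonneg_of_le (fun n => mul_nonneg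
      (Real.rpow_nonneg (by linarith [nsq_nonneg n]) _) (sq_nonneg _)) (fun n => ?_)
      (h2.mul_left G)
    have h3 : wt (k + 1) n * ‖a t n‖ ≤ G := by simpa using hb t le_rfl {n}
    have h1 : (1 : ℝ) ≤ 1 + nsq n := by linarith [nsq_nonneg n]
    have h4 : (1 + nsq n) ^ s ≤ wt (k + 1) n := by
      rw [wt, ← Real.rpow_natCast]
      exact Real.rpow_le_rpow_of_exponent_le h1 (by push_cast; linarith)
    have h5 : (1 + nsq n) ^ s ≤ wt (k + 1) n * wt (k + 1) n :=
      h4.trans (le_mul_of_one_le_left (wt_nonneg _ _) (one_le_wt _ n))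
    calc (1 + nsq n) ^ s * ‖a t n‖ ^ 2 ≤ wt (k + 1) n * wt (k + 1) n * ‖a t n‖ ^ 2 :=
          mul_le_mul_of_nonneg_right h5 (sq_nonneg _)
      _ = wt (k + 1) n * ‖a t n‖ * (wt (k + 1) n * ‖a t n‖) := by ring
      _ ≤ G * (wt (k + 1) n * ‖a t n‖) :=
          mul_le_mul_of_nonneg_right h3 (mul_nonneg (wt_nonneg _ _) (norm_nonneg _))

end Limits

/-! ### Approximation by the resonant system -/

/-- Twice the negative of this form is the frequency mismatch `|x|² - |y|² + |z|² - |x-y+z|²`. -/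
def dotDiff (x y z : Z2) : ℤ := (x.1 - y.1) * (z.1 - y.1) + (x.2 - y.2) * (z.2 - y.2)

/-- The resonant interactions: `x, y, z, w` are the vertices of a (possibly flat) rectangle. -/
def ResRel (x y z w : Z2) : Prop := x - y + z = w ∧ dotDiff x y z = 0

theorem symmRel_resRel : SymmRel ResRel := by
  refine ⟨fun x y z w h => ⟨?_, ?_⟩, fun x y z w h => ⟨?_, ?_⟩⟩
  · rw [← h.1]; abel
  · rw [← h.2]; unfold dotDiff; ring
  · rw [← h.1]; abel
  · rw [← h.1, ← neg_zero, ← h.2]; simp only [dotDiff, Prod.fst_add, Prod.snd_add, Prod.fst_sub,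
      Prod.snd_sub]; ring

theorem nsq_mismatch (x y z : Z2) :
    nsq x - nsq y + nsq z - nsq (x - y + z) = -2 * (dotDiff x y z : ℝ) := by
  simp only [nsq, dotDiff, Prod.fst_add, Prod.snd_add, Prod.fst_sub, Prod.snd_sub]
  push_cast
  ring

/-- The sum of `f x y z` over the triples in `F` with `x - y + z = n`. -/
def convSum (F : Finset Z2) (f : Z2 → Z2 → Z2 → ℂ) (n : Z2) : ℂ :=
  ∑ x ∈ F, ∑ y ∈ F, ∑ z ∈ F, if x - y + z = n then f x y z else 0

theorem convSum_add (F : Finset Z2) (f g : Z2 → Z2 → Z2 → ℂ) (n : Z2) :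
    convSum F (fun x y z => f x y z + g x y z) n = convSum F f n + convSum F g n := by
  simp only [convSum, ← Finset.sum_add_distrib]
  refine Finset.sum_congr rfl fun x _ => Finset.sum_congr rfl fun y _ =>
    Finset.sum_congr rfl fun z _ => ?_
  split_ifs <;> simp

theorem convSum_mul (F : Finset Z2) (f : Z2 → Z2 → Z2 → ℂ) (c : ℂ) (n : Z2) :
    convSum F (fun x y z => c * f x y z) n = c * convSum F f n := by
  simp only [convSum, Finset.mul_sum, mul_ite, mul_zero]

theorem convSum_congr {F : Finset Z2} {f g : Z2 → Z2 → Z2 → ℂ} {n : Z2}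
    (h : ∀ x ∈ F, ∀ y ∈ F, ∀ z ∈ F, x - y + z = n → f x y z = g x y z) :
    convSum F f n = convSum F g n := by
  refine Finset.sum_congr rfl fun x hx => Finset.sum_congr rfl fun y hy =>
    Finset.sum_congr rfl fun z hz => ?_
  split_ifs with hn
  · exact h x hx y hy z hz hn
  · rfl

theorem sum_norm_convSum_le (F S : Finset Z2) (f : Z2 → Z2 → Z2 → ℂ) :
    ∑ n ∈ S, ‖convSum F f n‖ ≤ ∑ x ∈ F, ∑ y ∈ F, ∑ z ∈ F, ‖f x y z‖ := by
  have h1 : ∀ n, ‖convSum F f n‖ ≤ ∑ x ∈ F, ∑ y ∈ F, ∑ z ∈ F,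
      if x - y + z = n then ‖f x y z‖ else 0 := fun n => by
    refine (norm_sum_le _ _).trans (Finset.sum_le_sum fun x _ => (norm_sum_le _ _).trans
      (Finset.sum_le_sum fun y _ => (norm_sum_le _ _).trans (Finset.sum_le_sum fun z _ => ?_)))
    split_ifs <;> simp
  refine (Finset.sum_le_sum fun n _ => h1 n).trans ?_
  rw [Finset.sum_comm]
  refine Finset.sum_le_sum fun x _ => ?_
  rw [Finset.sum_comm]
  refine Finset.sum_le_sum fun y _ => ?_
  rw [Finset.sum_comm]
  refine Finset.sum_le_sum fun z _ => ?_
  rw [Finset.sum_ite_eq]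
  split_ifs
  · rfl
  · exact norm_nonneg _

theorem sum_triple_mul (F : Finset Z2) (a b c : Z2 → ℝ) :
    ∑ x ∈ F, ∑ y ∈ F, ∑ z ∈ F, a x * b y * c z =
      (∑ n ∈ F, a n) * (∑ n ∈ F, b n) * ∑ n ∈ F, c n := by
  simp only [← Finset.mul_sum, ← Finset.sum_mul]

theorem hasDerivAt_convSum {F : Finset Z2} {f : ℝ → Z2 → Z2 → Z2 → ℂ}
    {f' : Z2 → Z2 → Z2 → ℂ} {t : ℝ}
    (h : ∀ x ∈ F, ∀ y ∈ F, ∀ z ∈ F, HasDerivAt (fun τ => f τ x y z) (f' x y z) t) (n : Z2) :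
    HasDerivAt (fun τ => convSum F (f τ) n) (convSum F f' n) t := by
  unfold convSum
  refine HasDerivAt.fun_sum fun x hx => HasDerivAt.fun_sum fun y hy =>
    HasDerivAt.fun_sum fun z hz => ?_
  split_ifs
  · exact h x hx y hy z hz
  · exact hasDerivAt_const _ _

theorem conj_phase (ω t : ℝ) : (starRingEnd ℂ) (phase ω t) = phase (-ω) t := by
  unfold phase
  rw [← Complex.exp_conj]
  simp

theorem phase_mul (ω ω' t : ℝ) : phase ω t * phase ω' t = phase (ω + ω') t := by
  unfold phase
  rw [← Complex.exp_add]
  push_cast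
  ring_nf

theorem norm_phase_sub_one_le (ω t : ℝ) : ‖phase ω t - 1‖ ≤ |ω * t| := by
  unfold phase
  rw [mul_comm]
  simpa using Real.norm_exp_I_mul_ofReal_sub_one_le (x := -(ω * t))

/-- The frequency mismatch of an interaction. -/
def mismatch (ω : Z2 → ℝ) (x y z : Z2) : ℝ := ω x - ω y + ω z - ω (x - y + z)

section NormalForm

variable (Λ : Finset Z2) (ω : Z2 → ℝ)

/-- The normal form correction removing the nonresonant interactions. -/
def corrector (r : Z2 → ℂ) (t : ℝ) (n : Z2) : ℂ :=
  convSum Λ (fun x y z => if dotDiff x y z = 0 then 0 else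
    r x * (starRingEnd ℂ) (r y) * r z *
      (phase (-mismatch ω x y z) t * ((mismatch ω x y z : ℂ))⁻¹)) n

variable {Λ ω}

theorem sum_norm_corrector_le {r : Z2 → ℂ} {G W : ℝ} (hr : ∑ n ∈ Λ, ‖r n‖ ≤ G) (hW : 0 < W)
    (hnon : ∀ x ∈ Λ, ∀ y ∈ Λ, ∀ z ∈ Λ, dotDiff x y z ≠ 0 → W ≤ |mismatch ω x y z|)
    (S : Finset Z2) (t : ℝ) : ∑ n ∈ S, ‖corrector Λ ω r t n‖ ≤ G ^ 3 / W := by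
  have h0 : 0 ≤ ∑ n ∈ Λ, ‖r n‖ := Finset.sum_nonneg fun _ _ => norm_nonneg _
  refine (sum_norm_convSum_le Λ S _).trans ?_
  have h1 : ∀ x ∈ Λ, ∀ y ∈ Λ, ∀ z ∈ Λ, ‖(if dotDiff x y z = 0 then 0 else
      r x * (starRingEnd ℂ) (r y) * r z *
      (phase (-mismatch ω x y z) t * ((mismatch ω x y z : ℂ))⁻¹) : ℂ)‖ ≤
      ‖r x‖ * ‖r y‖ * ‖r z‖ * W⁻¹ := by
    intro x hx y hy z hz
    split_ifs with h
    · rw [norm_zero]; positivity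
    · rw [norm_mul, norm_mul, norm_mul, norm_mul, norm_phase, one_mul, norm_inv, RCLike.norm_conj,
        Complex.norm_real, Real.norm_eq_abs]
      gcongr
      exact hnon x hx y hy z hz h
  refine (Finset.sum_le_sum fun x hx => Finset.sum_le_sum fun y hy => Finset.sum_le_sum
    fun z hz => h1 x hx y hy z hz).trans ?_
  simp only [← Finset.sum_mul]
  rw [sum_triple_mul, div_eq_mul_inv]
  gcongr
  calc _ = (∑ n ∈ Λ, ‖r n‖) ^ 3 := by ring
    _ ≤ G ^ 3 := by gcongr

variable {ρ : ℝ → Z2 → ℂ} {F : Finset Z2} {A : ℝ → Z2 → ℂ}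

theorem sum_norm_cub_le' (R : Z2 → Z2 → Z2 → Z2 → Prop) (hR : ∀ x y z w, R x y z w → x - y + z = w)
    (F S : Finset Z2) (a b c : Z2 → ℂ) :
    ∑ n ∈ S, ‖cub R F a b c n‖ ≤
      (∑ n ∈ F, ‖a n‖) * (∑ n ∈ F, ‖b n‖) * (∑ n ∈ F, ‖c n‖) := by
  classical
  have h : ∀ n, cub R F a b c n = convSum F (fun x y z =>
      if R x y z (x - y + z) then a x * (starRingEnd ℂ) (b y) * c z else 0) n := by
    intro n
    refine Finset.sum_congr rfl fun x _ => Finset.sum_congr rfl fun y _ =>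
      Finset.sum_congr rfl fun z _ => ?_
    by_cases h1 : x - y + z = n
    · subst h1; simp
    · rw [if_neg h1, if_neg fun h2 => h1 (hR _ _ _ _ h2)]
  simp only [h]
  refine (sum_norm_convSum_le F S _).trans ?_
  rw [← sum_triple_mul]
  refine Finset.sum_le_sum fun x _ => Finset.sum_le_sum fun y _ => Finset.sum_le_sum fun z _ => ?_
  split_ifs
  · simp
  · rw [norm_zero]; positivity

theorem cub_convRel_phase (hΛF : Λ ⊆ F) {r : Z2 → ℂ} (hr : ∀ n ∉ Λ, r n = 0) (t : ℝ) (n : Z2) :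
    phase (ω n) t * cub ConvRel F (fun x => phase (-ω x) t * r x) (fun x => phase (-ω x) t * r x)
      (fun x => phase (-ω x) t * r x) n =
    convSum Λ (fun x y z => r x * (starRingEnd ℂ) (r y) * r z * phase (-mismatch ω x y z) t) n := by
  have h0 : ∀ n ∉ Λ, phase (-ω n) t * r n = 0 := fun n hn => by rw [hr n hn, mul_zero]
  rw [cub_eq_of_subset hΛF h0 h0 h0, cub, Finset.mul_sum]
  refine Finset.sum_congr rfl fun x _ => ?_
  rw [Finset.mul_sum]
  refine Finset.sum_congr rfl fun y _ => ?_
  rw [Finset.mul_sum]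
  refine Finset.sum_congr rfl fun z _ => ?_
  by_cases h : x - y + z = n
  · rw [if_pos h, if_pos (show ConvRel x y z n from h), map_mul, conj_phase]
    have e : phase (-mismatch ω x y z) t =
        phase (ω n) t * phase (-ω x) t * phase (- -ω y) t * phase (-ω z) t := by
      rw [phase_mul, phase_mul, phase_mul, mismatch, h]
      ring_nf
    simp only [e]; ring
  · rw [if_neg h, if_neg (show ¬ ConvRel x y z n from h), mul_zero]

theorem cub_resRel (r : Z2 → ℂ) (n : Z2) : cub ResRel Λ r r r n =
    convSum Λ (fun x y z => if dotDiff x y z = 0 then r x * (starRingEnd ℂ) (r y) * r z else 0)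
      n := by
  refine Finset.sum_congr rfl fun x _ => Finset.sum_congr rfl fun y _ =>
    Finset.sum_congr rfl fun z _ => ?_
  by_cases h1 : x - y + z = n <;> by_cases h2 : dotDiff x y z = 0 <;> simp [ResRel, h1, h2]

/-- Derivative of the corrector along a resonant flow. -/
theorem hasDerivAt_corrector (hρ : IsFlow ResRel Λ (fun _ => 0) ρ)
    (hnz : ∀ x ∈ Λ, ∀ y ∈ Λ, ∀ z ∈ Λ, dotDiff x y z ≠ 0 → mismatch ω x y z ≠ 0) (t : ℝ) (n : Z2) :
    HasDerivAt (fun τ => corrector Λ ω (ρ τ) τ n)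
      (Complex.I * convSum Λ (fun x y z => if dotDiff x y z = 0 then 0 else
          ρ t x * (starRingEnd ℂ) (ρ t y) * ρ t z * phase (-mismatch ω x y z) t) n
        + convSum Λ (fun x y z => if dotDiff x y z = 0 then 0 else
          (field ResRel Λ (fun _ => 0) (ρ t) x * (starRingEnd ℂ) (ρ t y) * ρ t z
            + ρ t x * (starRingEnd ℂ) (field ResRel Λ (fun _ => 0) (ρ t) y) * ρ t z
            + ρ t x * (starRingEnd ℂ) (ρ t y) * field ResRel Λ (fun _ => 0) (ρ t) z) *
          (phase (-mismatch ω x y z) t * ((mismatch ω x y z : ℂ))⁻¹)) n) t := by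
  rw [← convSum_mul, ← convSum_add]
  refine hasDerivAt_convSum (fun x hx y hy z hz => ?_) n
  by_cases h : dotDiff x y z = 0
  · simp only [h, if_true, mul_zero, add_zero]
    exact hasDerivAt_const _ _
  · simp only [h, if_false]
    have hm : (mismatch ω x y z : ℂ) ≠ 0 := by exact_mod_cast hnz x hx y hy z hz h
    have d1 := ((hρ.deriv t x hx).mul (hρ.deriv t y hy).star).mul (hρ.deriv t z hz)
    have d2 := d1.mul ((hasDerivAt_phase (-mismatch ω x y z) t).mul_const
      ((mismatch ω x y z : ℂ))⁻¹)
    convert! d2 using 1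
    simp only [Complex.star_def, Pi.mul_apply]
    push_cast
    field_simp
    ring

end NormalForm

/-- Solutions of the truncated equation follow the resonant flow, provided the nonresonant
mismatches are large and the resonant ones are small. -/
theorem resonant_approximation {Λ F : Finset Z2} {ω : Z2 → ℝ} {ρ A : ℝ → Z2 → ℂ}
    (hρ : IsFlow ResRel Λ (fun _ => 0) ρ) (hA : IsFlow ConvRel F ω A) (h0 : A 0 = ρ 0)
    (hΛF : Λ ⊆ F)
    (hclosed : ∀ x ∈ Λ, ∀ y ∈ Λ, ∀ z ∈ Λ, dotDiff x y z = 0 → x - y + z ∈ Λ)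
    {G θ W T : ℝ} (hG : 0 ≤ G) (hρG : ∀ t ∈ Set.Icc 0 T, ∑ n ∈ Λ, ‖ρ t n‖ ≤ G)
    (hres : ∀ x ∈ Λ, ∀ y ∈ Λ, ∀ z ∈ Λ, dotDiff x y z = 0 → |mismatch ω x y z| ≤ θ) (hθ : 0 ≤ θ)
    (hnon : ∀ x ∈ Λ, ∀ y ∈ Λ, ∀ z ∈ Λ, dotDiff x y z ≠ 0 → W ≤ |mismatch ω x y z|) (hW : 0 < W)
    (hT : 0 ≤ T)
    (hη : (θ * T * (G + 2) ^ 3 + 8 * (G + 2) ^ 5 / W) *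
      Real.exp ((3 * (G + 2) ^ 2 + 1) * T) ≤ 1) :
    ∑ n ∈ F, ‖A T n - phase (-ω n) T * ρ T n‖ ≤
      2 * ((θ * T * (G + 2) ^ 3 + 8 * (G + 2) ^ 5 / W) *
        Real.exp ((3 * (G + 2) ^ 2 + 1) * T)) := by
  classical
  set M := G + 2 with hM
  have hM2 : 2 ≤ M := by linarith
  set C := 3 * M ^ 2 + 1 with hC
  have hC0 : 0 ≤ C := by positivity
  set η := θ * T * M ^ 3 + 8 * M ^ 5 / W with hηdef
  have hpp : ∀ w τ, phase (-w) τ * phase w τ = 1 := fun w τ => by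
    rw [phase_mul, neg_add_cancel]; simp [phase]
  set g : ℝ → Z2 → ℂ := fun τ n => corrector Λ ω (ρ τ) τ n with hg
  have hgb : ∀ τ ∈ Set.Icc 0 T, ∑ n ∈ F, ‖g τ n‖ ≤ G ^ 3 / W := fun τ hτ =>
    sum_norm_corrector_le (hρG τ hτ) hW hnon F τ
  have hG35 : G ^ 3 ≤ M ^ 5 := by
    calc G ^ 3 ≤ M ^ 3 := by gcongr; linarith
      _ ≤ M ^ 5 := pow_le_pow_right₀ (by linarith) (by norm_num)
  have hη1 : G ^ 3 / W ≤ η := by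
    have h1 : G ^ 3 / W ≤ 8 * M ^ 5 / W := by
      gcongr
      have : 0 ≤ M ^ 5 := by positivity
      linarith
    have h2 : 0 ≤ θ * T * M ^ 3 := by positivity
    linarith
  have hη0 : 0 ≤ η := by positivity
  have hE1 : ∀ τ, 0 ≤ τ → 1 ≤ Real.exp (C * τ) := fun τ hτ => Real.one_le_exp (by positivity)
  have hηe : η ≤ η * Real.exp (C * T) := le_mul_of_one_le_right hη0 (hE1 T hT)
  let D : ℝ → Z2 → ℂ := fun τ => field ResRel Λ (fun _ => 0) (ρ τ)
  let P : ℝ → Z2 → ℂ := fun τ n => phase (-ω n) τ * (ρ τ n + g τ n)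
  let Q : ℝ → Z2 → ℂ := fun τ n => phase (-ω n) τ * ρ τ n
  let E₁ : ℝ → Z2 → ℂ := fun τ n => convSum Λ (fun x y z => if dotDiff x y z = 0 then
    ρ τ x * (starRingEnd ℂ) (ρ τ y) * ρ τ z * (phase (-mismatch ω x y z) τ - 1) else 0) n
  let E₂ : ℝ → Z2 → ℂ := fun τ n => convSum Λ (fun x y z => if dotDiff x y z = 0 then 0 else
          (D τ x * (starRingEnd ℂ) (ρ τ y) * ρ τ z
            + ρ τ x * (starRingEnd ℂ) (D τ y) * ρ τ z
            + ρ τ x * (starRingEnd ℂ) (ρ τ y) * D τ z) *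
          (phase (-mismatch ω x y z) τ * ((mismatch ω x y z : ℂ))⁻¹)) n
  let f : Z2 → ℝ → ℂ := fun n τ => phase (ω n) τ * A τ n - ρ τ n - g τ n
  let f' : Z2 → ℝ → ℂ := fun n τ =>
    Complex.I * (phase (ω n) τ * (cub ConvRel F (A τ) (A τ) (A τ) n -
      cub ConvRel F (P τ) (P τ) (P τ) n)) +
    Complex.I * (phase (ω n) τ * (cub ConvRel F (P τ) (P τ) (P τ) n -
      cub ConvRel F (Q τ) (Q τ) (Q τ) n)) + Complex.I * E₁ τ n - E₂ τ n
  have hρd : ∀ τ n, HasDerivAt (fun τ => ρ τ n)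
      (Complex.I * cub ResRel Λ (ρ τ) (ρ τ) (ρ τ) n) τ := by
    intro τ n
    by_cases hn : n ∈ Λ
    · simpa [field] using hρ.deriv τ n hn
    · have e1 : (fun τ => ρ τ n) = fun _ => 0 := funext fun τ => hρ.zero τ n hn
      have e2 : cub ResRel Λ (ρ τ) (ρ τ) (ρ τ) n = 0 :=
        Finset.sum_eq_zero fun x hx => Finset.sum_eq_zero fun y hy => Finset.sum_eq_zero
          fun z hz => if_neg fun h : ResRel x y z n => hn (h.1 ▸ hclosed x hx y hy z hz h.2)
      rw [e1, e2, mul_zero]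
      exact hasDerivAt_const _ _
  have hf : ∀ n ∈ F, ∀ τ, HasDerivAt (f n) (f' n τ) τ := by
    intro n hn τ
    have d1 := hA.hasDerivAt_phase_mul hn τ
    have d3 := hasDerivAt_corrector hρ (ω := ω) (fun x hx y hy z hz h h' => by
      have := hnon x hx y hy z hz h
      rw [h', abs_zero] at this
      linarith) τ n
    convert! (d1.sub (hρd τ n)).sub d3 using 1
    simp only [f', E₂, D]
    have e1 : phase (ω n) τ * cub ConvRel F (Q τ) (Q τ) (Q τ) n =
        E₁ τ n + cub ResRel Λ (ρ τ) (ρ τ) (ρ τ) n +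
        convSum Λ (fun x y z => if dotDiff x y z = 0 then 0 else
          ρ τ x * (starRingEnd ℂ) (ρ τ y) * ρ τ z * phase (-mismatch ω x y z) τ) n := by
      rw [cub_convRel_phase hΛF (hρ.zero τ), cub_resRel, ← convSum_add, ← convSum_add]
      refine convSum_congr fun x _ y _ z _ _ => ?_
      split_ifs <;> ring
    linear_combination Complex.I * (-e1)
  have hnormP : ∀ τ n, ‖A τ n - P τ n‖ = ‖f n τ‖ := by
    intro τ n
    have : A τ n - P τ n = phase (-ω n) τ * f n τ := by
      simp only [P, f]
      linear_combination (-(A τ n)) * hpp (ω n) τ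
    rw [this, norm_mul, norm_phase, one_mul]
  have hnormPQ : ∀ τ n, ‖P τ n - Q τ n‖ = ‖g τ n‖ := by
    intro τ n
    have : P τ n - Q τ n = phase (-ω n) τ * g τ n := by simp only [P, Q]; ring
    rw [this, norm_mul, norm_phase, one_mul]
  have hsQ : ∀ τ ∈ Set.Icc 0 T, ∑ n ∈ F, ‖Q τ n‖ ≤ G := by
    intro τ hτ
    refine le_trans (le_of_eq ?_) (hρG τ hτ)
    simp only [Q, norm_mul, norm_phase, one_mul]
    exact (Finset.sum_subset hΛF fun n _ hn => by rw [hρ.zero τ n hn, norm_zero]).symm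
  have hsP : ∀ τ ∈ Set.Icc 0 T, ∑ n ∈ F, ‖P τ n‖ ≤ G + 1 := by
    intro τ hτ
    have h1 : ∑ n ∈ F, ‖P τ n‖ ≤ ∑ n ∈ F, ‖Q τ n‖ + ∑ n ∈ F, ‖P τ n - Q τ n‖ := by
      rw [← Finset.sum_add_distrib]
      exact Finset.sum_le_sum fun n _ => norm_le_norm_add_norm_sub' _ _
    simp only [hnormPQ] at h1
    linarith [hsQ τ hτ, hgb τ hτ]
  have key := sum_norm_le_of_deriv_lt F f f' hf (B := fun τ => η * Real.exp (C * τ))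
    (B' := fun τ => η * (Real.exp (C * τ) * C))
    (fun τ => by
      have h1 : HasDerivAt (fun τ => C * τ) C τ := by
        simpa using (hasDerivAt_id τ).const_mul C
      exact h1.exp.const_mul _)
    (by
      simp only [mul_zero, Real.exp_zero, mul_one]
      refine le_trans (le_of_eq ?_) ((hgb 0 ⟨le_rfl, hT⟩).trans hη1)
      refine Finset.sum_congr rfl fun n _ => ?_
      simp only [f]
      rw [h0, phase_zero, one_mul, sub_self, zero_sub, norm_neg])
    (T := T) ?_ (t := T) ⟨hT, le_rfl⟩
  · have h1 : ∑ n ∈ F, ‖A T n - Q T n‖ ≤ ∑ n ∈ F, ‖f n T‖ + ∑ n ∈ F, ‖g T n‖ := by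
      rw [← Finset.sum_add_distrib]
      refine Finset.sum_le_sum fun n _ => ?_
      rw [← hnormP, ← hnormPQ]
      exact norm_sub_le_norm_sub_add_norm_sub _ _ _
    have h2 := hgb T ⟨hT, le_rfl⟩
    have h3 : ∑ n ∈ F, ‖A T n - phase (-ω n) T * ρ T n‖ = ∑ n ∈ F, ‖A T n - Q T n‖ := rfl
    linarith
  · intro τ hτ heq
    have hτ' : τ ∈ Set.Icc 0 T := ⟨hτ.1, hτ.2.le⟩
    have hmono : η * Real.exp (C * τ) ≤ η * Real.exp (C * T) := by
      gcongr; exact hτ.2.le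
    have hsA : ∑ n ∈ F, ‖A τ n‖ ≤ M := by
      have h1 : ∑ n ∈ F, ‖A τ n‖ ≤ ∑ n ∈ F, ‖P τ n‖ + ∑ n ∈ F, ‖A τ n - P τ n‖ := by
        rw [← Finset.sum_add_distrib]
        exact Finset.sum_le_sum fun n _ => norm_le_norm_add_norm_sub' _ _
      simp only [hnormP] at h1
      linarith [hsP τ hτ', heq.le]
    have b1 := sum_norm_cub_sub_le F F (A τ) (P τ) hsA ((hsP τ hτ').trans (by linarith))
    simp only [hnormP] at b1
    rw [heq] at b1
    have b2 := sum_norm_cub_sub_le F F (P τ) (Q τ) (G := M) ((hsP τ hτ').trans (by linarith))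
      ((hsQ τ hτ').trans (by linarith))
    simp only [hnormPQ] at b2
    have hr0 : 0 ≤ ∑ n ∈ Λ, ‖ρ τ n‖ := Finset.sum_nonneg fun _ _ => norm_nonneg _
    have b3 : ∑ n ∈ F, ‖E₁ τ n‖ ≤ θ * T * M ^ 3 := by
      refine (sum_norm_convSum_le Λ F _).trans ?_
      have h1 : ∀ x ∈ Λ, ∀ y ∈ Λ, ∀ z ∈ Λ, ‖(if dotDiff x y z = 0 then
          ρ τ x * (starRingEnd ℂ) (ρ τ y) * ρ τ z * (phase (-mismatch ω x y z) τ - 1) else 0 : ℂ)‖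
          ≤ ‖ρ τ x‖ * ‖ρ τ y‖ * ‖ρ τ z‖ * (θ * T) := by
        intro x hx y hy z hz
        split_ifs with h
        · rw [norm_mul, norm_mul, norm_mul, RCLike.norm_conj]
          refine mul_le_mul_of_nonneg_left ((norm_phase_sub_one_le _ _).trans ?_) (by positivity)
          rw [abs_mul, abs_neg, abs_of_nonneg hτ.1]
          exact mul_le_mul (hres x hx y hy z hz h) hτ.2.le hτ.1 hθ
        · rw [norm_zero]; positivity
      refine (Finset.sum_le_sum fun x hx => Finset.sum_le_sum fun y hy => Finset.sum_le_sum
        fun z hz => h1 x hx y hy z hz).trans ?_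
      simp only [← Finset.sum_mul]
      rw [sum_triple_mul, mul_comm]
      gcongr
      calc _ = (∑ n ∈ Λ, ‖ρ τ n‖) ^ 3 := by ring
        _ ≤ M ^ 3 := by gcongr; linarith [hρG τ hτ']
    have hD : ∑ n ∈ Λ, ‖D τ n‖ ≤ M ^ 3 := by
      have h1 := sum_norm_cub_le' ResRel (fun _ _ _ _ h => h.1) Λ Λ (ρ τ) (ρ τ) (ρ τ)
      simp only [D, field, norm_mul, Complex.norm_I, one_mul, Complex.ofReal_zero, zero_mul,
        zero_add]
      refine h1.trans ?_
      calc _ = (∑ n ∈ Λ, ‖ρ τ n‖) ^ 3 := by ring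
        _ ≤ M ^ 3 := by gcongr; linarith [hρG τ hτ']
    have b4 : ∑ n ∈ F, ‖E₂ τ n‖ ≤ 3 * M ^ 5 / W := by
      refine (sum_norm_convSum_le Λ F _).trans ?_
      have h1 : ∀ x ∈ Λ, ∀ y ∈ Λ, ∀ z ∈ Λ, ‖(if dotDiff x y z = 0 then 0 else
          (D τ x * (starRingEnd ℂ) (ρ τ y) * ρ τ z
            + ρ τ x * (starRingEnd ℂ) (D τ y) * ρ τ z
            + ρ τ x * (starRingEnd ℂ) (ρ τ y) * D τ z) *
          (phase (-mismatch ω x y z) τ * ((mismatch ω x y z : ℂ))⁻¹) : ℂ)‖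
          ≤ (‖D τ x‖ * ‖ρ τ y‖ * ‖ρ τ z‖ + ‖ρ τ x‖ * ‖D τ y‖ * ‖ρ τ z‖ +
            ‖ρ τ x‖ * ‖ρ τ y‖ * ‖D τ z‖) * W⁻¹ := by
        intro x hx y hy z hz
        split_ifs with h
        · rw [norm_zero]; positivity
        · rw [norm_mul, norm_mul, norm_phase, one_mul, norm_inv, Complex.norm_real,
            Real.norm_eq_abs]
          have := hnon x hx y hy z hz h
          gcongr
          refine norm_add₃_le.trans (le_of_eq ?_)
          simp only [norm_mul, RCLike.norm_conj]
      refine (Finset.sum_le_sum fun x hx => Finset.sum_le_sum fun y hy => Finset.sum_le_sum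
        fun z hz => h1 x hx y hy z hz).trans ?_
      simp only [← Finset.sum_mul, Finset.sum_add_distrib]
      rw [div_eq_mul_inv]
      gcongr
      rw [sum_triple_mul, sum_triple_mul, sum_triple_mul]
      have hr : ∑ n ∈ Λ, ‖ρ τ n‖ ≤ M := by linarith [hρG τ hτ']
      have hd0 : 0 ≤ ∑ n ∈ Λ, ‖D τ n‖ := Finset.sum_nonneg fun _ _ => norm_nonneg _
      have h2 : (∑ n ∈ Λ, ‖ρ τ n‖) * (∑ n ∈ Λ, ‖ρ τ n‖) ≤ M * M :=
        mul_le_mul hr hr hr0 (by linarith)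
      have h3 := mul_le_mul hD h2 (by positivity) (by positivity : 0 ≤ M ^ 3)
      ring_nf at h3 ⊢
      linarith
    have hsum : ∑ n ∈ F, ‖f' n τ‖ ≤ 3 * M ^ 2 * (η * Real.exp (C * τ)) +
        3 * M ^ 2 * (G ^ 3 / W) + θ * T * M ^ 3 + 3 * M ^ 5 / W := by
      have h1 : ∀ n, ‖f' n τ‖ ≤ ‖cub ConvRel F (A τ) (A τ) (A τ) n -
          cub ConvRel F (P τ) (P τ) (P τ) n‖ + ‖cub ConvRel F (P τ) (P τ) (P τ) n -
          cub ConvRel F (Q τ) (Q τ) (Q τ) n‖ + ‖E₁ τ n‖ + ‖E₂ τ n‖ := by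
        intro n
        refine (norm_sub_le _ _).trans (add_le_add_left (norm_add₃_le.trans (le_of_eq ?_)) _)
        simp only [norm_mul, norm_phase, Complex.norm_I, one_mul]
      refine (Finset.sum_le_sum fun n _ => h1 n).trans ?_
      rw [Finset.sum_add_distrib, Finset.sum_add_distrib, Finset.sum_add_distrib]
      have := mul_le_mul_of_nonneg_left (hgb τ hτ') (by positivity : 0 ≤ 3 * M ^ 2)
      linarith
    refine hsum.trans_lt ?_
    have h2 : η * (Real.exp (C * τ) * C) =
        3 * M ^ 2 * (η * Real.exp (C * τ)) + η * Real.exp (C * τ) := by rw [hC]; ring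
    have h3 : η ≤ η * Real.exp (C * τ) := le_mul_of_one_le_right hη0 (hE1 τ hτ.1)
    have h4 : 3 * M ^ 2 * (G ^ 3 / W) ≤ 3 * M ^ 5 / W := by
      have : G ^ 3 ≤ M ^ 3 := by gcongr; linarith
      calc 3 * M ^ 2 * (G ^ 3 / W) ≤ 3 * M ^ 2 * (M ^ 3 / W) := by gcongr
        _ = 3 * M ^ 5 / W := by ring
    have h5 : 0 < M ^ 5 / W := by positivity
    rw [h2]
    have h6 : η = θ * T * M ^ 3 + 8 * (M ^ 5 / W) := by rw [hηdef]; ring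
    have h7 : 3 * M ^ 5 / W = 3 * (M ^ 5 / W) := by ring
    rw [h7] at h4 ⊢
    linarith

section Shadowing

/-! ### From resonant flows on abstract index sets to solutions of the full equation -/

open Filter Topology

section Transport

variable {ι α : Type*} [Fintype ι] {R : ι → ι → ι → ι → Prop} {R' : α → α → α → α → Prop}

theorem cub_extend (e : ι ↪ α) (hR : ∀ x y z w, R' (e x) (e y) (e z) (e w) ↔ R x y z w)
    (a : ι → ℂ) (i : ι) :
    cub R' (Finset.univ.map e) (Function.extend e a 0) (Function.extend e a 0)
      (Function.extend e a 0) (e i) = cub R Finset.univ a a a i := by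
  classical
  unfold cub
  simp only [Finset.sum_map, e.injective.extend_apply, hR]

theorem IsFlow.extend (e : ι ↪ α) (hR : ∀ x y z w, R' (e x) (e y) (e z) (e w) ↔ R x y z w)
    {r : ℝ → ι → ℂ} (hr : IsFlow R Finset.univ (fun _ => 0) r) :
    IsFlow R' (Finset.univ.map e) (fun _ => 0) (fun t => Function.extend e (r t) 0) := by
  refine ⟨fun t n hn => Function.extend_apply' _ _ _ fun ⟨i, hi⟩ =>
    hn (Finset.mem_map.mpr ⟨i, Finset.mem_univ i, hi⟩), fun t n hn => ?_⟩
  obtain ⟨i, -, rfl⟩ := Finset.mem_map.mp hn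
  have h := hr.deriv t i (Finset.mem_univ i)
  simp only [field, cub_extend e hR, e.injective.extend_apply] at h ⊢
  exact h

end Transport

theorem IsFlow.exists_sum_norm_le {ι : Type*} [Fintype ι] {R : ι → ι → ι → ι → Prop}
    {ω : ι → ℝ} {r : ℝ → ι → ℂ} (hr : IsFlow R Finset.univ ω r) (T : ℝ) :
    ∃ G, 0 ≤ G ∧ ∀ t ∈ Set.Icc 0 T, ∑ i, ‖r t i‖ ≤ G := by
  have hc : Continuous fun t => ∑ i, ‖r t i‖ :=
    continuous_finsetSum _ fun i _ => (continuous_iff_continuousAt.mpr fun t =>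
      (hr.deriv t i (Finset.mem_univ i)).continuousAt).norm
  obtain ⟨G, hG⟩ := (isCompact_Icc.bddAbove_image hc.continuousOn : BddAbove
    ((fun t => ∑ i, ‖r t i‖) '' Set.Icc 0 T))
  exact ⟨max G 0, le_max_right _ _, fun t ht =>
    (hG (Set.mem_image_of_mem _ ht)).trans (le_max_left _ _)⟩

theorem nsmul_notMem_sqBox {n : Z2} (hn : n ≠ 0) {N l : ℕ} (hl : N < l) : l • n ∉ sqBox N := by
  rw [mem_sqBox, not_and_or]
  have key : ∀ m : ℤ, m ≠ 0 → ¬ |(l : ℤ) * m| ≤ N := by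
    intro m hm h
    rw [abs_mul, Nat.abs_cast] at h
    have h1 : 1 ≤ |m| := Int.one_le_abs hm
    have h2 : (N : ℤ) < l := by exact_mod_cast hl
    nlinarith
  by_cases h1 : n.1 = 0
  · right
    have : n.2 ≠ 0 := fun h2 => hn (Prod.ext h1 h2)
    simpa using key n.2 this
  · left
    simpa using key n.1 h1

theorem dotDiff_nsmul (l : ℕ) (x y z : Z2) :
    dotDiff (l • x) (l • y) (l • z) = (l : ℤ) ^ 2 * dotDiff x y z := by
  have h1 : ∀ n : Z2, (l • n).1 = l * n.1 := fun n => by simp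
  have h2 : ∀ n : Z2, (l • n).2 = l * n.2 := fun n => by simp
  simp only [dotDiff, h1, h2]
  ring

theorem resRel_nsmul {l : ℕ} (hl : l ≠ 0) (x y z w : Z2) :
    ResRel (l • x) (l • y) (l • z) (l • w) ↔ ResRel x y z w := by
  have h1 : l • x - l • y + l • z = l • (x - y + z) := by simp only [smul_add, smul_sub]
  have h2 : (l : ℤ) ^ 2 ≠ 0 := by positivity
  simp only [ResRel, dotDiff_nsmul, mul_eq_zero, h2, false_or, h1]
  rw [(nsmul_right_injective hl).eq_iff]

/-- A resonant flow placed on a resonance-closed set of modes is shadowed by solutions of the full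
equation once the modes are dilated. -/
theorem exists_shadowing_solution {v : Z2 → ℝ} (hv : Tendsto v cofinite (𝓝 0)) {b : ℝ}
    (hb : ∀ n, |v n| ≤ b) {ι : Type*} [Fintype ι] (e : ι ↪ Z2) (he : ∀ i, e i ≠ 0)
    {R : ι → ι → ι → ι → Prop} (hR : ∀ x y z w, ResRel (e x) (e y) (e z) (e w) ↔ R x y z w)
    (hclosed : ∀ x y z, dotDiff (e x) (e y) (e z) = 0 → ∃ w, e x - e y + e z = e w)
    {r : ℝ → ι → ℂ} (hr : IsFlow R Finset.univ (fun _ => 0) r) {T ε : ℝ} (hT : 0 ≤ T)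
    (hε : 0 < ε) :
    ∃ l₀ : ℕ, ∀ l, l₀ ≤ l → ∃ a : ℝ → Z2 → ℂ, IsSolutionV v a ∧ (∀ s t, HsFinite s (a t)) ∧
      (∀ i, a 0 (l • e i) = r 0 i) ∧ (∀ n, (∀ i, n ≠ l • e i) → a 0 n = 0) ∧
      ∀ i, ‖r T i‖ - ε ≤ ‖a T (l • e i)‖ := by
  classical
  obtain ⟨G, hG, hrG⟩ := hr.exists_sum_norm_le T
  set M := G + 2 with hM
  set X := Real.exp ((3 * M ^ 2 + 1) * T) with hX
  have hX0 : 0 < X := Real.exp_pos _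
  set δ := min 1 (ε / 2) with hδ
  have hδ0 : 0 < δ := lt_min one_pos (by linarith)
  set κ := δ / (2 * X * (4 * (T * M ^ 3) + 1)) with hκ
  have hκ0 : 0 < κ := by positivity
  have hb0 : 0 ≤ b := (abs_nonneg _).trans (hb 0)
  have hfin : {n | κ ≤ |v n|}.Finite := by
    have h1 := (hv.abs).eventually_lt_const (show |(0 : ℝ)| < κ by simpa using hκ0)
    rw [eventually_cofinite] at h1
    simpa using h1
  obtain ⟨N, hN⟩ := exists_subset_sqBox hfin.toFinset
  obtain ⟨L, hL⟩ := exists_nat_ge (4 * b + 16 * M ^ 5 * X / δ + 1)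
  refine ⟨max (N + 1) (L + 1), fun l hl => ?_⟩
  have hlN : N < l := (Nat.lt_succ_self N).trans_le ((le_max_left _ _).trans hl)
  have hlL : L + 1 ≤ l := (le_max_right _ _).trans hl
  have hl0 : l ≠ 0 := by omega
  have hvs : ∀ i, |v (l • e i)| ≤ κ := by
    intro i
    by_contra! h
    exact nsmul_notMem_sqBox (he i) hlN (hN N le_rfl (hfin.mem_toFinset.mpr h.le))
  let e' : ι ↪ Z2 := ⟨fun i => l • e i, fun i j h => e.injective (nsmul_right_injective hl0 h)⟩
  have he' : ∀ i, e' i = l • e i := fun _ => rfl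
  set Λ : Finset Z2 := Finset.univ.map e' with hΛ
  have hΛm : ∀ {n}, n ∈ Λ → ∃ i, e' i = n := fun hn => by
    obtain ⟨i, -, hi⟩ := Finset.mem_map.mp hn
    exact ⟨i, hi⟩
  set ρ : ℝ → Z2 → ℂ := fun t => Function.extend e' (r t) 0 with hρdef
  have hρ : IsFlow ResRel Λ (fun _ => 0) ρ :=
    hr.extend e' fun x y z w => (resRel_nsmul hl0 _ _ _ _).trans (hR x y z w)
  have hρe : ∀ t i, ρ t (e' i) = r t i := fun t i => e'.injective.extend_apply _ _ _
  obtain ⟨a, A, N₀, ha0, hsol, hfinite, hA, hlim⟩ := exists_global_solution hb Λ (hρ.zero 0)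
  refine ⟨a, hsol, hfinite, fun i => by rw [ha0, ← he', hρe], fun n hn => by
    rw [ha0]
    exact hρ.zero 0 n fun h => by
      obtain ⟨i, hi⟩ := hΛm h
      exact hn i hi.symm, fun i => ?_⟩
  set ω : Z2 → ℝ := fun n => nsq n + v n with hω
  have hmm : ∀ x y z, mismatch ω x y z = -2 * (dotDiff x y z : ℝ) +
      (v x - v y + v z - v (x - y + z)) := by
    intro x y z
    rw [← nsq_mismatch]
    simp only [mismatch, hω]
    ring
  set W : ℝ := (L : ℝ) with hW
  have hMX : 0 ≤ 16 * M ^ 5 * X / δ := by positivity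
  have hW1 : 1 ≤ W := by linarith
  have hres : ∀ x ∈ Λ, ∀ y ∈ Λ, ∀ z ∈ Λ, dotDiff x y z = 0 → x - y + z ∈ Λ := by
    intro x hx y hy z hz h
    obtain ⟨i, rfl⟩ := hΛm hx
    obtain ⟨j, rfl⟩ := hΛm hy
    obtain ⟨k, rfl⟩ := hΛm hz
    simp only [he', dotDiff_nsmul, mul_eq_zero] at h
    rcases h with h | h
    · exact absurd h (by positivity)
    · obtain ⟨w, hw⟩ := hclosed i j k h
      refine Finset.mem_map.mpr ⟨w, Finset.mem_univ w, ?_⟩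
      simp only [he', ← smul_sub, ← smul_add, hw]
  have hvΛ : ∀ x ∈ Λ, |v x| ≤ κ := fun x hx => by
    obtain ⟨i, rfl⟩ := hΛm hx
    exact hvs i
  have hres' : ∀ x ∈ Λ, ∀ y ∈ Λ, ∀ z ∈ Λ, dotDiff x y z = 0 → |mismatch ω x y z| ≤ 4 * κ := by
    intro x hx y hy z hz h
    rw [hmm, h, Int.cast_zero, mul_zero, zero_add, abs_le]
    have h1 := abs_le.mp (hvΛ x hx)
    have h2 := abs_le.mp (hvΛ y hy)
    have h3 := abs_le.mp (hvΛ z hz)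
    have h4 := abs_le.mp (hvΛ _ (hres x hx y hy z hz h))
    constructor <;> linarith
  have hnon : ∀ x ∈ Λ, ∀ y ∈ Λ, ∀ z ∈ Λ, dotDiff x y z ≠ 0 → W ≤ |mismatch ω x y z| := by
    intro x hx y hy z hz h
    have h5 : (l : ℝ) ^ 2 ≤ |(dotDiff x y z : ℝ)| := by
      obtain ⟨i, rfl⟩ := hΛm hx
      obtain ⟨j, rfl⟩ := hΛm hy
      obtain ⟨k, rfl⟩ := hΛm hz
      simp only [he', dotDiff_nsmul] at h ⊢
      have h6 : 1 ≤ |dotDiff (e i) (e j) (e k)| := Int.one_le_abs (right_ne_zero_of_mul h)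
      push_cast
      rw [abs_mul, abs_of_nonneg (by positivity : (0 : ℝ) ≤ (l : ℝ) ^ 2)]
      refine le_mul_of_one_le_right (by positivity) ?_
      exact_mod_cast h6
    have hl1 : W + 1 ≤ (l : ℝ) := by rw [hW]; exact_mod_cast hlL
    have h1 := abs_le.mp (hb x)
    have h2 := abs_le.mp (hb y)
    have h3 := abs_le.mp (hb z)
    have h4 := abs_le.mp (hb (x - y + z))
    have h6 : |v x - v y + v z - v (x - y + z)| ≤ 4 * b := by
      rw [abs_le]; constructor <;> linarith
    have h7 := abs_sub_abs_le_abs_sub (-2 * (dotDiff x y z : ℝ))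
      (-(v x - v y + v z - v (x - y + z)))
    rw [sub_neg_eq_add, abs_neg, abs_mul, abs_neg, abs_two] at h7
    rw [hmm]
    nlinarith
  have hsumρ : ∀ t, ∑ n ∈ Λ, ‖ρ t n‖ = ∑ i, ‖r t i‖ := fun t => by
    rw [hΛ, Finset.sum_map]
    simp only [hρe]
  have hηδ : (4 * κ * T * M ^ 3 + 8 * M ^ 5 / W) * X ≤ δ := by
    have h1 : 4 * κ * T * M ^ 3 * X ≤ δ / 2 := by
      have e1 : κ * (2 * X * (4 * (T * M ^ 3) + 1)) = δ :=
        div_mul_cancel₀ _ (by positivity)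
      nlinarith [mul_pos hκ0 hX0]
    have h2 : 8 * M ^ 5 / W * X ≤ δ / 2 := by
      have h3 : 16 * M ^ 5 * X / δ ≤ W := by linarith
      rw [div_le_iff₀ hδ0] at h3
      rw [div_mul_eq_mul_div, div_le_iff₀ (by linarith)]
      linarith
    linarith
  have hAb : ∀ k, ‖r T i‖ - ε ≤ ‖A k T (e' i)‖ ∨ ¬ Λ ⊆ sqBox (k + N₀) := by
    intro k
    by_cases hsub : Λ ⊆ sqBox (k + N₀)
    · left
      have happ := resonant_approximation hρ (hA k).2 (hA k).1 hsub hres hG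
        (fun t ht => (hsumρ t).trans_le (hrG t ht)) hres' (by positivity) hnon (by linarith) hT
        (hηδ.trans (min_le_left _ _))
      have h1 := (Finset.single_le_sum (f := fun n => ‖A k T n - phase (-ω n) T * ρ T n‖)
        (fun _ _ => norm_nonneg _)
        (hsub (Finset.mem_map_of_mem e' (Finset.mem_univ i)))).trans happ
      have h2 : δ ≤ ε / 2 := min_le_right _ _
      have h3 := norm_sub_norm_le (phase (-ω (e' i)) T * ρ T (e' i)) (A k T (e' i))
      rw [norm_sub_rev, norm_mul, norm_phase, one_mul, hρe] at h3
      have h1' : ‖A k T (e' i) - phase (-ω (e' i)) T * r T i‖ ≤ 2 * δ := by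
        rw [← hρe]; exact h1.trans (by linarith)
      linarith
    · exact Or.inr hsub
  obtain ⟨N₁, hN₁⟩ := exists_subset_sqBox Λ
  refine ge_of_tendsto (hlim T (l • e i)).norm (eventually_atTop.mpr ⟨N₁, fun k hk => ?_⟩)
  exact (hAb k).resolve_right (not_not.mpr (hN₁ _ (hk.trans (Nat.le_add_right _ _))))

end Shadowing

section Chains

/-! ### The resonant chain -/

open scoped ComplexConjugate
open Complex (I)

/-- The resonant system on a chain of rectangles `c, n (j + 1); n j, p j` for `1 ≤ j ≤ J` sharing
the vertex `c`, which is also a vertex of the rectangle `c, e; d, f`. The modes `n 0` and `p 0` are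
padding. -/
structure IsChainFlow (J : ℕ) (μ : ℝ) (n p : ℕ → ℝ → ℂ) (c d e f : ℝ → ℂ) : Prop where
  n_zero : ∀ t, n 0 t = 0
  p_zero : ∀ t, p 0 t = 0
  p_gt : ∀ j, J < j → ∀ t, p j t = 0
  n_deriv : ∀ j t, HasDerivAt (n (j + 1)) (I * ((μ - n (j + 1) t * conj (n (j + 1) t)) * n (j + 1) t
    + 2 * n (j + 2) t * conj (p (j + 1) t) * c t + 2 * n j t * p j t * conj (c t))) t
  p_deriv : ∀ j t, HasDerivAt (p j) (I * ((μ - p j t * conj (p j t)) * p j t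
    + 2 * n (j + 1) t * conj (n j t) * c t)) t
  c_deriv : ∀ t, HasDerivAt c (I * ((μ - c t * conj (c t)) * c t
    + 2 * (∑ j ∈ Finset.range (J + 1), n j t * p j t * conj (n (j + 1) t))
    + 2 * d t * f t * conj (e t))) t
  d_deriv : ∀ t, HasDerivAt d (I * ((μ - d t * conj (d t)) * d t + 2 * c t * e t * conj (f t))) t
  f_deriv : ∀ t, HasDerivAt f (I * ((μ - f t * conj (f t)) * f t + 2 * c t * e t * conj (d t))) t
  e_deriv : ∀ t, HasDerivAt e (I * ((μ - e t * conj (e t)) * e t + 2 * d t * f t * conj (c t))) t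

theorem HasDerivAt.conj_comp {g : ℝ → ℂ} {g' : ℂ} {t : ℝ} (hg : HasDerivAt g g' t) :
    HasDerivAt (fun τ => conj (g τ)) (conj g') t :=
  Complex.conjCLE.hasFDerivAt.comp_hasDerivAt t hg

theorem HasDerivAt.norm_sq_of_eq {g : ℝ → ℂ} {g' : ℂ} {t φ : ℝ} (hg : HasDerivAt g g' t)
    (h : 2 * (conj (g t) * g').re = φ) : HasDerivAt (fun τ => ‖g τ‖ ^ 2) φ t := by
  have := hg.norm_sq
  rw [Complex.inner] at this
  rwa [← h, mul_comm (conj (g t))]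

theorem re_I_mul_ofReal_add (r : ℝ) (z w : ℂ) (h : w = r + z) : (I * w).re = -z.im := by
  simp [h]

namespace IsChainFlow

variable {J : ℕ} {μ : ℝ} {n p : ℕ → ℝ → ℂ} {c d e f : ℝ → ℂ}

/-- The flux through the `j`-th rectangle of a chain. -/
def flux (n p : ℕ → ℝ → ℂ) (c : ℝ → ℂ) (j : ℕ) (t : ℝ) : ℝ :=
  -4 * (n j t * p j t * conj (n (j + 1) t) * conj (c t)).im

theorem norm_sq_p (h : IsChainFlow J μ n p c d e f) (j : ℕ) (t : ℝ) :
    HasDerivAt (fun τ => ‖p j τ‖ ^ 2) (-flux n p c j t) t := by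
  refine (h.p_deriv j t).norm_sq_of_eq ?_
  rw [mul_left_comm, re_I_mul_ofReal_add ((μ - ‖p j t‖ ^ 2) * ‖p j t‖ ^ 2)
    (2 * conj (n j t * p j t * conj (n (j + 1) t) * conj (c t)))]
  · simp only [flux, Complex.mul_im, Complex.conj_im, Complex.conj_re]; simp; ring
  · push_cast
    rw [← Complex.mul_conj']
    simp only [map_mul, Complex.conj_conj]
    ring

theorem norm_sq_n (h : IsChainFlow J μ n p c d e f) (j : ℕ) (t : ℝ) :
    HasDerivAt (fun τ => ‖n (j + 1) τ‖ ^ 2) (flux n p c j t - flux n p c (j + 1) t) t := by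
  refine (h.n_deriv j t).norm_sq_of_eq ?_
  rw [mul_left_comm, re_I_mul_ofReal_add ((μ - ‖n (j + 1) t‖ ^ 2) * ‖n (j + 1) t‖ ^ 2)
    (2 * (n j t * p j t * conj (n (j + 1) t) * conj (c t)) +
      2 * conj (n (j + 1) t * p (j + 1) t * conj (n (j + 1 + 1) t) * conj (c t)))]
  · simp only [flux, Complex.mul_im, Complex.add_im, Complex.conj_im]; simp; ring
  · push_cast
    rw [← Complex.mul_conj']
    simp only [map_mul, Complex.conj_conj]
    ring

/-- The flux through the rectangle `c, e; d, f`. -/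
def clusterFlux (c d e f : ℝ → ℂ) (t : ℝ) : ℝ :=
  -4 * (d t * f t * conj (e t) * conj (c t)).im

theorem norm_sq_d (h : IsChainFlow J μ n p c d e f) (t : ℝ) :
    HasDerivAt (fun τ => ‖d τ‖ ^ 2) (-clusterFlux c d e f t) t := by
  refine (h.d_deriv t).norm_sq_of_eq ?_
  rw [mul_left_comm, re_I_mul_ofReal_add ((μ - ‖d t‖ ^ 2) * ‖d t‖ ^ 2)
    (2 * conj (d t * f t * conj (e t) * conj (c t)))]
  · simp only [clusterFlux, Complex.mul_im, Complex.conj_im]; simp; ring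
  · push_cast
    rw [← Complex.mul_conj']
    simp only [map_mul, Complex.conj_conj]
    ring

theorem norm_sq_f (h : IsChainFlow J μ n p c d e f) (t : ℝ) :
    HasDerivAt (fun τ => ‖f τ‖ ^ 2) (-clusterFlux c d e f t) t := by
  refine (h.f_deriv t).norm_sq_of_eq ?_
  rw [mul_left_comm, re_I_mul_ofReal_add ((μ - ‖f t‖ ^ 2) * ‖f t‖ ^ 2)
    (2 * conj (d t * f t * conj (e t) * conj (c t)))]
  · simp only [clusterFlux, Complex.mul_im, Complex.conj_im]; simp; ring
  · push_cast
    rw [← Complex.mul_conj']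
    simp only [map_mul, Complex.conj_conj]
    ring

theorem norm_sq_e (h : IsChainFlow J μ n p c d e f) (t : ℝ) :
    HasDerivAt (fun τ => ‖e τ‖ ^ 2) (clusterFlux c d e f t) t := by
  refine (h.e_deriv t).norm_sq_of_eq ?_
  rw [mul_left_comm, re_I_mul_ofReal_add ((μ - ‖e t‖ ^ 2) * ‖e t‖ ^ 2)
    (2 * (d t * f t * conj (e t) * conj (c t)))]
  · simp only [clusterFlux, Complex.mul_im]; simp; ring
  · push_cast
    rw [← Complex.mul_conj']
    ring

theorem norm_sq_c (h : IsChainFlow J μ n p c d e f) (t : ℝ) :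
    HasDerivAt (fun τ => ‖c τ‖ ^ 2)
      (∑ j ∈ Finset.range (J + 1), flux n p c j t + clusterFlux c d e f t) t := by
  refine (h.c_deriv t).norm_sq_of_eq ?_
  rw [mul_left_comm, re_I_mul_ofReal_add ((μ - ‖c t‖ ^ 2) * ‖c t‖ ^ 2)
    (2 * (∑ j ∈ Finset.range (J + 1), n j t * p j t * conj (n (j + 1) t) * conj (c t)) +
      2 * (d t * f t * conj (e t) * conj (c t)))]
  · simp only [flux, clusterFlux, ← Finset.mul_sum, ← Complex.im_sum]
    generalize ∑ j ∈ Finset.range (J + 1), n j t * p j t * conj (n (j + 1) t) * conj (c t) = z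
    generalize d t * f t * conj (e t) * conj (c t) = w
    simp
    ring
  · push_cast
    rw [← Complex.mul_conj', ← Finset.sum_mul]
    ring

/-- The neighbour interaction, which telescopes along the chain. -/
def neighbour (n p : ℕ → ℂ) (c : ℂ) (j : ℕ) : ℂ :=
  n (j - 1) * p (j - 1) * p j * conj (n (j + 1)) * conj c * conj c

/-- The total interaction of a chain. -/
def interaction (J : ℕ) (n p : ℕ → ℂ) : ℂ :=
  ∑ j ∈ Finset.range (J + 1), n j * p j * conj (n (j + 1))

/-- The action balance of the `j`-th rectangle of a chain. -/
def balance (n p : ℕ → ℂ) (j : ℕ) : ℝ :=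
  ‖p j‖ ^ 2 * (‖n j‖ ^ 2 - ‖n (j + 1)‖ ^ 2) - ‖n j‖ ^ 2 * ‖n (j + 1)‖ ^ 2

theorem hasDerivAt_link (h : IsChainFlow J μ n p c d e f) (j : ℕ) (t : ℝ) :
    HasDerivAt (fun τ => n j τ * p j τ * conj (n (j + 1) τ) * conj (c τ))
      (I * ((n j t * p j t * conj (n (j + 1) t)) * conj (c t) *
          ((-‖n j t‖ ^ 2 - ‖p j t‖ ^ 2 + ‖n (j + 1) t‖ ^ 2 : ℝ) : ℂ)
        - 2 * ((‖c t‖ ^ 2 * balance (fun i => n i t) (fun i => p i t) j : ℝ) : ℂ)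
        - 2 * (n j t * p j t * conj (n (j + 1) t)) *
            conj (interaction J (fun i => n i t) (fun i => p i t))
        + (n j t * p j t * conj (n (j + 1) t)) *
            conj (c t * conj (c t) * c t - 2 * d t * f t * conj (e t))
        + 2 * (neighbour (fun i => n i t) (fun i => p i t) (c t) j
            - neighbour (fun i => n i t) (fun i => p i t) (c t) (j + 1)))) t := by
  cases j with
  | zero =>
    simp only [h.n_zero, h.p_zero, balance, neighbour]
    simpa using hasDerivAt_const t (0 : ℂ)
  | succ j =>
    refine ((((h.n_deriv j t).mul (h.p_deriv (j + 1) t)).mul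
      (h.n_deriv (j + 1) t).conj_comp).mul (h.c_deriv t).conj_comp).congr_deriv ?_
    simp only [balance, neighbour, Nat.add_sub_cancel]
    push_cast
    simp only [← Complex.mul_conj', map_mul, map_add, map_sub, Complex.conj_conj, Complex.conj_I,
      Complex.conj_ofReal, map_ofNat, Pi.mul_apply]
    have : (∑ j ∈ Finset.range (J + 1), n j t * p j t * conj (n (j + 1) t)) =
      interaction J (fun i => n i t) (fun i => p i t) := rfl
    rw [this]
    ring

theorem hasDerivAt_interaction (h : IsChainFlow J μ n p c d e f) (t : ℝ) :
    HasDerivAt (fun τ => interaction J (fun i => n i τ) (fun i => p i τ) * conj (c τ))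
      (I * (∑ j ∈ Finset.range (J + 1), (n j t * p j t * conj (n (j + 1) t)) * conj (c t) *
          ((-‖n j t‖ ^ 2 - ‖p j t‖ ^ 2 + ‖n (j + 1) t‖ ^ 2 : ℝ) : ℂ)
        - 2 * ((‖c t‖ ^ 2 * ∑ j ∈ Finset.range (J + 1),
            balance (fun i => n i t) (fun i => p i t) j : ℝ) : ℂ)
        - 2 * ((‖interaction J (fun i => n i t) (fun i => p i t)‖ ^ 2 : ℝ) : ℂ)
        + interaction J (fun i => n i t) (fun i => p i t) *
            conj (c t * conj (c t) * c t - 2 * d t * f t * conj (e t)))) t := by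
  have h1 := HasDerivAt.fun_sum fun j (_ : j ∈ Finset.range (J + 1)) => h.hasDerivAt_link j t
  simp only [← Finset.sum_mul] at h1
  refine h1.congr_deriv ?_
  have h2 : neighbour (fun i => n i t) (fun i => p i t) (c t) (J + 1) = 0 := by
    simp [neighbour, h.p_gt (J + 1) (Nat.lt_succ_self J)]
  have h3 : neighbour (fun i => n i t) (fun i => p i t) (c t) 0 = 0 := by
    simp [neighbour, h.p_zero]
  rw [← Finset.mul_sum]
  simp only [Finset.sum_add_distrib, Finset.sum_sub_distrib, ← Finset.mul_sum, ← Finset.sum_mul]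
  rw [← Finset.sum_sub_distrib, Finset.sum_range_sub', h2, h3]
  have h4 : (∑ j ∈ Finset.range (J + 1), n j t * p j t * conj (n (j + 1) t)) =
    interaction J (fun i => n i t) (fun i => p i t) := rfl
  rw [h4]
  push_cast
  simp only [← Complex.mul_conj', ← Finset.mul_sum]
  ring

end IsChainFlow

theorem eq_of_hasDerivAt_zero {g : ℝ → ℝ} (h : ∀ t, HasDerivAt g 0 t) (t : ℝ) : g t = g 0 :=
  is_const_of_deriv_eq_zero (fun t => (h t).differentiableAt) (fun t => (h t).deriv) t 0

theorem HasDerivAt.re_I_mul {g : ℝ → ℂ} {w : ℂ} {t : ℝ} (h : HasDerivAt g (I * w) t) :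
    HasDerivAt (fun τ => (g τ).re) (-w.im) t := by
  have := Complex.reCLM.hasFDerivAt.comp_hasDerivAt t h
  simpa [Function.comp_def] using this

theorem HasDerivAt.im_I_mul {g : ℝ → ℂ} {w : ℂ} {t : ℝ} (h : HasDerivAt g (I * w) t) :
    HasDerivAt (fun τ => (g τ).im) w.re t := by
  have := Complex.imCLM.hasFDerivAt.comp_hasDerivAt t h
  simpa [Function.comp_def] using this

namespace IsChainFlow

variable {J : ℕ} {μ : ℝ} {n p : ℕ → ℝ → ℂ} {c d e f : ℝ → ℂ}

theorem hasDerivAt_cluster (h : IsChainFlow J μ n p c d e f) (t : ℝ) :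
    HasDerivAt (fun τ => d τ * f τ * conj (e τ) * conj (c τ))
      (I * (d t * f t * conj (e t) * conj (c t) *
          ((-‖d t‖ ^ 2 - ‖f t‖ ^ 2 + ‖e t‖ ^ 2 + ‖c t‖ ^ 2 : ℝ) : ℂ)
        + ((2 * ‖c t‖ ^ 2 * (‖e t‖ ^ 2 * ‖f t‖ ^ 2 + ‖e t‖ ^ 2 * ‖d t‖ ^ 2
            - ‖d t‖ ^ 2 * ‖f t‖ ^ 2) - 2 * (‖d t‖ ^ 2 * ‖f t‖ ^ 2 * ‖e t‖ ^ 2) : ℝ) : ℂ)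
        - 2 * (d t * f t * conj (e t)) *
            conj (interaction J (fun i => n i t) (fun i => p i t)))) t := by
  refine ((((h.d_deriv t).mul (h.f_deriv t)).mul (h.e_deriv t).conj_comp).mul
    (h.c_deriv t).conj_comp).congr_deriv ?_
  have : (∑ j ∈ Finset.range (J + 1), n j t * p j t * conj (n (j + 1) t)) =
    interaction J (fun i => n i t) (fun i => p i t) := rfl
  rw [this]
  push_cast
  simp only [← Complex.mul_conj', map_mul, map_add, map_sub, Complex.conj_conj, Complex.conj_I,
    Complex.conj_ofReal, map_ofNat, Pi.mul_apply]
  ring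

/-- The energy of a chain. -/
def energy (J : ℕ) (n p : ℕ → ℝ → ℂ) (c d e f : ℝ → ℂ) (t : ℝ) : ℝ :=
  8 * (interaction J (fun i => n i t) (fun i => p i t) * conj (c t)).re
    + 8 * (d t * f t * conj (e t) * conj (c t)).re
    - ∑ j ∈ Finset.range (J + 1), (‖n (j + 1) t‖ ^ 2) ^ 2
    - ∑ j ∈ Finset.range (J + 1), (‖p j t‖ ^ 2) ^ 2
    - ((‖c t‖ ^ 2) ^ 2 + (‖d t‖ ^ 2) ^ 2 + (‖e t‖ ^ 2) ^ 2 + (‖f t‖ ^ 2) ^ 2)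

theorem sum_mul_flux_sub (h : IsChainFlow J μ n p c d e f) (w : ℕ → ℝ) (t : ℝ) :
    ∑ j ∈ Finset.range (J + 1), w (j + 1) * (flux n p c j t - flux n p c (j + 1) t) =
      ∑ j ∈ Finset.range (J + 1), (w (j + 1) - w j) * flux n p c j t := by
  have h1 := Finset.sum_range_sub (fun j => w j * flux n p c j t) (J + 1)
  have h2 : flux n p c (J + 1) t = 0 := by simp [flux, h.p_gt (J + 1) (Nat.lt_succ_self J)]
  have h3 : flux n p c 0 t = 0 := by simp [flux, h.p_zero]
  rw [h2, h3, mul_zero, mul_zero, sub_zero] at h1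
  rw [← sub_eq_zero, ← neg_eq_zero, ← h1, ← Finset.sum_sub_distrib, ← Finset.sum_neg_distrib]
  exact Finset.sum_congr rfl fun j _ => by ring

theorem energy_eq (h : IsChainFlow J μ n p c d e f) (t : ℝ) :
    energy J n p c d e f t = energy J n p c d e f 0 := by
  refine eq_of_hasDerivAt_zero (fun t => ?_) t
  refine ((((((h.hasDerivAt_interaction t).re_I_mul.const_mul 8).add
    ((h.hasDerivAt_cluster t).re_I_mul.const_mul 8)).sub
    (HasDerivAt.fun_sum fun j _ => (h.norm_sq_n j t).pow 2)).sub
    (HasDerivAt.fun_sum fun j _ => (h.norm_sq_p j t).pow 2)).sub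
    (((((h.norm_sq_c t).pow 2).add ((h.norm_sq_d t).pow 2)).add ((h.norm_sq_e t).pow 2)).add
      ((h.norm_sq_f t).pow 2))).congr_deriv ?_
  set G := interaction J (fun i => n i t) (fun i => p i t) with hG
  set Y := d t * f t * conj (e t) with hY
  have hsn : ∑ j ∈ Finset.range (J + 1), ((2 : ℕ) : ℝ) * (‖n (j + 1) t‖ ^ 2) ^ (2 - 1) *
      (flux n p c j t - flux n p c (j + 1) t) = 2 * ∑ j ∈ Finset.range (J + 1),
        (‖n (j + 1) t‖ ^ 2 - ‖n j t‖ ^ 2) * flux n p c j t := by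
    rw [← h.sum_mul_flux_sub (fun j => ‖n j t‖ ^ 2) t, Finset.mul_sum]
    exact Finset.sum_congr rfl fun j _ => by norm_num; ring
  have hsp : ∑ j ∈ Finset.range (J + 1), ((2 : ℕ) : ℝ) * (‖p j t‖ ^ 2) ^ (2 - 1) *
      (-flux n p c j t) = -2 * ∑ j ∈ Finset.range (J + 1), ‖p j t‖ ^ 2 * flux n p c j t := by
    rw [Finset.mul_sum]
    exact Finset.sum_congr rfl fun j _ => by norm_num; ring
  have hsf : ∑ j ∈ Finset.range (J + 1), flux n p c j t = -4 * (G * conj (c t)).im := by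
    simp only [flux, ← Finset.mul_sum, ← Complex.im_sum, hG, interaction, Finset.sum_mul]
  have hsz : (∑ j ∈ Finset.range (J + 1), (n j t * p j t * conj (n (j + 1) t)) * conj (c t) *
          ((-‖n j t‖ ^ 2 - ‖p j t‖ ^ 2 + ‖n (j + 1) t‖ ^ 2 : ℝ) : ℂ)).im =
      -(1 / 4) * (∑ j ∈ Finset.range (J + 1), (‖n (j + 1) t‖ ^ 2 - ‖n j t‖ ^ 2) * flux n p c j t
        - ∑ j ∈ Finset.range (J + 1), ‖p j t‖ ^ 2 * flux n p c j t) := by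
    rw [← Finset.sum_sub_distrib, Finset.mul_sum, Complex.im_sum]
    refine Finset.sum_congr rfl fun j _ => ?_
    rw [Complex.im_mul_ofReal, flux]
    ring
  rw [hsn, hsp, hsf]
  have h1 : G * conj (c t * conj (c t) * c t - 2 * d t * f t * conj (e t)) =
      (G * conj (c t)) * ((‖c t‖ ^ 2 : ℝ) : ℂ) - 2 * (G * conj Y) := by
    push_cast
    simp only [hY, ← Complex.mul_conj', map_mul, map_sub, Complex.conj_conj, map_ofNat]
    ring
  rw [h1]
  have h3 : ∀ z : ℂ, (2 * z).im = 2 * z.im := fun z => by simp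
  have h2 : (Y * conj G).im = -(G * conj Y).im := by simp; ring
  simp only [Complex.add_im, Complex.sub_im, hsz, Complex.im_mul_ofReal, Complex.ofReal_im,
    mul_assoc (2 : ℂ), h3, h2, clusterFlux, ← hY]
  norm_num
  ring

end IsChainFlow

/-- The initial data of the chain: the first rung of the chain and all the pumps have size one, and
the cluster `c, d, e, f` is large. -/
structure IsChainStart (J : ℕ) (Γ : ℝ) (n p : ℕ → ℝ → ℂ) (c d e f : ℝ → ℂ) : Prop where
  n_one : n 1 0 = 1
  n_ne : ∀ j, j ≠ 1 → n j 0 = 0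
  p_one : ∀ j, 1 ≤ j → j ≤ J → p j 0 = 1
  c_eq : c 0 = Γ
  d_eq : d 0 = Γ
  e_eq : e 0 = ((Γ / √2 : ℝ) : ℂ)
  f_eq : f 0 = ((Γ / √2 : ℝ) : ℂ)

namespace IsChainFlow

variable {J : ℕ} {μ Γ : ℝ} {n p : ℕ → ℝ → ℂ} {c d e f : ℝ → ℂ}

theorem hasDerivAt_weight (h : IsChainFlow J μ n p c d e f) (w : ℕ → ℝ) (t : ℝ) :
    HasDerivAt (fun τ => ∑ j ∈ Finset.range (J + 1), w (j + 1) * ‖n (j + 1) τ‖ ^ 2)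
      (∑ j ∈ Finset.range (J + 1), (w (j + 1) - w j) * flux n p c j t) t := by
  rw [← h.sum_mul_flux_sub w t]
  exact HasDerivAt.fun_sum fun j _ => (h.norm_sq_n j t).const_mul (w (j + 1))

theorem sum_norm_sq_n (h : IsChainFlow J μ n p c d e f) (h0 : IsChainStart J Γ n p c d e f)
    (t : ℝ) : ∑ j ∈ Finset.range (J + 1), ‖n (j + 1) t‖ ^ 2 = 1 := by
  have h1 := eq_of_hasDerivAt_zero (fun t => by simpa using h.hasDerivAt_weight (fun _ => 1) t) t
  rw [h1, Finset.sum_range_succ']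
  simp [h0.n_one, h0.n_ne]

theorem norm_sq_p_eq (h : IsChainFlow J μ n p c d e f) (h0 : IsChainStart J Γ n p c d e f)
    {j : ℕ} (hj : j ≤ J) (t : ℝ) :
    ‖p j t‖ ^ 2 = ∑ i ∈ Finset.range (j + 1), ‖n i t‖ ^ 2 := by
  have h3 : flux n p c 0 = 0 := by ext; simp [flux, h.p_zero]
  have h1 : ∀ t, HasDerivAt (fun τ => ‖p j τ‖ ^ 2 - ∑ i ∈ Finset.range j, ‖n (i + 1) τ‖ ^ 2) 0 t :=
    fun t => by
      refine ((h.norm_sq_p j t).sub (HasDerivAt.fun_sum fun i _ => h.norm_sq_n i t)).congr_deriv ?_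
      rw [Finset.sum_range_sub' (fun i => flux n p c i t), h3]
      simp
  have h2 := eq_of_hasDerivAt_zero h1 t
  have h4 : ‖p j 0‖ ^ 2 - ∑ i ∈ Finset.range j, ‖n (i + 1) 0‖ ^ 2 = 0 := by
    cases j with
    | zero => simp [h.p_zero]
    | succ j =>
      rw [Finset.sum_range_succ', h0.p_one _ (by omega) hj]
      simp [h0.n_one, h0.n_ne]
  rw [Finset.sum_range_succ', h.n_zero]
  simp only [norm_zero]
  linarith

/-- The first moment of the actions along the chain. -/
def moment (J : ℕ) (n : ℕ → ℝ → ℂ) (t : ℝ) : ℝ :=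
  ∑ j ∈ Finset.range (J + 1), (j : ℝ) * ‖n (j + 1) t‖ ^ 2

/-- The total current along the chain. -/
def current (J : ℕ) (n p : ℕ → ℝ → ℂ) (c : ℝ → ℂ) (t : ℝ) : ℝ :=
  -(interaction J (fun i => n i t) (fun i => p i t) * conj (c t)).im

theorem sum_flux (t : ℝ) :
    ∑ j ∈ Finset.range (J + 1), flux n p c j t = 4 * current J n p c t := by
  simp only [flux, current, ← Finset.mul_sum, ← Complex.im_sum, interaction, Finset.sum_mul]
  ring

theorem hasDerivAt_moment (h : IsChainFlow J μ n p c d e f) (t : ℝ) :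
    HasDerivAt (moment J n) (4 * current J n p c t) t := by
  have := h.hasDerivAt_weight (fun j => (j : ℝ) - 1) t
  simp only [Nat.cast_add, Nat.cast_one, add_sub_cancel_right, sub_sub_cancel, one_mul,
    sum_flux] at this
  exact this

theorem moment_zero (h0 : IsChainStart J Γ n p c d e f) : moment J n 0 = 0 := by
  rw [moment, Finset.sum_range_succ']
  simp [h0.n_ne]

theorem moment_nonneg (t : ℝ) : 0 ≤ moment J n t :=
  Finset.sum_nonneg fun _ _ => by positivity

theorem moment_le (h : IsChainFlow J μ n p c d e f) (h0 : IsChainStart J Γ n p c d e f) (t : ℝ) :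
    moment J n t ≤ J := by
  rw [← mul_one (J : ℝ), ← h.sum_norm_sq_n h0 t, Finset.mul_sum]
  refine Finset.sum_le_sum fun j hj => ?_
  have : (j : ℝ) ≤ J := by exact_mod_cast Nat.lt_succ_iff.mp (Finset.mem_range.mp hj)
  gcongr

theorem sq_div_sqrt_two (Γ : ℝ) : (Γ / √2) ^ 2 = Γ ^ 2 / 2 := by
  rw [div_pow, Real.sq_sqrt (by norm_num)]

theorem norm_sq_d_eq (h : IsChainFlow J μ n p c d e f) (h0 : IsChainStart J Γ n p c d e f) (t : ℝ) :
    ‖d t‖ ^ 2 = 3 * Γ ^ 2 / 2 - ‖e t‖ ^ 2 := by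
  have h1 := eq_of_hasDerivAt_zero (g := fun t => ‖d t‖ ^ 2 + ‖e t‖ ^ 2)
    (fun t => ((h.norm_sq_d t).add (h.norm_sq_e t)).congr_deriv (by ring)) t
  simp only [h0.d_eq, h0.e_eq, Complex.norm_real, Real.norm_eq_abs, sq_abs, sq_div_sqrt_two] at h1
  linarith

theorem norm_sq_f_eq (h : IsChainFlow J μ n p c d e f) (h0 : IsChainStart J Γ n p c d e f) (t : ℝ) :
    ‖f t‖ ^ 2 = Γ ^ 2 - ‖e t‖ ^ 2 := by
  have h1 := eq_of_hasDerivAt_zero (g := fun t => ‖f t‖ ^ 2 + ‖e t‖ ^ 2)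
    (fun t => ((h.norm_sq_f t).add (h.norm_sq_e t)).congr_deriv (by ring)) t
  simp only [h0.f_eq, h0.e_eq, Complex.norm_real, Real.norm_eq_abs, sq_abs, sq_div_sqrt_two] at h1
  linarith

theorem norm_sq_c_eq (h : IsChainFlow J μ n p c d e f) (h0 : IsChainStart J Γ n p c d e f) (t : ℝ) :
    ‖c t‖ ^ 2 = Γ ^ 2 / 2 + moment J n t + ‖e t‖ ^ 2 := by
  have h1 := eq_of_hasDerivAt_zero (g := fun t => ‖c t‖ ^ 2 - moment J n t - ‖e t‖ ^ 2)
    (fun t => (((h.norm_sq_c t).sub (h.hasDerivAt_moment t)).sub (h.norm_sq_e t)).congr_deriv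
      (by rw [sum_flux]; ring)) t
  simp only [h0.c_eq, h0.e_eq, Complex.norm_real, Real.norm_eq_abs, sq_abs, sq_div_sqrt_two,
    moment_zero h0] at h1
  linarith

theorem norm_p_le (h : IsChainFlow J μ n p c d e f) (h0 : IsChainStart J Γ n p c d e f) (j : ℕ)
    (t : ℝ) : ‖p j t‖ ≤ 1 := by
  rcases le_or_gt j J with hj | hj
  · rw [← sq_le_one_iff₀ (norm_nonneg _), h.norm_sq_p_eq h0 hj, ← h.sum_norm_sq_n h0 t,
      Finset.sum_range_succ', h.n_zero]
    simp only [norm_zero, ne_eq, OfNat.ofNat_ne_zero, not_false_eq_true, zero_pow, add_zero]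
    exact Finset.sum_le_sum_of_subset_of_nonneg (Finset.range_subset_range.mpr (by omega))
      fun _ _ _ => by positivity
  · simp [h.p_gt j hj]

theorem sum_norm_mul_norm_le (h : IsChainFlow J μ n p c d e f)
    (h0 : IsChainStart J Γ n p c d e f) (t : ℝ) :
    ∑ j ∈ Finset.range (J + 1), ‖n j t‖ * ‖n (j + 1) t‖ ≤ 1 := by
  have h1 : ∑ j ∈ Finset.range (J + 1), ‖n j t‖ ^ 2 ≤ 1 := by
    rw [← h.sum_norm_sq_n h0 t, Finset.sum_range_succ', h.n_zero, Finset.sum_range_succ]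
    have := sq_nonneg ‖n (J + 1) t‖
    simp only [norm_zero]
    linarith
  have h2 := h.sum_norm_sq_n h0 t
  have h3 : ∑ j ∈ Finset.range (J + 1), ‖n j t‖ * ‖n (j + 1) t‖ ≤
      ∑ j ∈ Finset.range (J + 1), (‖n j t‖ ^ 2 / 2 + ‖n (j + 1) t‖ ^ 2 / 2) :=
    Finset.sum_le_sum fun j _ => by nlinarith [sq_nonneg (‖n j t‖ - ‖n (j + 1) t‖)]
  rw [Finset.sum_add_distrib, ← Finset.sum_div, ← Finset.sum_div] at h3
  linarith

theorem norm_n_le (h : IsChainFlow J μ n p c d e f)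
    (h0 : IsChainStart J Γ n p c d e f) {j : ℕ} (hj : j ≤ J + 1) (t : ℝ) : ‖n j t‖ ^ 2 ≤ 1 := by
  cases j with
  | zero => simp [h.n_zero]
  | succ j =>
    rw [← h.sum_norm_sq_n h0 t]
    exact Finset.single_le_sum (f := fun j => ‖n (j + 1) t‖ ^ 2) (fun _ _ => by positivity)
      (Finset.mem_range.mpr (by omega))

theorem norm_link_le (h : IsChainFlow J μ n p c d e f) (h0 : IsChainStart J Γ n p c d e f)
    (j : ℕ) (t : ℝ) : ‖n j t * p j t * conj (n (j + 1) t)‖ ≤ ‖n j t‖ * ‖n (j + 1) t‖ := by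
  rw [norm_mul, norm_mul, RCLike.norm_conj]
  have h1 := h.norm_p_le h0 j t
  calc ‖n j t‖ * ‖p j t‖ * ‖n (j + 1) t‖ ≤ ‖n j t‖ * 1 * ‖n (j + 1) t‖ := by gcongr
    _ = _ := by ring

theorem norm_interaction_le (h : IsChainFlow J μ n p c d e f) (h0 : IsChainStart J Γ n p c d e f)
    (t : ℝ) : ‖interaction J (fun i => n i t) (fun i => p i t)‖ ≤ 1 :=
  (norm_sum_le _ _).trans ((Finset.sum_le_sum fun j _ => h.norm_link_le h0 j t).trans
    (h.sum_norm_mul_norm_le h0 t))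

end IsChainFlow

/-- A lower bound for the balance of a sequence of actions against its partial sums. -/
theorem sum_balance_ge (a : ℕ → ℝ) (ha : a 0 = 0) (k : ℕ) :
    a 1 ^ 2 / 2 - a (k + 1) ^ 2 / 2 - (∑ i ∈ Finset.range (k + 1), a i) * a (k + 1) ≤
      ∑ j ∈ Finset.range (k + 1),
        ((∑ i ∈ Finset.range (j + 1), a i) * (a j - a (j + 1)) - a j * a (j + 1)) := by
  induction k with
  | zero => simp [ha]
  | succ k ih =>
    rw [Finset.sum_range_succ (fun j => (∑ i ∈ Finset.range (j + 1), a i) * (a j - a (j + 1)) -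
      a j * a (j + 1)) (k + 1), Finset.sum_range_succ a (k + 1)]
    nlinarith [sq_nonneg (a (k + 1) - a (k + 2))]

namespace IsChainFlow

variable {J : ℕ} {μ g : ℝ} {n p : ℕ → ℝ → ℂ} {c d e f : ℝ → ℂ}

theorem sum_balance (h : IsChainFlow J μ n p c d e f) {Γ : ℝ} (h0 : IsChainStart J Γ n p c d e f)
    (t : ℝ) : (‖n 1 t‖ ^ 2) ^ 2 / 2 - ‖n (J + 1) t‖ ^ 2 ≤
      ∑ j ∈ Finset.range (J + 1), balance (fun i => n i t) (fun i => p i t) j := by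
  have h1 := sum_balance_ge (fun j => ‖n j t‖ ^ 2) (by simp [h.n_zero]) J
  have h2 : ∑ j ∈ Finset.range (J + 1), balance (fun i => n i t) (fun i => p i t) j =
      ∑ j ∈ Finset.range (J + 1), ((∑ i ∈ Finset.range (j + 1), ‖n i t‖ ^ 2) *
        (‖n j t‖ ^ 2 - ‖n (j + 1) t‖ ^ 2) - ‖n j t‖ ^ 2 * ‖n (j + 1) t‖ ^ 2) := by
    refine Finset.sum_congr rfl fun j hj => ?_
    rw [balance, h.norm_sq_p_eq h0 (by simpa [Nat.lt_succ_iff] using hj)]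
  rw [h2]
  refine le_trans ?_ h1
  have h3 := h.sum_norm_sq_n h0 t
  rw [Finset.sum_range_succ] at h3
  have h4 : ∑ i ∈ Finset.range (J + 1), ‖n i t‖ ^ 2 = 1 - ‖n (J + 1) t‖ ^ 2 := by
    rw [Finset.sum_range_succ', h.n_zero]
    simp only [norm_zero]
    linarith
  simp only [h4]
  nlinarith [sq_nonneg (‖n (J + 1) t‖ ^ 2)]

theorem norm_c_bounds (h : IsChainFlow J μ n p c d e f) {Γ : ℝ}
    (h0 : IsChainStart J Γ n p c d e f) (hΓ : 0 < Γ) (hJ : (J : ℝ) ≤ Γ ^ 2 / 2) (t : ℝ) :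
    Γ ^ 2 / 2 ≤ ‖c t‖ ^ 2 ∧ ‖c t‖ ^ 2 ≤ 2 * Γ ^ 2 ∧ ‖c t‖ ≤ 3 / 2 * Γ := by
  have h1 := h.norm_sq_c_eq h0 t
  have h2 := h.norm_sq_f_eq h0 t
  have h3 := moment_nonneg (J := J) (n := n) t
  have h4 := h.moment_le h0 t
  have h5 := sq_nonneg ‖e t‖
  have h6 := sq_nonneg ‖f t‖
  have h7 : ‖c t‖ ^ 2 ≤ 2 * Γ ^ 2 := by linarith
  exact ⟨by linarith, h7, abs_le_of_sq_le_sq' (by nlinarith) (by linarith) |>.2⟩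

theorem norm_d_le (h : IsChainFlow J μ n p c d e f) {Γ : ℝ}
    (h0 : IsChainStart J Γ n p c d e f) (hΓ : 0 < Γ) (t : ℝ) : ‖d t‖ ≤ 5 / 4 * Γ := by
  have h1 := h.norm_sq_d_eq h0 t
  have h2 := sq_nonneg ‖e t‖
  exact abs_le_of_sq_le_sq' (by nlinarith) (by linarith) |>.2

theorem cluster_bound (h : IsChainFlow J μ n p c d e f) {Γ : ℝ}
    (h0 : IsChainStart J Γ n p c d e f) (hΓ : 0 < Γ) (hJ : (J : ℝ) ≤ Γ ^ 2 / 2)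
    (hJ' : (J : ℝ) + 1 ≤ 2 * Γ) (t : ℝ) :
    10 * (‖e t‖ ^ 2 - Γ ^ 2 / 2) ^ 2 + 2 * ‖c t * conj (d t) - 2 * conj (e t) * f t‖ ^ 2
      ≤ 14 * Γ := by
  have hE := h.energy_eq t
  have hc := (h.norm_c_bounds h0 hΓ hJ t).2.2
  have hG := h.norm_interaction_le h0 t
  have hw : ‖c t * conj (d t) - 2 * conj (e t) * f t‖ ^ 2 = ‖c t‖ ^ 2 * ‖d t‖ ^ 2 +
      4 * (‖e t‖ ^ 2 * ‖f t‖ ^ 2) - 4 * (d t * f t * conj (e t) * conj (c t)).re := by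
    simp only [← Complex.normSq_eq_norm_sq, Complex.normSq_apply]
    simp
    ring
  have hGc : (interaction J (fun i => n i t) (fun i => p i t) * conj (c t)).re ≤ 3 / 2 * Γ := by
    refine (Complex.re_le_norm _).trans ?_
    rw [norm_mul, RCLike.norm_conj]
    nlinarith [norm_nonneg (c t)]
  have hz : energy J n p c d e f 0 = -1 - J + 3 / 2 * Γ ^ 4 := by
    have z1 : interaction J (fun i => n i 0) (fun i => p i 0) = 0 := by
      refine Finset.sum_eq_zero fun j _ => ?_
      by_cases hj : j = 1
      · simp [h0.n_ne (j + 1) (by omega)]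
      · simp [h0.n_ne j hj]
    have z2 : ∑ j ∈ Finset.range (J + 1), (‖n (j + 1) 0‖ ^ 2) ^ 2 = 1 := by
      rw [Finset.sum_range_succ']
      simp [h0.n_one, h0.n_ne]
    have z3 : ∑ j ∈ Finset.range (J + 1), (‖p j 0‖ ^ 2) ^ 2 = J := by
      rw [Finset.sum_range_succ', h.p_zero, Finset.sum_congr rfl fun j hj => by
        rw [h0.p_one (j + 1) (by omega) (by simpa [Nat.succ_le_iff] using hj)]]
      simp
    have z4 : (d 0 * f 0 * conj (e 0) * conj (c 0)).re = Γ ^ 4 / 2 := by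
      rw [h0.c_eq, h0.d_eq, h0.e_eq, h0.f_eq]
      simp only [Complex.conj_ofReal, ← Complex.ofReal_mul, Complex.ofReal_re]
      have := sq_div_sqrt_two Γ
      linear_combination Γ ^ 2 * this
    rw [energy, z1, z2, z3, z4, h0.c_eq, h0.d_eq, h0.e_eq, h0.f_eq]
    simp only [Complex.norm_real, Real.norm_eq_abs, sq_abs, sq_div_sqrt_two]
    simp
    ring
  rw [hz, energy] at hE
  have hn : 0 ≤ ∑ j ∈ Finset.range (J + 1), (‖n (j + 1) t‖ ^ 2) ^ 2 :=
    Finset.sum_nonneg fun _ _ => by positivity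
  have hp : 0 ≤ ∑ j ∈ Finset.range (J + 1), (‖p j t‖ ^ 2) ^ 2 :=
    Finset.sum_nonneg fun _ _ => by positivity
  rw [h.norm_sq_c_eq h0 t, h.norm_sq_d_eq h0 t, h.norm_sq_f_eq h0 t] at hE hw
  set y := ‖e t‖ ^ 2 with hy
  set X := moment J n t
  nlinarith [sq_nonneg (2 * (y - Γ ^ 2 / 2) + X)]

theorem norm_cluster_le (h : IsChainFlow J μ n p c d e f)
    (h0 : IsChainStart J (g ^ 2) n p c d e f) (hg : 0 < g) (hJ : (J : ℝ) ≤ (g ^ 2) ^ 2 / 2)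
    (hJ' : (J : ℝ) + 1 ≤ 2 * g ^ 2) (t : ℝ) :
    ‖c t * conj (c t) * c t - 2 * d t * f t * conj (e t)‖ ≤ g ^ 2 * (3 / 2 * J + 7 * g) := by
  have hΓ : 0 < g ^ 2 := by positivity
  have hb := h.cluster_bound h0 hΓ hJ hJ' t
  have hc := (h.norm_c_bounds h0 hΓ hJ t).2.2
  have hd := h.norm_d_le h0 hΓ t
  set w := c t * conj (d t) - 2 * conj (e t) * f t with hw
  set y := ‖e t‖ ^ 2 - (g ^ 2) ^ 2 / 2 with hy
  have hX := moment_nonneg (J := J) (n := n) t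
  have hX' := h.moment_le h0 t
  have e1 : c t * conj (c t) * c t - 2 * d t * f t * conj (e t) =
      ((moment J n t + 2 * y : ℝ) : ℂ) * c t + d t * w := by
    have : moment J n t + 2 * y = ‖c t‖ ^ 2 - ‖d t‖ ^ 2 := by
      rw [h.norm_sq_c_eq h0, h.norm_sq_d_eq h0, hy]; ring
    rw [this]
    push_cast
    rw [← Complex.mul_conj', ← Complex.mul_conj', hw]
    ring
  have hy1 : |y| ≤ 6 / 5 * g := by
    refine abs_le_of_sq_le_sq (a := y) ?_ (by positivity)
    nlinarith [sq_nonneg ‖w‖]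
  have hw1 : ‖w‖ ≤ 27 / 10 * g :=
    abs_le_of_sq_le_sq' (by nlinarith [sq_nonneg y]) (by positivity) |>.2
  rw [e1]
  refine (norm_add_le _ _).trans ?_
  rw [norm_mul, norm_mul, Complex.norm_real, Real.norm_eq_abs]
  have h1 : |moment J n t + 2 * y| ≤ J + 12 / 5 * g := by
    refine (abs_add_le _ _).trans ?_
    rw [abs_mul, abs_two, abs_of_nonneg hX]
    linarith
  have h2 : |moment J n t + 2 * y| * ‖c t‖ ≤ (J + 12 / 5 * g) * (3 / 2 * g ^ 2) :=
    mul_le_mul h1 hc (norm_nonneg _) (by positivity)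
  have h3 : ‖d t‖ * ‖w‖ ≤ (5 / 4 * g ^ 2) * (27 / 10 * g) :=
    mul_le_mul hd hw1 (norm_nonneg _) (by positivity)
  have h4 : 0 < g ^ 2 * g := by positivity
  nlinarith

theorem exists_deriv_current (h : IsChainFlow J μ n p c d e f)
    (h0 : IsChainStart J (g ^ 2) n p c d e f) (hg : 0 < g) (hJ : (J : ℝ) ≤ (g ^ 2) ^ 2 / 2)
    (hJ' : (J : ℝ) + 1 ≤ 2 * g ^ 2) (t : ℝ) :
    ∃ v, HasDerivAt (current J n p c) v t ∧
      2 * ‖c t‖ ^ 2 * ((‖n 1 t‖ ^ 2) ^ 2 / 2 - ‖n (J + 1) t‖ ^ 2)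
        - g ^ 2 * (3 / 2 * J + 7 * g + 3) ≤ v := by
  refine ⟨_, (h.hasDerivAt_interaction t).im_I_mul.neg, ?_⟩
  have hΓ : 0 < g ^ 2 := by positivity
  have hc := (h.norm_c_bounds h0 hΓ hJ t).2.2
  set G := interaction J (fun i => n i t) (fun i => p i t) with hG
  have hG1 : ‖G‖ ≤ 1 := h.norm_interaction_le h0 t
  have hS := h.sum_balance h0 t
  set S := ∑ j ∈ Finset.range (J + 1), balance (fun i => n i t) (fun i => p i t) j
  have b1 : (G * conj (c t * conj (c t) * c t - 2 * d t * f t * conj (e t))).re ≤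
      g ^ 2 * (3 / 2 * J + 7 * g) := by
    refine (Complex.re_le_norm _).trans ?_
    rw [norm_mul, RCLike.norm_conj]
    have := h.norm_cluster_le h0 hg hJ hJ' t
    nlinarith [norm_nonneg (c t * conj (c t) * c t - 2 * d t * f t * conj (e t))]
  have b2 : (∑ j ∈ Finset.range (J + 1), (n j t * p j t * conj (n (j + 1) t)) * conj (c t) *
      ((-‖n j t‖ ^ 2 - ‖p j t‖ ^ 2 + ‖n (j + 1) t‖ ^ 2 : ℝ) : ℂ)).re ≤ 3 * g ^ 2 := by
    refine (Complex.re_le_norm _).trans ((norm_sum_le _ _).trans ?_)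
    have h1 : ∀ j ∈ Finset.range (J + 1), ‖(n j t * p j t * conj (n (j + 1) t)) * conj (c t) *
        ((-‖n j t‖ ^ 2 - ‖p j t‖ ^ 2 + ‖n (j + 1) t‖ ^ 2 : ℝ) : ℂ)‖ ≤
          ‖n j t‖ * ‖n (j + 1) t‖ * (3 / 2 * g ^ 2) * 2 := by
      intro j hj
      have hj' : j ≤ J := by simpa [Nat.lt_succ_iff] using hj
      rw [norm_mul, norm_mul _ (conj (c t)), RCLike.norm_conj, Complex.norm_real, Real.norm_eq_abs]
      have k1 := h.norm_n_le h0 (j := j) (by omega) t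
      have k2 := h.norm_n_le h0 (j := j + 1) (by omega) t
      have k3 := pow_le_one₀ (n := 2) (norm_nonneg _) (h.norm_p_le h0 j t)
      have k4 : |-‖n j t‖ ^ 2 - ‖p j t‖ ^ 2 + ‖n (j + 1) t‖ ^ 2| ≤ 2 := by
        rw [abs_le]
        constructor <;> nlinarith [sq_nonneg ‖n j t‖, sq_nonneg ‖p j t‖, sq_nonneg ‖n (j + 1) t‖]
      have k5 := h.norm_link_le h0 j t
      gcongr
    refine (Finset.sum_le_sum h1).trans ?_
    rw [← Finset.sum_mul, ← Finset.sum_mul]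
    have := h.sum_norm_mul_norm_le h0 t
    nlinarith
  have h3 : ∀ z : ℂ, (2 * z).re = 2 * z.re := fun z => by simp
  simp only [Complex.add_re, Complex.sub_re, h3, Complex.ofReal_re]
  nlinarith [sq_nonneg ‖G‖, mul_le_mul_of_nonneg_left hS (sq_nonneg ‖c t‖)]

end IsChainFlow

theorem mul_sub_le_of_hasDerivAt {u : ℝ → ℝ} {C a b : ℝ} (hab : a ≤ b)
    (hu : ∀ t ∈ Set.Icc a b, ∃ v, HasDerivAt u v t ∧ C ≤ v) : C * (b - a) ≤ u b - u a := by
  refine (convex_Icc a b).mul_sub_le_image_sub_of_le_deriv (fun t ht => ?_) (fun t ht => ?_)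
    (fun t ht => ?_) a (Set.left_mem_Icc.mpr hab) b (Set.right_mem_Icc.mpr hab) hab
  · obtain ⟨v, hv, -⟩ := hu t ht
    exact hv.continuousAt.continuousWithinAt
  · obtain ⟨v, hv, -⟩ := hu t (interior_subset ht)
    exact hv.differentiableAt.differentiableWithinAt
  · obtain ⟨v, hv, hC⟩ := hu t (interior_subset ht)
    rwa [hv.deriv]

namespace IsChainFlow

variable {J : ℕ} {μ Γ : ℝ} {n p : ℕ → ℝ → ℂ} {c d e f : ℝ → ℂ}

theorem abs_flux_le (h : IsChainFlow J μ n p c d e f) (h0 : IsChainStart J Γ n p c d e f)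
    (hΓ : 0 < Γ) (hJ : (J : ℝ) ≤ Γ ^ 2 / 2) (j : ℕ) (t : ℝ) :
    |flux n p c j t| ≤ 6 * Γ * (‖n j t‖ * ‖n (j + 1) t‖) := by
  have hc := (h.norm_c_bounds h0 hΓ hJ t).2.2
  have h1 := h.norm_link_le h0 j t
  rw [flux, abs_mul, abs_neg, Nat.abs_ofNat]
  have h2 := Complex.abs_im_le_norm (n j t * p j t * conj (n (j + 1) t) * conj (c t))
  rw [norm_mul _ (conj (c t)), RCLike.norm_conj] at h2
  have h3 : ‖n j t * p j t * conj (n (j + 1) t)‖ * ‖c t‖ ≤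
      ‖n j t‖ * ‖n (j + 1) t‖ * (3 / 2 * Γ) := by gcongr
  linarith

/-- Finite speed of propagation along the chain. -/
theorem norm_sq_last_le (h : IsChainFlow J μ n p c d e f) (h0 : IsChainStart J Γ n p c d e f)
    (hΓ : 0 < Γ) (hJ : (J : ℝ) ≤ Γ ^ 2 / 2) {t : ℝ} (ht : 0 ≤ t) :
    4 ^ J * ‖n (J + 1) t‖ ^ 2 ≤ Real.exp (9 * Γ * t) := by
  set F : ℝ → ℝ := fun τ => ∑ j ∈ Finset.range (J + 1), (4 : ℝ) ^ (j + 1) / 4 * ‖n (j + 1) τ‖ ^ 2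
    with hF
  have hF' := h.hasDerivAt_weight (fun j => (4 : ℝ) ^ j / 4)
  have hle : ∀ τ, ∑ j ∈ Finset.range (J + 1), ((4 : ℝ) ^ (j + 1) / 4 - 4 ^ j / 4) *
      flux n p c j τ ≤ 9 * Γ * F τ := by
    intro τ
    have h1 : ∀ j ∈ Finset.range (J + 1), ((4 : ℝ) ^ (j + 1) / 4 - 4 ^ j / 4) *
        flux n p c j τ ≤ 9 / 2 * Γ * (4 ^ j / 4 * ‖n j τ‖ ^ 2 +
          4 ^ (j + 1) / 4 * ‖n (j + 1) τ‖ ^ 2) := by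
      intro j _
      have h2 := (le_abs_self _).trans (h.abs_flux_le h0 hΓ hJ j τ)
      have h3 : ‖n j τ‖ * ‖n (j + 1) τ‖ ≤ ‖n j τ‖ ^ 2 / 4 + ‖n (j + 1) τ‖ ^ 2 := by
        nlinarith [sq_nonneg (‖n j τ‖ / 2 - ‖n (j + 1) τ‖)]
      have h4 : (0 : ℝ) < 4 ^ j := by positivity
      calc ((4 : ℝ) ^ (j + 1) / 4 - 4 ^ j / 4) * flux n p c j τ
          = 3 / 4 * 4 ^ j * flux n p c j τ := by ring
        _ ≤ 3 / 4 * 4 ^ j * (6 * Γ * (‖n j τ‖ ^ 2 / 4 + ‖n (j + 1) τ‖ ^ 2)) := by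
          gcongr
          exact h2.trans (by gcongr)
        _ = _ := by ring
    refine (Finset.sum_le_sum h1).trans ?_
    rw [← Finset.mul_sum, Finset.sum_add_distrib]
    have h5 : ∑ j ∈ Finset.range (J + 1), (4 : ℝ) ^ j / 4 * ‖n j τ‖ ^ 2 ≤ F τ := by
      rw [hF, Finset.sum_range_succ', h.n_zero]
      simp only [norm_zero]
      rw [Finset.sum_range_succ]
      have : 0 ≤ (4 : ℝ) ^ (J + 1) / 4 * ‖n (J + 1) τ‖ ^ 2 := by positivity
      linarith
    have h6 : 9 / 2 * Γ * (∑ j ∈ Finset.range (J + 1), (4 : ℝ) ^ j / 4 * ‖n j τ‖ ^ 2 + F τ) ≤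
        9 / 2 * Γ * (F τ + F τ) := by gcongr
    linarith
  have hanti : ∀ τ ∈ Set.Icc 0 t, ∃ v,
      HasDerivAt (fun τ => -(F τ * Real.exp (-(9 * Γ * τ)))) v τ ∧ 0 ≤ v := by
    intro τ _
    refine ⟨_, ((hF' τ).mul (((hasDerivAt_id τ).const_mul (9 * Γ)).neg.exp)).neg, ?_⟩
    have := hle τ
    have h7 := Real.exp_pos (-(9 * Γ * τ))
    simp only [id, mul_one, Pi.neg_apply]
    nlinarith
  have h8 := mul_sub_le_of_hasDerivAt ht hanti
  have h9 : F 0 = 1 := by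
    rw [hF]
    simp only
    rw [Finset.sum_range_succ']
    simp [h0.n_one, h0.n_ne]
  simp only [h9, mul_zero, neg_zero, Real.exp_zero, mul_one, zero_mul] at h8
  have h10 : F t ≤ Real.exp (9 * Γ * t) := by
    rw [Real.exp_neg, ← div_eq_mul_inv] at h8
    rw [← div_le_one (Real.exp_pos _)]
    linarith
  refine le_trans ?_ h10
  have h11 := Finset.single_le_sum (f := fun j => (4 : ℝ) ^ (j + 1) / 4 * ‖n (j + 1) t‖ ^ 2)
    (fun _ _ => by positivity) (Finset.self_mem_range_succ J)
  refine le_trans (le_of_eq ?_) h11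
  ring

theorem norm_sq_first_ge (h : IsChainFlow J μ n p c d e f) (h0 : IsChainStart J Γ n p c d e f)
    (hΓ : 0 < Γ) (hJ : (J : ℝ) ≤ Γ ^ 2 / 2) (hJ1 : 1 ≤ J) {t : ℝ} (ht : 0 ≤ t)
    (ht' : t ≤ 1 / (6 * Γ)) : 1 / 2 ≤ ‖n 1 t‖ ^ 2 := by
  have h1 := mul_sub_le_of_hasDerivAt (u := fun τ => ‖n 1 τ‖ ^ 2) (C := -(3 * Γ)) ht
    fun τ _ => ⟨_, h.norm_sq_n 0 τ, by
      have h2 := (le_abs_self _).trans (h.abs_flux_le h0 hΓ hJ 1 τ)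
      have h3 : flux n p c 0 τ = 0 := by simp [flux, h.p_zero]
      have h4 := h.sum_norm_sq_n h0 τ
      have h5 : ‖n 1 τ‖ ^ 2 + ‖n 2 τ‖ ^ 2 ≤ 1 := by
        rw [← h4]
        have h6 : Finset.range 2 ⊆ Finset.range (J + 1) :=
          Finset.range_subset_range.mpr (by omega)
        refine le_trans (le_of_eq ?_) (Finset.sum_le_sum_of_subset_of_nonneg h6
          fun _ _ _ => by positivity)
        simp [Finset.sum_range_succ]
      simp only [zero_add] at *
      rw [h3]
      norm_num at h2 ⊢
      nlinarith [sq_nonneg (‖n 1 τ‖ - ‖n 2 τ‖)]⟩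
  have h7 : 3 * Γ * t ≤ 1 / 2 := by
    rw [le_div_iff₀ (by positivity)] at ht'
    linarith
  simp only [h0.n_one, norm_one] at h1
  linarith

theorem two_pow_ge {J : ℕ} (hJ : 16 ≤ J) : 128 * (J : ℝ) ≤ 2 ^ J := by
  induction J, hJ using Nat.le_induction with
  | base => norm_num
  | succ k hk ih =>
    rw [pow_succ]
    push_cast
    have : (16 : ℝ) ≤ k := by exact_mod_cast hk
    linarith

/-- Transport along the chain: at time `J / (18 Γ)` the first moment is comparable to `J`. -/
theorem moment_ge {g : ℝ} (h : IsChainFlow J μ n p c d e f)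
    (h0 : IsChainStart J (g ^ 2) n p c d e f) (hJ : 16 ≤ J) (hg : g = 200 * J) :
    ((J : ℝ) - 3) / 432 ≤ moment J n (J / (18 * g ^ 2)) := by
  have hJr : (16 : ℝ) ≤ J := by exact_mod_cast hJ
  have hg0 : 0 < g := by rw [hg]; positivity
  have hgg : g ^ 2 = 40000 * J ^ 2 := by rw [hg]; ring
  have hΓ0 : 0 < g ^ 2 := by positivity
  have hJ1 : (J : ℝ) + 1 ≤ 2 * g ^ 2 := by rw [hgg]; nlinarith
  have hJ2 : (J : ℝ) ≤ (g ^ 2) ^ 2 / 2 := by nlinarith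
  set Γ := g ^ 2 with hΓ
  set T := (J : ℝ) / (18 * Γ) with hT
  set t₁ := 1 / (6 * Γ) with ht₁
  have ht₁0 : 0 < t₁ := by positivity
  have hΓt₁ : Γ * t₁ = 1 / 6 := by rw [ht₁]; field_simp
  have hΓT : Γ * T = J / 18 := by rw [hT]; field_simp
  have htT : t₁ ≤ T := by
    refine le_of_mul_le_mul_left ?_ hΓ0
    rw [hΓt₁, hΓT]
    linarith
  have hlast : ∀ t ∈ Set.Icc 0 T, ‖n (J + 1) t‖ ^ 2 ≤ 1 / 2 ^ J := by
    intro t ht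
    have h1 := h.norm_sq_last_le h0 hΓ0 hJ2 ht.1
    have h2 : Real.exp (9 * Γ * t) ≤ 2 ^ J := by
      have h3 : 9 * Γ * t ≤ J * Real.log 2 := by
        have h4 := Real.log_two_gt_d9
        have h5 : 9 * Γ * t ≤ 9 * (Γ * T) := by
          rw [mul_assoc]
          gcongr
          exact ht.2
        rw [hΓT] at h5
        nlinarith
      calc Real.exp (9 * Γ * t) ≤ Real.exp (J * Real.log 2) := Real.exp_le_exp.mpr h3
        _ = 2 ^ J := by rw [Real.exp_nat_mul, Real.exp_log two_pos]
    have h4 : (4 : ℝ) ^ J = 2 ^ J * 2 ^ J := by rw [← mul_pow]; norm_num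
    rw [le_div_iff₀ (by positivity)]
    rw [h4] at h1
    have h5 : (0 : ℝ) < 2 ^ J := by positivity
    refine le_of_mul_le_mul_left ?_ h5
    linarith
  set B := 4 * Γ ^ 2 / 2 ^ J + Γ * (3 / 2 * J + 7 * g + 3) with hB
  have hder : ∀ t ∈ Set.Icc 0 T, ∃ v, HasDerivAt (current J n p c) v t ∧
      ‖c t‖ ^ 2 * (‖n 1 t‖ ^ 2) ^ 2 - B ≤ v := by
    intro t ht
    obtain ⟨v, hv, hle⟩ := h.exists_deriv_current h0 hg0 hJ2 hJ1 t
    refine ⟨v, hv, ?_⟩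
    have h1 := h.norm_c_bounds h0 hΓ0 hJ2 t
    have h2 := hlast t ht
    have h3 : ‖c t‖ ^ 2 * ‖n (J + 1) t‖ ^ 2 ≤ 2 * Γ ^ 2 * (1 / 2 ^ J) := by
      gcongr
      exact h1.2.1
    have h4 : 4 * Γ ^ 2 / 2 ^ J = 2 * (2 * Γ ^ 2 * (1 / 2 ^ J)) := by ring
    rw [hB, h4]
    linarith
  have hB0 : 0 ≤ B := by positivity
  have hBT : B * T ≤ Γ / 96 := by
    have h1 : B = Γ * (4 * Γ / 2 ^ J + (3 / 2 * J + 7 * g + 3)) := by rw [hB]; ring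
    have h2 : 4 * Γ / 2 ^ J * (J / 18) ≤ Γ / 500 := by
      have := two_pow_ge hJ
      rw [div_mul_div_comm, div_le_div_iff₀ (by positivity) (by norm_num)]
      nlinarith
    have h3 : (3 / 2 * J + 7 * g + 3) * (J / 18) ≤ Γ / 400 := by
      rw [hΓ, hg]
      nlinarith
    calc B * T = (4 * Γ / 2 ^ J + (3 / 2 * J + 7 * g + 3)) * (Γ * T) := by rw [h1]; ring
      _ = 4 * Γ / 2 ^ J * (J / 18) + (3 / 2 * J + 7 * g + 3) * (J / 18) := by rw [hΓT]; ring
      _ ≤ Γ / 96 := by linarith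
  have hV0 : current J n p c 0 = 0 := by
    have z1 : interaction J (fun i => n i 0) (fun i => p i 0) = 0 := by
      refine Finset.sum_eq_zero fun j _ => ?_
      by_cases hj : j = 1
      · simp [h0.n_ne (j + 1) (by omega)]
      · simp [h0.n_ne j hj]
    simp [current, z1]
  have hV1 : Γ / 48 - B * t₁ ≤ current J n p c t₁ := by
    have h1 := mul_sub_le_of_hasDerivAt (u := current J n p c) (C := Γ ^ 2 / 8 - B) ht₁0.le
      fun t ht => by
        obtain ⟨v, hv, hle⟩ := hder t ⟨ht.1, ht.2.trans htT⟩
        refine ⟨v, hv, le_trans ?_ hle⟩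
        have h1 := (h.norm_c_bounds h0 hΓ0 hJ2 t).1
        have h2 := h.norm_sq_first_ge h0 hΓ0 hJ2 (by omega) ht.1 ht.2
        have h3 : (1 / 2 : ℝ) ^ 2 ≤ (‖n 1 t‖ ^ 2) ^ 2 := pow_le_pow_left₀ (by norm_num) h2 2
        have h4 : Γ ^ 2 / 2 * (1 / 2 : ℝ) ^ 2 ≤ ‖c t‖ ^ 2 * (‖n 1 t‖ ^ 2) ^ 2 :=
          mul_le_mul h1 h3 (by positivity) (by positivity)
        linarith
    rw [hV0] at h1
    have h2 : Γ ^ 2 / 8 * t₁ = Γ / 48 := by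
      calc Γ ^ 2 / 8 * t₁ = Γ / 8 * (Γ * t₁) := by ring
        _ = Γ / 48 := by rw [hΓt₁]; ring
    linarith
  have hV : ∀ t ∈ Set.Icc t₁ T, Γ / 96 ≤ current J n p c t := by
    intro t ht
    have h1 := mul_sub_le_of_hasDerivAt (u := current J n p c) (C := -B) ht.1
      fun τ hτ => by
        obtain ⟨v, hv, hle⟩ := hder τ ⟨ht₁0.le.trans hτ.1, hτ.2.trans ht.2⟩
        refine ⟨v, hv, le_trans ?_ hle⟩
        have : 0 ≤ ‖c τ‖ ^ 2 * (‖n 1 τ‖ ^ 2) ^ 2 := by positivity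
        linarith
    have h2 : B * t ≤ B * T := mul_le_mul_of_nonneg_left ht.2 hB0
    linarith
  have h1 := mul_sub_le_of_hasDerivAt (u := moment J n) (C := 4 * (Γ / 96)) htT
    fun t ht => ⟨_, h.hasDerivAt_moment t, mul_le_mul_of_nonneg_left (hV t ht) (by norm_num)⟩
  have h2 := moment_nonneg (J := J) (n := n) t₁
  have h3 : 4 * (Γ / 96) * (T - t₁) = ((J : ℝ) - 3) / 432 := by
    calc 4 * (Γ / 96) * (T - t₁) = (Γ * T - Γ * t₁) / 24 := by ring
      _ = _ := by rw [hΓT, hΓt₁]; ring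
  linarith

end IsChainFlow

/-! ### The combinatorial model of the chain -/

/-- Labels of the modes of a chain. -/
inductive Label
  | c | d | e | f
  | n (j : ℕ)
  | p (j : ℕ)
  deriving DecidableEq

namespace Label

/-- `Rect y w x z`: the pairs `y, w` and `x, z` are the diagonals of a rectangle of the chain. -/
inductive Rect : Label → Label → Label → Label → Prop
  | cn (j : ℕ) : Rect c (n (j + 1)) (n j) (p j)
  | nc (j : ℕ) : Rect (n (j + 1)) c (n j) (p j)
  | np (j : ℕ) : Rect (n j) (p j) c (n (j + 1))
  | pn (j : ℕ) : Rect (p j) (n j) c (n (j + 1))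
  | ce : Rect c e d f
  | ec : Rect e c d f
  | df : Rect d f c e
  | fd : Rect f d c e

/-- The interactions of a chain. -/
def Rel (x y z w : Label) : Prop :=
  (x = y ∧ z = w) ∨ (z = y ∧ x = w) ∨ Rect y w x z ∨ Rect y w z x

/-- The modes of a chain whose last vertex is `n k`. -/
def modes (k : ℕ) : Finset Label :=
  {c, d, e, f} ∪ (Finset.Icc 1 k).image n ∪ (Finset.Ico 1 k).image p

variable {k j : ℕ} {x y z w : Label}

theorem c_mem : c ∈ modes k := by simp [modes]
theorem d_mem : d ∈ modes k := by simp [modes]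
theorem e_mem : e ∈ modes k := by simp [modes]
theorem f_mem : f ∈ modes k := by simp [modes]
theorem n_mem : n j ∈ modes k ↔ 1 ≤ j ∧ j ≤ k := by simp [modes]
theorem p_mem : p j ∈ modes k ↔ 1 ≤ j ∧ j < k := by simp [modes]

theorem Rect.swap (h : Rect y w x z) : Rect w y x z := by
  cases h <;> constructor

theorem Rect.ne (h : Rect y w x z) : x ≠ y ∧ z ≠ y ∧ x ≠ z ∧ x ≠ w ∧ z ≠ w ∧ y ≠ w := by
  cases h <;> simp

theorem Rect.unique (h : Rect y w x z) {x' z' : Label} (h' : Rect y w x' z') :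
    x = x' ∧ z = z' := by
  cases h <;> cases h' <;> simp

theorem Rect.not_swap (h : Rect y w x z) : ¬ Rect y w z x := fun h' =>
  h.ne.2.2.1 (h.unique h').1

theorem Rect.mem (h : Rect y w x z) (hx : x ∈ modes k) (hy : y ∈ modes k) (hz : z ∈ modes k) :
    w ∈ modes k := by
  cases h <;> simp only [c_mem, d_mem, e_mem, f_mem, n_mem, p_mem] at * <;> omega

theorem symmRel_rel : SymmRel (Rel : Label → Label → Label → Label → Prop) := by
  have key : ∀ {x y z w : Label}, Rect y w x z → Rect x z y w ∨ Rect x z w y := by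
    intro x y z w h
    cases h
    · exact Or.inl (.np _)
    · exact Or.inr (.np _)
    · exact Or.inl (.cn _)
    · exact Or.inr (.cn _)
    · exact Or.inl .df
    · exact Or.inr .df
    · exact Or.inl .ce
    · exact Or.inr .ce
  refine ⟨fun x y z w h => ?_, fun x y z w h => ?_⟩
  · rcases h with h | h | h | h
    · exact Or.inr (Or.inl h)
    · exact Or.inl h
    · exact Or.inr (Or.inr (Or.inr h))
    · exact Or.inr (Or.inr (Or.inl h))
  · rcases h with ⟨rfl, rfl⟩ | ⟨rfl, rfl⟩ | h | h
    · exact Or.inl ⟨rfl, rfl⟩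
    · exact Or.inr (Or.inl ⟨rfl, rfl⟩)
    · exact Or.inr (Or.inr (key h))
    · refine Or.inr (Or.inr ?_)
      rcases key h with h | h
      · exact Or.inl h.swap
      · exact Or.inr h.swap

section Cub

variable {F : Finset Label} {a : Label → ℂ}

open scoped Classical in
/-- The contribution of the rectangles to the cubic interaction. -/
def rectSum (F : Finset Label) (a : Label → ℂ) (w : Label) : ℂ :=
  ∑ x ∈ F, ∑ y ∈ F, ∑ z ∈ F, if Rect y w x z then a x * conj (a y) * a z else 0

theorem cub_rel (hw : w ∈ F) : cub Rel F a a a w =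
    (2 * (∑ y ∈ F, (‖a y‖ ^ 2 : ℝ) : ℝ) - a w * conj (a w)) * a w + 2 * rectSum F a w := by
  classical
  have h1 : ∀ x y z, (if Rel x y z w then a x * conj (a y) * a z else 0) =
      (if z = w then (if y = x then a x * conj (a y) * a z else 0) else 0)
      + (if z = y then (if x = w then a x * conj (a y) * a z else 0) else 0)
      - (if z = w then (if y = w then (if x = w then a x * conj (a y) * a z else 0) else 0) else 0)
      + (if Rect y w x z then a x * conj (a y) * a z else 0)
      + (if Rect y w z x then a x * conj (a y) * a z else 0) := by
    intro x y z
    by_cases r1 : Rect y w x z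
    · have h2 := r1.ne
      have h3 := r1.not_swap
      simp [Rel, r1, h3, h2.2.2.2.2.1, h2.2.1]
    · by_cases r2 : Rect y w z x
      · have h2 := r2.ne
        simp [Rel, r1, r2, h2.1, h2.2.2.2.1]
      · by_cases h1 : z = w <;> by_cases h2 : y = x <;> by_cases h3 : z = y <;>
          by_cases h4 : x = w <;> simp_all [Rel, eq_comm]
  have h2 : ∑ x ∈ F, ∑ y ∈ F, ∑ z ∈ F, (if Rect y w z x then a x * conj (a y) * a z else 0) =
      rectSum F a w := by
    rw [rectSum, Finset.sum_comm]
    conv_lhs => enter [2, y]; rw [Finset.sum_comm]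
    rw [Finset.sum_comm]
    exact Finset.sum_congr rfl fun x _ => Finset.sum_congr rfl fun y _ =>
      Finset.sum_congr rfl fun z _ => by split_ifs <;> ring
  have h3 : cub Rel F a a a w = ∑ x ∈ F, ∑ y ∈ F, ∑ z ∈ F,
      (if Rel x y z w then a x * conj (a y) * a z else 0) := by
    unfold cub
    exact Finset.sum_congr rfl fun x _ => Finset.sum_congr rfl fun y _ =>
      Finset.sum_congr rfl fun z _ => by congr
  rw [h3]
  simp only [h1, Finset.sum_add_distrib, Finset.sum_sub_distrib, h2]
  rw [← rectSum]
  have s1 : ∑ x ∈ F, ∑ y ∈ F, ∑ z ∈ F,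
      (if z = w then (if y = x then a x * conj (a y) * a z else 0) else 0) =
        (∑ y ∈ F, (‖a y‖ ^ 2 : ℝ) : ℝ) * a w := by
    push_cast
    rw [Finset.sum_mul]
    refine Finset.sum_congr rfl fun x hx => ?_
    simp only [Finset.sum_ite_eq', hw, if_true, hx, Complex.mul_conj']
  have s2 : ∑ x ∈ F, ∑ y ∈ F, ∑ z ∈ F,
      (if z = y then (if x = w then a x * conj (a y) * a z else 0) else 0) =
        (∑ y ∈ F, (‖a y‖ ^ 2 : ℝ) : ℝ) * a w := by
    rw [Finset.sum_comm]
    push_cast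
    rw [Finset.sum_mul]
    refine Finset.sum_congr rfl fun y hy => ?_
    simp only [Finset.sum_ite_eq', hw, if_true, hy, ← Complex.mul_conj']
    ring
  have s3 : ∑ x ∈ F, ∑ y ∈ F, ∑ z ∈ F,
      (if z = w then (if y = w then (if x = w then a x * conj (a y) * a z else 0) else 0) else 0) =
        a w * conj (a w) * a w := by
    simp only [Finset.sum_ite_eq', hw, if_true]
  rw [s1, s2, s3]
  ring

theorem rectSum_eq (ha : ∀ x ∉ F, a x = 0) (S : Finset (Label × Label × Label))
    (hS : ∀ x ∈ F, ∀ y ∈ F, ∀ z ∈ F, Rect y w x z ↔ (x, y, z) ∈ S) :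
    rectSum F a w = ∑ q ∈ S, a q.1 * conj (a q.2.1) * a q.2.2 := by
  classical
  have h1 : rectSum F a w = ∑ q ∈ F ×ˢ F ×ˢ F,
      if q ∈ S then a q.1 * conj (a q.2.1) * a q.2.2 else 0 := by
    simp only [rectSum, Finset.sum_product]
    exact Finset.sum_congr rfl fun x hx => Finset.sum_congr rfl fun y hy =>
      Finset.sum_congr rfl fun z hz => by simp only [hS x hx y hy z hz]
  rw [h1, ← Finset.sum_filter]
  refine Finset.sum_subset (fun q hq => (Finset.mem_filter.mp hq).2) fun q hq hq' => ?_
  have h2 : ¬ (q.1 ∈ F ∧ q.2.1 ∈ F ∧ q.2.2 ∈ F) := fun h => hq' (by simp [h, hq])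
  by_cases h3 : q.1 ∈ F
  · by_cases h4 : q.2.1 ∈ F
    · rw [ha q.2.2 fun h5 => h2 ⟨h3, h4, h5⟩, mul_zero]
    · simp [ha _ h4]
  · simp [ha _ h3]

end Cub

theorem rectSum_n {F : Finset Label} {a : Label → ℂ} (ha : ∀ x ∉ F, a x = 0) :
    rectSum F a (n (j + 1)) =
      a (n j) * conj (a c) * a (p j) + a c * conj (a (p (j + 1))) * a (n (j + 2)) := by
  rw [rectSum_eq ha {(n j, c, p j), (c, p (j + 1), n (j + 2))}, Finset.sum_pair (by simp)]
  intro x _ y _ z _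
  simp only [Finset.mem_insert, Finset.mem_singleton, Prod.mk.injEq]
  constructor
  · intro h
    cases h <;> simp
  · rintro (⟨rfl, rfl, rfl⟩ | ⟨rfl, rfl, rfl⟩)
    · exact .cn j
    · exact .pn (j + 1)

theorem rectSum_p {F : Finset Label} {a : Label → ℂ} (ha : ∀ x ∉ F, a x = 0) :
    rectSum F a (p j) = a c * conj (a (n j)) * a (n (j + 1)) := by
  rw [rectSum_eq ha {(c, n j, n (j + 1))}, Finset.sum_singleton]
  intro x _ y _ z _
  simp only [Finset.mem_singleton, Prod.mk.injEq]
  constructor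
  · intro h
    cases h
    simp
  · rintro ⟨rfl, rfl, rfl⟩
    exact .np j

theorem rectSum_d {F : Finset Label} {a : Label → ℂ} (ha : ∀ x ∉ F, a x = 0) :
    rectSum F a d = a c * conj (a f) * a e := by
  rw [rectSum_eq ha {(c, f, e)}, Finset.sum_singleton]
  intro x _ y _ z _
  simp only [Finset.mem_singleton, Prod.mk.injEq]
  constructor
  · intro h
    cases h
    simp
  · rintro ⟨rfl, rfl, rfl⟩
    exact .fd

theorem rectSum_f {F : Finset Label} {a : Label → ℂ} (ha : ∀ x ∉ F, a x = 0) :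
    rectSum F a f = a c * conj (a d) * a e := by
  rw [rectSum_eq ha {(c, d, e)}, Finset.sum_singleton]
  intro x _ y _ z _
  simp only [Finset.mem_singleton, Prod.mk.injEq]
  constructor
  · intro h
    cases h
    simp
  · rintro ⟨rfl, rfl, rfl⟩
    exact .df

theorem rectSum_e {F : Finset Label} {a : Label → ℂ} (ha : ∀ x ∉ F, a x = 0) :
    rectSum F a e = a d * conj (a c) * a f := by
  rw [rectSum_eq ha {(d, c, f)}, Finset.sum_singleton]
  intro x _ y _ z _
  simp only [Finset.mem_singleton, Prod.mk.injEq]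
  constructor
  · intro h
    cases h
    simp
  · rintro ⟨rfl, rfl, rfl⟩
    exact .ce

theorem rectSum_c {J : ℕ} {a : Label → ℂ} (ha : ∀ x ∉ modes (J + 1), a x = 0) :
    rectSum (modes (J + 1)) a c =
      ∑ j ∈ Finset.range (J + 1), a (n j) * a (p j) * conj (a (n (j + 1)))
        + a d * a f * conj (a e) := by
  rw [rectSum_eq ha (insert (d, e, f) ((Finset.range (J + 1)).image
    fun j => (n j, n (j + 1), p j))), Finset.sum_insert (by simp),
    Finset.sum_image (fun i _ j _ h => by simpa using h), add_comm]
  · congr 1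
    · exact Finset.sum_congr rfl fun j _ => by ring
    · ring
  · intro x _ y hy z _
    simp only [Finset.mem_insert, Finset.mem_image, Finset.mem_range,
      Prod.mk.injEq]
    constructor
    · intro h
      cases h with
      | nc j => exact Or.inr ⟨j, (n_mem.mp hy).2, rfl, rfl, rfl⟩
      | ec => simp
    · rintro (⟨rfl, rfl, rfl⟩ | ⟨j, -, rfl, rfl, rfl⟩)
      · exact .ec
      · exact .nc j

/-- A resonant flow on the modes of a chain is a chain flow. -/
theorem isChainFlow {J : ℕ} {r : ℝ → Label → ℂ}
    (hr : IsFlow Rel (modes (J + 1)) (fun _ => 0) r) :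
    IsChainFlow J (2 * ∑ y ∈ modes (J + 1), ‖r 0 y‖ ^ 2) (fun j t => r t (n j))
      (fun j t => r t (p j)) (fun t => r t c) (fun t => r t d) (fun t => r t e)
      (fun t => r t f) := by
  have hz := hr.zero
  have key : ∀ t, ∀ w ∈ modes (J + 1), HasDerivAt (fun τ => r τ w)
      (I * (((2 * ∑ y ∈ modes (J + 1), ‖r 0 y‖ ^ 2 : ℝ) - r t w * conj (r t w)) * r t w
        + 2 * rectSum (modes (J + 1)) (r t) w)) t := by
    intro t w hw
    refine (hr.deriv t w hw).congr_deriv ?_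
    rw [field, cub_rel hw, hr.mass_eq symmRel_rel t]
    push_cast
    ring
  have hn : ∀ j t, ¬ (1 ≤ j ∧ j ≤ J + 1) → r t (n j) = 0 := fun j t h =>
    hz t _ fun h' => h (n_mem.mp h')
  have hp : ∀ j t, ¬ (1 ≤ j ∧ j < J + 1) → r t (p j) = 0 := fun j t h =>
    hz t _ fun h' => h (p_mem.mp h')
  refine ⟨fun t => hn 0 t (by omega), fun t => hp 0 t (by omega), fun j hj t => hp j t (by omega),
    fun j t => ?_, fun j t => ?_, fun t => ?_, fun t => ?_, fun t => ?_, fun t => ?_⟩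
  · by_cases hj : j ≤ J
    · refine (key t _ (n_mem.mpr ⟨by omega, by omega⟩)).congr_deriv ?_
      rw [rectSum_n (hz t)]
      push_cast
      ring
    · have h1 : (fun τ => r τ (n (j + 1))) = fun _ => 0 := funext fun τ => hn _ τ (by omega)
      simp only [h1, hn (j + 1) t (by omega), hp j t (by omega), hp (j + 1) t (by omega)]
      simpa using hasDerivAt_const t (0 : ℂ)
  · by_cases hj : 1 ≤ j ∧ j < J + 1
    · refine (key t _ (p_mem.mpr hj)).congr_deriv ?_
      rw [rectSum_p (hz t)]
      push_cast
      ring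
    · have h1 : (fun τ => r τ (p j)) = fun _ => 0 := funext fun τ => hp _ τ hj
      have h2 : r t (n (j + 1)) * conj (r t (n j)) = 0 := by
        by_cases h3 : j = 0
        · simp [h3, hn 0 t (by omega)]
        · simp [hn (j + 1) t (by omega)]
      simp only [h1, hp j t hj, mul_assoc, h2]
      simpa using hasDerivAt_const t (0 : ℂ)
  · refine (key t _ c_mem).congr_deriv ?_
    rw [rectSum_c (hz t)]
    push_cast
    ring
  · refine (key t _ d_mem).congr_deriv ?_
    rw [rectSum_d (hz t)]
    push_cast
    ring
  · refine (key t _ f_mem).congr_deriv ?_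
    rw [rectSum_f (hz t)]
    push_cast
    ring
  · refine (key t _ e_mem).congr_deriv ?_
    rw [rectSum_e (hz t)]
    push_cast
    ring

end Label

end Chains

/-! ### Placement of a chain in the plane -/

namespace Label

/-- The dot product on `ℚ²`. -/
def dotQ (a b : ℚ × ℚ) : ℚ := a.1 * b.1 + a.2 * b.2

/-- The cross product on `ℚ²`. -/
def crossQ (a b : ℚ × ℚ) : ℚ := a.1 * b.2 - a.2 * b.1

theorem dotQ_self_eq_zero {a : ℚ × ℚ} : dotQ a a = 0 ↔ a = 0 := by
  constructor
  · intro h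
    unfold dotQ at h
    have h1 : a.1 = 0 := by nlinarith [sq_nonneg a.1, sq_nonneg a.2]
    have h2 : a.2 = 0 := by nlinarith [sq_nonneg a.1, sq_nonneg a.2]
    exact Prod.ext h1 h2
  · rintro rfl
    simp [dotQ]

/-- The corner relation of the rectangles of a chain, including the degenerate ones. -/
def Corner (x y z : Label) : Prop := x = y ∨ z = y ∨ ∃ w, Rect y w x z ∨ Rect y w z x

theorem Corner.symm {x y z : Label} (h : Corner x y z) : Corner z y x := by
  rcases h with h | h | ⟨w, h | h⟩
  · exact Or.inr (Or.inl h)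
  · exact Or.inl h
  · exact Or.inr (Or.inr ⟨w, Or.inr h⟩)
  · exact Or.inr (Or.inr ⟨w, Or.inl h⟩)

/-- A placement of the modes of a chain in the plane whose only right angles are those of the
rectangles of the chain. -/
structure IsPlacement (k : ℕ) (L : ℚ) (P : Label → ℚ × ℚ) : Prop where
  c_eq : P c = 0
  d_eq : P d = (1, 0)
  e_eq : P e = (1, 2)
  f_eq : P f = (0, 2)
  n_one : P (n 1) = (5 * L, 4 * L)
  n_succ : ∀ j, 1 ≤ j → j < k → P (n (j + 1)) = P (n j) + P (p j)
  dot_np : ∀ j, 1 ≤ j → j < k → dotQ (P (n j)) (P (p j)) = 0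
  le_p : ∀ j, 1 ≤ j → j < k → 41 * L ^ 2 ≤ dotQ (P (p j)) (P (p j))
  p_le : ∀ j, 1 ≤ j → j < k → dotQ (P (p j)) (P (p j)) ≤ 4 * (41 * L ^ 2)
  corner : ∀ x ∈ modes k, ∀ y ∈ modes k, ∀ z ∈ modes k,
    dotQ (P x - P y) (P z - P y) = 0 → Corner x y z
  cross : ∀ x ∈ modes k, crossQ (P (n k)) (P x) = 0 → x = c ∨ x = n k

theorem mem_modes_one {x : Label} : x ∈ modes 1 ↔ x = c ∨ x = d ∨ x = e ∨ x = f ∨ x = n 1 := by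
  simp [modes]

theorem exists_isPlacement_one {L : ℚ} (hL : 2 ≤ L) : ∃ P, IsPlacement 1 L P := by
  let P : Label → ℚ × ℚ := fun x => match x with
    | c => 0
    | d => (1, 0)
    | e => (1, 2)
    | f => (0, 2)
    | n _ => (5 * L, 4 * L)
    | p _ => 0
  refine ⟨P, rfl, rfl, rfl, rfl, rfl, ?_, ?_, ?_, ?_, ?_, ?_⟩
  · intro j h1 h2; omega
  · intro j h1 h2; omega
  · intro j h1 h2; omega
  · intro j h1 h2; omega
  · intro x hx y hy z hz h
    rw [mem_modes_one] at hx hy hz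
    unfold dotQ at h
    have r1 : Corner d c f := Or.inr (Or.inr ⟨e, Or.inl .ce⟩)
    have r2 : Corner d e f := Or.inr (Or.inr ⟨c, Or.inl .ec⟩)
    have r3 : Corner c d e := Or.inr (Or.inr ⟨f, Or.inl .df⟩)
    have r4 : Corner c f e := Or.inr (Or.inr ⟨d, Or.inl .fd⟩)
    rcases hx with rfl | rfl | rfl | rfl | rfl <;> rcases hy with rfl | rfl | rfl | rfl | rfl <;>
      rcases hz with rfl | rfl | rfl | rfl | rfl <;>
      first
      | exact Or.inl rfl
      | exact Or.inr (Or.inl rfl)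
      | assumption
      | exact Corner.symm (by assumption)
      | (exfalso
         simp only [P, Prod.fst_sub, Prod.snd_sub, Prod.fst_zero, Prod.snd_zero] at h
         nlinarith)
  · intro x hx h
    rw [mem_modes_one] at hx
    unfold crossQ at h
    rcases hx with rfl | rfl | rfl | rfl | rfl <;>
      first
      | exact Or.inl rfl
      | exact Or.inr rfl
      | (exfalso
         simp only [P] at h
         linarith)

theorem finite_setOf_quadratic_eq_zero {A B C : ℚ} (h : A ≠ 0 ∨ B ≠ 0 ∨ C ≠ 0) :
    {t : ℚ | A * t ^ 2 + B * t + C = 0}.Finite := by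
  open Polynomial in
  let q : ℚ[X] := Polynomial.C A * X ^ 2 + Polynomial.C B * X + Polynomial.C C
  have hq : q ≠ 0 := by
    intro h0
    have h1 := congrArg (fun r : Polynomial ℚ => (r.coeff 2, r.coeff 1, r.coeff 0)) h0
    simp [q, Polynomial.coeff_X, Polynomial.coeff_C] at h1
    tauto
  refine (Polynomial.finite_setOfPred_isRoot hq).subset fun t ht => ?_
  simpa [q, Polynomial.IsRoot] using ht

namespace IsPlacement

variable {k : ℕ} {L : ℚ} {P : Label → ℚ × ℚ} {x y z w : Label}

theorem injOn (h : IsPlacement k L P) (hx : x ∈ modes k) (hy : y ∈ modes k) (hxy : P x = P y) :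
    x = y := by
  have h1 : dotQ (P x - P y) (P x - P y) = 0 := by simp [hxy, dotQ]
  rcases h.corner x hx y hy x hx h1 with h | h | ⟨w, h | h⟩
  · exact h
  · exact h
  · exact absurd rfl h.ne.2.2.1
  · exact absurd rfl h.ne.2.2.1

theorem add_eq (h : IsPlacement k L P) (hr : Rect y w x z) (hx : x ∈ modes k) (hy : y ∈ modes k)
    (hz : z ∈ modes k) : P y + P w = P x + P z := by
  have hw := hr.mem hx hy hz
  cases hr <;> (try simp only [n_mem, p_mem] at hx hy hz hw) <;>
    first
    | (rw [h.n_succ _ (by omega) (by omega), h.c_eq]; abel)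
    | simp [h.c_eq, h.d_eq, h.e_eq, h.f_eq]

theorem dotQ_eq_zero (h : IsPlacement k L P) (hr : Rect y w x z) (hx : x ∈ modes k)
    (hy : y ∈ modes k) (hz : z ∈ modes k) : dotQ (P x - P y) (P z - P y) = 0 := by
  have hw := hr.mem hx hy hz
  cases hr <;> (try simp only [n_mem, p_mem] at hx hy hz hw) <;>
    first
    | (rename_i j
       have h1 := h.dot_np j (by omega) (by omega)
       rw [h.n_succ _ (by omega) (by omega)]
       try rw [h.c_eq]
       simp only [dotQ, Prod.fst_sub, Prod.snd_sub, Prod.fst_add, Prod.snd_add, Prod.fst_zero,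
         Prod.snd_zero] at h1 ⊢
       linarith)
    | (rename_i j
       have h1 := h.dot_np j (by omega) (by omega)
       rw [h.c_eq]
       simp only [dotQ, Prod.fst_sub, Prod.snd_sub, Prod.fst_zero, Prod.snd_zero] at h1 ⊢
       linarith)
    | simp [h.c_eq, h.d_eq, h.e_eq, h.f_eq, dotQ]

/-- The candidate placements of a chain with one more vertex. -/
def extend (k : ℕ) (P : Label → ℚ × ℚ) (t : ℚ) : Label → ℚ × ℚ :=
  Function.update (Function.update P (p k) (-t * (P (n k)).2, t * (P (n k)).1))
    (n (k + 1)) ((P (n k)).1 - t * (P (n k)).2, (P (n k)).2 + t * (P (n k)).1)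

theorem extend_n (t : ℚ) : extend k P t (n (k + 1)) =
    ((P (n k)).1 - t * (P (n k)).2, (P (n k)).2 + t * (P (n k)).1) := by
  simp [extend]

theorem extend_p (t : ℚ) : extend k P t (p k) = (-t * (P (n k)).2, t * (P (n k)).1) := by
  simp [extend]

theorem extend_of_mem (t : ℚ) (hx : x ∈ modes k) : extend k P t x = P x := by
  have h1 : x ≠ n (k + 1) := by rintro rfl; have := n_mem.mp hx; omega
  have h2 : x ≠ p k := by rintro rfl; have := p_mem.mp hx; omega
  simp [extend, h1, h2]

theorem mem_modes_succ (hk : 1 ≤ k) :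
    x ∈ modes (k + 1) ↔ x ∈ modes k ∨ x = p k ∨ x = n (k + 1) := by
  cases x <;> simp [c_mem, d_mem, e_mem, f_mem, n_mem, p_mem] <;> omega

theorem corner_or_finite (h : IsPlacement k L P) (hk : 1 ≤ k) (hx : x ∈ modes (k + 1))
    (hy : y ∈ modes (k + 1)) (hz : z ∈ modes (k + 1)) :
    Corner x y z ∨ {t | dotQ (extend k P t x - extend k P t y)
      (extend k P t z - extend k P t y) = 0}.Finite := by
  have hnk : n k ∈ modes k := n_mem.mpr ⟨hk, le_rfl⟩
  set N := P (n k) with hN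
  have hN0 : N.1 ^ 2 + N.2 ^ 2 ≠ 0 := by
    intro h0
    have h1 : P (n k) = P c := by
      rw [h.c_eq, ← dotQ_self_eq_zero, dotQ, ← hN]
      linarith
    exact absurd (h.injOn hnk c_mem h1) (by simp)
  have hsymm : ∀ {x z}, {t | dotQ (extend k P t x - extend k P t y)
      (extend k P t z - extend k P t y) = 0} = {t | dotQ (extend k P t z - extend k P t y)
      (extend k P t x - extend k P t y) = 0} := by
    intro x z
    ext t
    simp only [Set.mem_ofPred_eq, dotQ, mul_comm]
  -- one new corner point, the others old
  have hP : ∀ z ∈ modes k, y ∈ modes k → Corner (p k) y z ∨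
      {t | dotQ (extend k P t (p k) - extend k P t y)
        (extend k P t z - extend k P t y) = 0}.Finite := by
    intro z hz hy
    by_cases h0 : crossQ N (P z - P y) = 0 ∧ dotQ (P y) (P z - P y) = 0
    · left
      have h1 := h.corner c c_mem y hy z hz (by
        rw [h.c_eq]
        have := h0.2
        simp only [dotQ, Prod.fst_sub, Prod.snd_sub, Prod.fst_zero, Prod.snd_zero] at this ⊢
        linarith)
      rcases h1 with rfl | h1 | ⟨w, h1⟩
      · rw [h.c_eq, sub_zero] at h0
        rcases h.cross z hz h0.1 with rfl | rfl
        · exact Or.inr (Or.inl rfl)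
        · exact Or.inr (Or.inr ⟨_, Or.inr (.cn k)⟩)
      · exact Or.inr (Or.inl h1)
      · exfalso
        have h2 : w ∈ modes k ∧ P w = P z - P y ∧ w ≠ c := by
          rcases h1 with h1 | h1
          · refine ⟨h1.mem c_mem hy hz, ?_, h1.ne.2.2.2.1.symm⟩
            have := h.add_eq h1 c_mem hy hz
            rw [h.c_eq, zero_add] at this
            rw [← this]; abel
          · refine ⟨h1.mem hz hy c_mem, ?_, h1.ne.2.2.2.2.1.symm⟩
            have := h.add_eq h1 hz hy c_mem
            rw [h.c_eq, add_zero] at this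
            rw [← this]; abel
        rcases h.cross w h2.1 (by rw [h2.2.1]; exact h0.1) with h3 | rfl
        · exact h2.2.2 h3
        · rcases h1 with h1 | h1
          · cases h1
            have := p_mem.mp hy
            omega
          · cases h1
    · right
      refine (finite_setOf_quadratic_eq_zero (A := 0) (B := crossQ N (P z - P y))
        (C := -dotQ (P y) (P z - P y)) ?_).subset fun t ht => ?_
      · by_contra! h1
        exact h0 ⟨h1.2.1, neg_eq_zero.mp h1.2.2⟩
      · simp only [Set.mem_ofPred_eq, extend_p, extend_of_mem t hy, extend_of_mem t hz, dotQ, crossQ,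
          Prod.fst_sub, Prod.snd_sub, ← hN] at ht ⊢
        linarith
  have hQ : ∀ z ∈ modes k, y ∈ modes k → Corner (n (k + 1)) y z ∨
      {t | dotQ (extend k P t (n (k + 1)) - extend k P t y)
        (extend k P t z - extend k P t y) = 0}.Finite := by
    intro z hz hy
    by_cases h0 : crossQ N (P z - P y) = 0 ∧ dotQ (N - P y) (P z - P y) = 0
    · left
      rcases h.corner (n k) hnk y hy z hz h0.2 with rfl | h1 | ⟨w, h1⟩
      · have h2 : crossQ (P (n k)) (P z) = 0 := by
          have := h0.1
          simp only [crossQ, Prod.fst_sub, Prod.snd_sub, hN] at this ⊢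
          linarith
        rcases h.cross z hz h2 with rfl | rfl
        · exact Or.inr (Or.inr ⟨_, Or.inr (.np k)⟩)
        · exact Or.inr (Or.inl rfl)
      · exact Or.inr (Or.inl h1)
      · exfalso
        have h2 : w ∈ modes k ∧ P w = N + (P z - P y) ∧ w ≠ n k := by
          rcases h1 with h1 | h1
          · refine ⟨h1.mem hnk hy hz, ?_, h1.ne.2.2.2.1.symm⟩
            have := h.add_eq h1 hnk hy hz
            rw [← add_sub_assoc, hN, ← this]; abel
          · refine ⟨h1.mem hz hy hnk, ?_, h1.ne.2.2.2.2.1.symm⟩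
            have := h.add_eq h1 hz hy hnk
            rw [← add_sub_assoc, hN, add_comm (P (n k)), ← this]; abel
        have h3 : crossQ (P (n k)) (P w) = 0 := by
          have := h0.1
          rw [h2.2.1]
          simp only [crossQ, Prod.fst_sub, Prod.snd_sub, Prod.fst_add, Prod.snd_add, hN] at this ⊢
          linarith
        rcases h.cross w h2.1 h3 with rfl | h3
        · rcases h1 with h1 | h1
          · cases h1
            have := n_mem.mp hy
            omega
          · cases h1
        · exact h2.2.2 h3
    · right
      refine (finite_setOf_quadratic_eq_zero (A := 0) (B := crossQ N (P z - P y))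
        (C := dotQ (N - P y) (P z - P y)) ?_).subset fun t ht => ?_
      · by_contra! h1
        exact h0 h1.2
      · simp only [Set.mem_ofPred_eq, extend_n, extend_of_mem t hy, extend_of_mem t hz, dotQ, crossQ,
          Prod.fst_sub, Prod.snd_sub, ← hN] at ht ⊢
        linarith
  -- the corner at the new point `p k`
  have hyP : ∀ z ∈ modes k, y = p k → Corner (n (k + 1)) y z ∨
      {t | dotQ (extend k P t (n (k + 1)) - extend k P t y)
        (extend k P t z - extend k P t y) = 0}.Finite := by
    intro z hz hy
    subst hy
    by_cases h0 : dotQ N (P z) = 0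
    · left
      rcases h.corner (n k) hnk c c_mem z hz (by simpa [h.c_eq] using h0) with h1 | rfl | ⟨w, h1⟩
      · cases h1
      · exact Or.inr (Or.inr ⟨_, Or.inr (.pn k)⟩)
      · exfalso
        rcases h1 with h1 | h1
        · cases h1
          have := p_mem.mp hz
          omega
        · cases h1
    · right
      refine (finite_setOf_quadratic_eq_zero (A := 0) (B := 0) (C := dotQ N (P z))
        (Or.inr (Or.inr h0))).subset fun t ht => ?_
      simp only [Set.mem_ofPred_eq, extend_n, extend_p, extend_of_mem t hz, dotQ,
        Prod.fst_sub, Prod.snd_sub, ← hN] at ht ⊢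
      linarith
  have hyQ : ∀ z ∈ modes k, y = n (k + 1) → Corner (p k) y z ∨
      {t | dotQ (extend k P t (p k) - extend k P t y)
        (extend k P t z - extend k P t y) = 0}.Finite := by
    intro z hz hy
    subst hy
    by_cases h0 : dotQ N (P z - N) = 0
    · left
      have h0' : dotQ (P c - P (n k)) (P z - P (n k)) = 0 := by
        rw [h.c_eq]
        simp only [dotQ, Prod.fst_sub, Prod.snd_sub, Prod.fst_zero, Prod.snd_zero, hN] at h0 ⊢
        linarith
      rcases h.corner c c_mem (n k) hnk z hz h0' with h1 | rfl | ⟨w, h1⟩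
      · cases h1
      · exact Or.inr (Or.inr ⟨_, Or.inr (.nc k)⟩)
      · exfalso
        rcases h1 with h1 | h1
        · cases h1
          have := n_mem.mp hz
          omega
        · cases h1
    · right
      refine (finite_setOf_quadratic_eq_zero (A := 0) (B := 0) (C := dotQ N (P z - N))
        (Or.inr (Or.inr h0))).subset fun t ht => ?_
      simp only [Set.mem_ofPred_eq, extend_n, extend_p, extend_of_mem t hz, dotQ,
        Prod.fst_sub, Prod.snd_sub, ← hN] at ht ⊢
      linarith
  have hquad : ∀ {x y z : Label} (B C : ℚ), (∀ t, dotQ (extend k P t x - extend k P t y)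
      (extend k P t z - extend k P t y) = (N.1 ^ 2 + N.2 ^ 2) * t ^ 2 + B * t + C) →
      Corner x y z ∨ {t | dotQ (extend k P t x - extend k P t y)
        (extend k P t z - extend k P t y) = 0}.Finite := by
    intro x y z B C h1
    right
    simp only [h1]
    exact finite_setOf_quadratic_eq_zero (Or.inl hN0)
  have hself : ∀ {x y : Label}, (∀ t, dotQ (extend k P t x - extend k P t y)
      (extend k P t x - extend k P t y) = N.1 ^ 2 + N.2 ^ 2) →
      Corner x y x ∨ {t | dotQ (extend k P t x - extend k P t y)
        (extend k P t x - extend k P t y) = 0}.Finite := by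
    intro x y h1
    right
    simp only [h1, hN0]
    exact Set.finite_empty
  have hcomm : ∀ {x z : Label}, (Corner z y x ∨ {t | dotQ (extend k P t z - extend k P t y)
      (extend k P t x - extend k P t y) = 0}.Finite) → (Corner x y z ∨
      {t | dotQ (extend k P t x - extend k P t y)
        (extend k P t z - extend k P t y) = 0}.Finite) := by
    intro x z h1
    rw [hsymm]
    exact h1.imp_left Corner.symm
  rw [mem_modes_succ hk] at hx hy hz
  rcases hy with hy | hy
  · rcases hx with hx | rfl | rfl
    · rcases hz with hz | rfl | rfl
      · simp only [extend_of_mem _ hx, extend_of_mem _ hy, extend_of_mem _ hz]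
        by_cases h0 : dotQ (P x - P y) (P z - P y) = 0
        · exact Or.inl (h.corner x hx y hy z hz h0)
        · right
          simp [h0]
      · exact hcomm (hP x hx hy)
      · exact hcomm (hQ x hx hy)
    · rcases hz with hz | rfl | rfl
      · exact hP z hz hy
      · refine hquad (2 * ((P y).1 * N.2 - (P y).2 * N.1)) ((P y).1 ^ 2 + (P y).2 ^ 2) fun t => ?_
        simp only [extend_p, extend_of_mem t hy, dotQ, Prod.fst_sub, Prod.snd_sub, ← hN]
        ring
      · refine hquad (2 * ((P y).1 * N.2 - (P y).2 * N.1))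
          ((P y).1 ^ 2 + (P y).2 ^ 2 - N.1 * (P y).1 - N.2 * (P y).2) fun t => ?_
        simp only [extend_p, extend_n, extend_of_mem t hy, dotQ, Prod.fst_sub, Prod.snd_sub, ← hN]
        ring
    · rcases hz with hz | rfl | rfl
      · exact hQ z hz hy
      · refine hquad (2 * ((P y).1 * N.2 - (P y).2 * N.1))
          ((P y).1 ^ 2 + (P y).2 ^ 2 - N.1 * (P y).1 - N.2 * (P y).2) fun t => ?_
        simp only [extend_p, extend_n, extend_of_mem t hy, dotQ, Prod.fst_sub, Prod.snd_sub, ← hN]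
        ring
      · refine hquad (2 * ((P y).1 * N.2 - (P y).2 * N.1))
          ((N.1 - (P y).1) ^ 2 + (N.2 - (P y).2) ^ 2) fun t => ?_
        simp only [extend_n, extend_of_mem t hy, dotQ, Prod.fst_sub, Prod.snd_sub, ← hN]
        ring
  · have hold : ∀ {x z}, x ∈ modes k → z ∈ modes k → (Corner x y z ∨
        {t | dotQ (extend k P t x - extend k P t y)
          (extend k P t z - extend k P t y) = 0}.Finite) := by
      intro x z hx hz
      rcases hy with rfl | rfl
      · refine hquad (N.2 * ((P x).1 + (P z).1) - N.1 * ((P x).2 + (P z).2)) (dotQ (P x) (P z))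
          fun t => ?_
        simp only [extend_p, extend_of_mem t hx, extend_of_mem t hz, dotQ, Prod.fst_sub,
          Prod.snd_sub, ← hN]
        ring
      · refine hquad (N.2 * ((P x).1 + (P z).1) - N.1 * ((P x).2 + (P z).2))
          (dotQ (P x - N) (P z - N)) fun t => ?_
        simp only [extend_n, extend_of_mem t hx, extend_of_mem t hz, dotQ, Prod.fst_sub,
          Prod.snd_sub, ← hN]
        ring
    rcases hy with rfl | rfl
    · rcases hx with hx | rfl | rfl
      · rcases hz with hz | rfl | rfl
        · exact hold hx hz
        · exact Or.inl (Or.inr (Or.inl rfl))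
        · exact hcomm (hyP x hx rfl)
      · exact Or.inl (Or.inl rfl)
      · rcases hz with hz | rfl | rfl
        · exact hyP z hz rfl
        · exact Or.inl (Or.inr (Or.inl rfl))
        · refine hself fun t => ?_
          simp only [extend_n, extend_p, dotQ, Prod.fst_sub, Prod.snd_sub, ← hN]
          ring
    · rcases hx with hx | rfl | rfl
      · rcases hz with hz | rfl | rfl
        · exact hold hx hz
        · exact hcomm (hyQ x hx rfl)
        · exact Or.inl (Or.inr (Or.inl rfl))
      · rcases hz with hz | rfl | rfl
        · exact hyQ z hz rfl
        · refine hself fun t => ?_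
          simp only [extend_n, extend_p, dotQ, Prod.fst_sub, Prod.snd_sub, ← hN]
          ring
        · exact Or.inl (Or.inr (Or.inl rfl))
      · exact Or.inl (Or.inl rfl)

theorem cross_or_finite (h : IsPlacement k L P) (hk : 1 ≤ k) (hx : x ∈ modes (k + 1)) :
    (x = c ∨ x = n (k + 1)) ∨
      {t | crossQ (extend k P t (n (k + 1))) (extend k P t x) = 0}.Finite := by
  have hnk : n k ∈ modes k := n_mem.mpr ⟨hk, le_rfl⟩
  set N := P (n k) with hN
  have hN0 : N.1 ^ 2 + N.2 ^ 2 ≠ 0 := by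
    intro h0
    have h1 : P (n k) = P c := by
      rw [h.c_eq, ← dotQ_self_eq_zero, dotQ, ← hN]
      linarith
    exact absurd (h.injOn hnk c_mem h1) (by simp)
  rw [mem_modes_succ hk] at hx
  rcases hx with hx | rfl | rfl
  · by_cases h0 : crossQ N (P x) = 0 ∧ dotQ N (P x) = 0
    · refine Or.inl (Or.inl (h.injOn hx c_mem ?_))
      have h1 : (N.1 ^ 2 + N.2 ^ 2) * dotQ (P x) (P x) = 0 := by
        have : (N.1 ^ 2 + N.2 ^ 2) * dotQ (P x) (P x) =
            crossQ N (P x) ^ 2 + dotQ N (P x) ^ 2 := by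
          simp only [crossQ, dotQ]
          ring
        rw [this, h0.1, h0.2]
        norm_num
      rw [h.c_eq, ← dotQ_self_eq_zero]
      exact (mul_eq_zero.mp h1).resolve_left hN0
    · right
      refine (finite_setOf_quadratic_eq_zero (A := 0) (B := -dotQ N (P x))
        (C := crossQ N (P x)) ?_).subset fun t ht => ?_
      · by_contra! h1
        exact h0 ⟨h1.2.2, neg_eq_zero.mp h1.2.1⟩
      · simp only [Set.mem_ofPred_eq, extend_n, extend_of_mem t hx, dotQ, crossQ, ← hN] at ht ⊢
        linarith
  · right
    refine (finite_setOf_quadratic_eq_zero (A := 0) (B := N.1 ^ 2 + N.2 ^ 2) (C := 0)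
      (Or.inr (Or.inl hN0))).subset fun t ht => ?_
    simp only [Set.mem_ofPred_eq, extend_n, extend_p, crossQ, ← hN] at ht ⊢
    linarith
  · exact Or.inl (Or.inr rfl)

theorem exists_succ (h : IsPlacement k L P) (hk : 1 ≤ k) (hL : 0 < L) :
    ∃ P', IsPlacement (k + 1) L P' := by
  have hnk : n k ∈ modes k := n_mem.mpr ⟨hk, le_rfl⟩
  set N := P (n k) with hN
  have hN0 : 0 < N.1 ^ 2 + N.2 ^ 2 := by
    refine lt_of_le_of_ne (by positivity) fun h0 => ?_
    have h1 : P (n k) = P c := by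
      rw [h.c_eq, ← dotQ_self_eq_zero, dotQ, ← hN]
      linarith
    exact absurd (h.injOn hnk c_mem h1) (by simp)
  let badCorner : Set ℚ := ⋃ x ∈ modes (k + 1), ⋃ y ∈ modes (k + 1), ⋃ z ∈ modes (k + 1),
    {t | dotQ (extend k P t x - extend k P t y) (extend k P t z - extend k P t y) = 0 ∧
      ¬ Corner x y z}
  let badCross : Set ℚ := ⋃ x ∈ modes (k + 1),
    {t | crossQ (extend k P t (n (k + 1))) (extend k P t x) = 0 ∧ ¬ (x = c ∨ x = n (k + 1))}
  have hbad : (badCorner ∪ badCross).Finite := by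
    refine Set.Finite.union ?_ ?_
    · refine Set.Finite.biUnion (Finset.finite_toSet _) fun x hx =>
        Set.Finite.biUnion (Finset.finite_toSet _) fun y hy =>
        Set.Finite.biUnion (Finset.finite_toSet _) fun z hz => ?_
      rcases h.corner_or_finite hk hx hy hz with h1 | h1
      · simp [h1]
      · exact h1.subset fun t ht => ht.1
    · refine Set.Finite.biUnion (Finset.finite_toSet _) fun x hx => ?_
      rcases h.cross_or_finite hk hx with h1 | h1
      · simp [h1]
      · exact h1.subset fun t ht => ht.1
  have hN1 : (0 : ℝ) < ((N.1 ^ 2 + N.2 ^ 2 : ℚ) : ℝ) := by exact_mod_cast hN0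
  have hR : (0 : ℝ) < ((41 * L ^ 2 : ℚ) : ℝ) := by
    have : (0 : ℚ) < 41 * L ^ 2 := by positivity
    exact_mod_cast this
  set τ := Real.sqrt (((41 * L ^ 2 : ℚ) : ℝ) / ((N.1 ^ 2 + N.2 ^ 2 : ℚ) : ℝ)) with hτ
  have hτ0 : 0 < τ := Real.sqrt_pos.mpr (div_pos hR hN1)
  have hτ2 : τ ^ 2 * ((N.1 ^ 2 + N.2 ^ 2 : ℚ) : ℝ) = ((41 * L ^ 2 : ℚ) : ℝ) := by
    rw [hτ, Real.sq_sqrt (div_pos hR hN1).le, div_mul_cancel₀ _ hN1.ne']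
  obtain ⟨q₁, hq₁, hq₁'⟩ := exists_rat_btwn (show τ < 2 * τ by linarith)
  obtain ⟨q₂, hq₂, hq₂'⟩ := exists_rat_btwn hq₁'
  obtain ⟨t, ht, htb⟩ := ((Set.Ioo_infinite (show q₁ < q₂ by exact_mod_cast hq₂)).sdiff
    hbad).nonempty
  have ht1 : τ ≤ t := hq₁.le.trans (by exact_mod_cast ht.1.le)
  have ht2 : (t : ℝ) ≤ 2 * τ := le_trans (by exact_mod_cast ht.2.le) hq₂'.le
  have hs1 : 41 * L ^ 2 ≤ t ^ 2 * (N.1 ^ 2 + N.2 ^ 2) := by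
    have : ((41 * L ^ 2 : ℚ) : ℝ) ≤ (t : ℝ) ^ 2 * ((N.1 ^ 2 + N.2 ^ 2 : ℚ) : ℝ) := by
      rw [← hτ2]
      gcongr
    exact_mod_cast this
  have hs2 : t ^ 2 * (N.1 ^ 2 + N.2 ^ 2) ≤ 4 * (41 * L ^ 2) := by
    have : (t : ℝ) ^ 2 * ((N.1 ^ 2 + N.2 ^ 2 : ℚ) : ℝ) ≤ 4 * ((41 * L ^ 2 : ℚ) : ℝ) := by
      rw [← hτ2]
      calc (t : ℝ) ^ 2 * ((N.1 ^ 2 + N.2 ^ 2 : ℚ) : ℝ)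
          ≤ (2 * τ) ^ 2 * ((N.1 ^ 2 + N.2 ^ 2 : ℚ) : ℝ) := by
            have : (0 : ℝ) ≤ t := hτ0.le.trans ht1
            gcongr
        _ = _ := by ring
    exact_mod_cast this
  have hp : ∀ j, 1 ≤ j → j < k + 1 → j ≠ k → p j ∈ modes k := fun j h1 h2 h3 =>
    p_mem.mpr ⟨h1, by omega⟩
  have hn : ∀ j, 1 ≤ j → j < k + 1 → n j ∈ modes k := fun j h1 h2 => n_mem.mpr ⟨h1, by omega⟩
  have hdot : dotQ (extend k P t (p k)) (extend k P t (p k)) = t ^ 2 * (N.1 ^ 2 + N.2 ^ 2) := by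
    rw [extend_p, dotQ]
    ring
  refine ⟨extend k P t, ?_, ?_, ?_, ?_, ?_, fun j h1 h2 => ?_, fun j h1 h2 => ?_,
    fun j h1 h2 => ?_, fun j h1 h2 => ?_, fun x hx y hy z hz h0 => ?_, fun x hx h0 => ?_⟩
  · rw [extend_of_mem t c_mem, h.c_eq]
  · rw [extend_of_mem t d_mem, h.d_eq]
  · rw [extend_of_mem t e_mem, h.e_eq]
  · rw [extend_of_mem t f_mem, h.f_eq]
  · rw [extend_of_mem t (hn 1 le_rfl (by omega)), h.n_one]
  · by_cases hj : j = k
    · subst hj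
      rw [extend_n, extend_p, extend_of_mem t hnk]
      refine Prod.ext ?_ ?_
      · simp only [Prod.fst_add]
        ring
      · simp only [Prod.snd_add]
    · rw [extend_of_mem t (hn j h1 h2), extend_of_mem t (hp j h1 h2 hj),
        extend_of_mem t (hn (j + 1) (by omega) (by omega)), h.n_succ j h1 (by omega)]
  · by_cases hj : j = k
    · subst hj
      rw [extend_p, extend_of_mem t hnk, dotQ]
      ring
    · rw [extend_of_mem t (hn j h1 h2), extend_of_mem t (hp j h1 h2 hj)]
      exact h.dot_np j h1 (by omega)
  · by_cases hj : j = k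
    · subst hj
      rwa [hdot]
    · rw [extend_of_mem t (hp j h1 h2 hj)]
      exact h.le_p j h1 (by omega)
  · by_cases hj : j = k
    · subst hj
      rwa [hdot]
    · rw [extend_of_mem t (hp j h1 h2 hj)]
      exact h.p_le j h1 (by omega)
  · by_contra h1
    refine htb (Or.inl ?_)
    simp only [badCorner, Set.mem_iUnion]
    exact ⟨x, hx, y, hy, z, hz, h0, h1⟩
  · by_contra h1
    refine htb (Or.inr ?_)
    simp only [badCross, Set.mem_iUnion]
    exact ⟨x, hx, h0, h1⟩

theorem le_dotQ_n (h : IsPlacement k L P) {j : ℕ} (hj : 1 ≤ j) (hjk : j ≤ k) :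
    j * (41 * L ^ 2) ≤ dotQ (P (n j)) (P (n j)) := by
  induction j, hj using Nat.le_induction with
  | base =>
    rw [h.n_one, dotQ]
    push_cast
    linarith
  | succ j hj ih =>
    have h1 := ih (by omega)
    have h2 := h.le_p j hj (by omega)
    have h3 := h.dot_np j hj (by omega)
    rw [h.n_succ j hj (by omega)]
    simp only [dotQ, Prod.fst_add, Prod.snd_add] at h1 h2 h3 ⊢
    push_cast
    linarith

end IsPlacement

theorem exists_isPlacement {k : ℕ} (hk : 1 ≤ k) {L : ℚ} (hL : 2 ≤ L) : ∃ P, IsPlacement k L P := by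
  induction k, hk using Nat.le_induction with
  | base => exact exists_isPlacement_one hL
  | succ k hk ih =>
    obtain ⟨P, hP⟩ := ih
    exact hP.exists_succ hk (by linarith)

theorem exists_common_multiple (P : Label → ℚ × ℚ) (F : Finset Label) :
    ∃ M : ℕ, 0 < M ∧ ∃ E : Label → ℤ × ℤ, ∀ x ∈ F,
      ((E x).1 : ℚ) = M * (P x).1 ∧ ((E x).2 : ℚ) = M * (P x).2 := by
  have key : ∀ (q : ℚ) (M : ℕ), q.den ∣ M → ∃ m : ℤ, (m : ℚ) = M * q := by
    rintro q M ⟨m, rfl⟩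
    refine ⟨m * q.num, ?_⟩
    push_cast
    rw [← Rat.mul_den_eq_num q]
    ring
  refine ⟨∏ x ∈ F, (P x).1.den * (P x).2.den,
    Finset.prod_pos fun x _ => Nat.mul_pos (P x).1.den_pos (P x).2.den_pos, ?_⟩
  have h1 : ∀ x, ∃ u : ℤ × ℤ, x ∈ F →
      ((u.1 : ℚ) = (∏ x ∈ F, (P x).1.den * (P x).2.den : ℕ) * (P x).1 ∧
        (u.2 : ℚ) = (∏ x ∈ F, (P x).1.den * (P x).2.den : ℕ) * (P x).2) := by
    intro x
    by_cases hx : x ∈ F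
    · have hd := Finset.dvd_prod_of_mem (fun x => (P x).1.den * (P x).2.den) hx
      obtain ⟨m₁, hm₁⟩ := key (P x).1 _ ((dvd_mul_right _ _).trans hd)
      obtain ⟨m₂, hm₂⟩ := key (P x).2 _ ((dvd_mul_left _ _).trans hd)
      exact ⟨(m₁, m₂), fun _ => ⟨hm₁, hm₂⟩⟩
    · exact ⟨0, fun h => absurd h hx⟩
  choose E hE using h1
  exact ⟨E, fun x hx => hE x hx⟩

end Label

namespace Label

/-- A placement of the modes of a chain in `ℤ² \ {0}` whose rectangles are exactly those of the
chain, and whose vertices `n j` have squared length at least `j * R / 4`. -/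
structure IsIntPlacement (k L M : ℕ) (E : Label → Z2) : Prop where
  ne_zero : ∀ x ∈ modes k, E x ≠ 0
  injOn : ∀ x ∈ modes k, ∀ y ∈ modes k, E x = E y → x = y
  resRel : ∀ x ∈ modes k, ∀ y ∈ modes k, ∀ z ∈ modes k, ∀ w ∈ modes k,
    ResRel (E x) (E y) (E z) (E w) ↔ Rel x y z w
  closed : ∀ x ∈ modes k, ∀ y ∈ modes k, ∀ z ∈ modes k, dotDiff (E x) (E y) (E z) = 0 →
    ∃ w ∈ modes k, E x - E y + E z = E w
  nsq_base : ∀ x ∈ ({c, d, e, f} : Finset Label), nsq (E x) ≤ 14 * M ^ 2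
  nsq_n_one : nsq (E (n 1)) ≤ 9 * (41 * L ^ 2 * M ^ 2)
  nsq_p : ∀ j, 1 ≤ j → j < k → nsq (E (p j)) ≤ 9 * (41 * L ^ 2 * M ^ 2)
  nsq_n : ∀ j, 1 ≤ j → j ≤ k → j * (41 * L ^ 2 * M ^ 2) / 4 ≤ nsq (E (n j))

theorem exists_isIntPlacement {k L : ℕ} (hk : 1 ≤ k) (hL : 2 ≤ L) :
    ∃ M : ℕ, 1 ≤ M ∧ ∃ E, IsIntPlacement k L M E := by
  obtain ⟨P, hP⟩ := exists_isPlacement hk (show (2 : ℚ) ≤ (L : ℚ) by exact_mod_cast hL)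
  obtain ⟨M, hM, u, hu⟩ := exists_common_multiple P (modes k)
  obtain ⟨m, hm⟩ : ∃ m, m = 2 * M := ⟨_, rfl⟩
  let E : Label → Z2 := fun x => (2 * (u x).1 + 1, 2 * (u x).2 + 1)
  have hE1 : ∀ x ∈ modes k, ((E x).1 : ℚ) = (m : ℚ) * (P x).1 + 1 := fun x hx => by
    simp only [E, hm]
    push_cast
    rw [(hu x hx).1]
    ring
  have hE2 : ∀ x ∈ modes k, ((E x).2 : ℚ) = (m : ℚ) * (P x).2 + 1 := fun x hx => by
    simp only [E, hm]
    push_cast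
    rw [(hu x hx).2]
    ring
  have hM0 : (m : ℚ) ≠ 0 := by exact_mod_cast (show m ≠ 0 by omega)
  have hdot : ∀ x ∈ modes k, ∀ y ∈ modes k, ∀ z ∈ modes k, (dotDiff (E x) (E y) (E z) : ℚ) =
      (m : ℚ) ^ 2 * dotQ (P x - P y) (P z - P y) := by
    intro x hx y hy z hz
    simp only [dotDiff, dotQ, Prod.fst_sub, Prod.snd_sub]
    push_cast
    rw [hE1 x hx, hE1 y hy, hE1 z hz, hE2 x hx, hE2 y hy, hE2 z hz]
    ring
  have hdot0 : ∀ x ∈ modes k, ∀ y ∈ modes k, ∀ z ∈ modes k, dotDiff (E x) (E y) (E z) = 0 ↔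
      dotQ (P x - P y) (P z - P y) = 0 := by
    intro x hx y hy z hz
    rw [← Int.cast_eq_zero (α := ℚ), hdot x hx y hy z hz]
    simp [hM0]
  have hPE : ∀ x ∈ modes k, ∀ y ∈ modes k, E x = E y → P x = P y := by
    intro x hx y hy h
    have h1 := congrArg (fun q : Z2 => (q.1 : ℚ)) h
    have h2 := congrArg (fun q : Z2 => (q.2 : ℚ)) h
    rw [hE1 x hx, hE1 y hy, add_left_inj] at h1
    rw [hE2 x hx, hE2 y hy, add_left_inj] at h2
    exact Prod.ext (mul_left_cancel₀ hM0 h1) (mul_left_cancel₀ hM0 h2)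
  have hinj : ∀ x ∈ modes k, ∀ y ∈ modes k, E x = E y → x = y := fun x hx y hy h =>
    hP.injOn hx hy (hPE x hx y hy h)
  have hadd : ∀ {x y z w}, Rect y w x z → x ∈ modes k → y ∈ modes k → z ∈ modes k →
      E x - E y + E z = E w := by
    intro x y z w hr hx hy hz
    have h1 := hP.add_eq hr hx hy hz
    have hw := hr.mem hx hy hz
    have h2 := congrArg Prod.fst h1
    have h3 := congrArg Prod.snd h1
    simp only [Prod.fst_add, Prod.snd_add] at h2 h3
    refine Prod.ext ?_ ?_
    · rw [← Int.cast_inj (α := ℚ)]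
      simp only [Prod.fst_sub, Prod.fst_add]
      push_cast
      rw [hE1 x hx, hE1 y hy, hE1 z hz, hE1 w hw]
      linear_combination (-(m : ℚ)) * h2
    · rw [← Int.cast_inj (α := ℚ)]
      simp only [Prod.snd_sub, Prod.snd_add]
      push_cast
      rw [hE2 x hx, hE2 y hy, hE2 z hz, hE2 w hw]
      linear_combination (-(m : ℚ)) * h3
  have hadd' : ∀ {x y z w}, Rect y w z x → x ∈ modes k → y ∈ modes k → z ∈ modes k →
      E x - E y + E z = E w := by
    intro x y z w hr hx hy hz
    rw [← hadd hr hz hy hx]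
    abel
  have hclosed : ∀ x ∈ modes k, ∀ y ∈ modes k, ∀ z ∈ modes k, dotDiff (E x) (E y) (E z) = 0 →
      ∃ w ∈ modes k, E x - E y + E z = E w ∧ Rel x y z w := by
    intro x hx y hy z hz h
    rcases hP.corner x hx y hy z hz ((hdot0 x hx y hy z hz).mp h) with rfl | rfl | ⟨w, h | h⟩
    · exact ⟨z, hz, by abel, Or.inl ⟨rfl, rfl⟩⟩
    · exact ⟨x, hx, by abel, Or.inr (Or.inl ⟨rfl, rfl⟩)⟩
    · exact ⟨w, h.mem hx hy hz, hadd h hx hy hz, Or.inr (Or.inr (Or.inl h))⟩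
    · exact ⟨w, h.mem hz hy hx, hadd' h hx hy hz, Or.inr (Or.inr (Or.inr h))⟩
  have hm2 : (2 : ℝ) ≤ m := by exact_mod_cast (show 2 ≤ m by omega)
  have hL2 : (2 : ℝ) ≤ L := by exact_mod_cast hL
  have hR : (8 : ℝ) ≤ 41 * L ^ 2 * m ^ 2 := by
    have h1 : (4 : ℝ) ≤ L ^ 2 := by nlinarith
    have h2 : (4 : ℝ) ≤ m ^ 2 := by nlinarith
    nlinarith
  have hup : ∀ x ∈ modes k, ∀ A : ℚ, dotQ (P x) (P x) ≤ A → nsq (E x) ≤ 2 * m ^ 2 * A + 4 := by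
    intro x hx A hA
    have h1 : nsq (E x) = (((m * (P x).1 + 1) ^ 2 + (m * (P x).2 + 1) ^ 2 : ℚ) : ℝ) := by
      rw [← hE1 x hx, ← hE2 x hx, nsq]
      push_cast
      rfl
    have h2 : (m * (P x).1 + 1) ^ 2 + (m * (P x).2 + 1) ^ 2 ≤ 2 * m ^ 2 * A + 4 := by
      have h3 : 2 * (m : ℚ) ^ 2 * dotQ (P x) (P x) ≤ 2 * m ^ 2 * A := by gcongr
      rw [dotQ] at h3
      nlinarith [sq_nonneg (m * (P x).1 - 1), sq_nonneg (m * (P x).2 - 1)]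
    rw [h1]
    exact_mod_cast h2
  have hlow : ∀ x ∈ modes k, ∀ A : ℚ, A ≤ dotQ (P x) (P x) → m ^ 2 * A / 2 - 2 ≤ nsq (E x) := by
    intro x hx A hA
    have h1 : nsq (E x) = (((m * (P x).1 + 1) ^ 2 + (m * (P x).2 + 1) ^ 2 : ℚ) : ℝ) := by
      rw [← hE1 x hx, ← hE2 x hx, nsq]
      push_cast
      rfl
    have h2 : m ^ 2 * A / 2 - 2 ≤ (m * (P x).1 + 1) ^ 2 + (m * (P x).2 + 1) ^ 2 := by
      have h3 : (m : ℚ) ^ 2 * A ≤ m ^ 2 * dotQ (P x) (P x) := by gcongr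
      rw [dotQ] at h3
      nlinarith [sq_nonneg (m * (P x).1 + 2), sq_nonneg (m * (P x).2 + 2)]
    rw [h1]
    exact_mod_cast h2
  refine ⟨m, by omega, E, fun x hx h => ?_, hinj, fun x hx y hy z hz w hw => ⟨fun h => ?_,
    fun h => ?_⟩, fun x hx y hy z hz h => ?_, fun x hx => ?_, ?_, fun j h1 h2 => ?_,
    fun j h1 h2 => ?_⟩
  · have := congrArg Prod.fst h
    simp only [E, Prod.fst_zero] at this
    omega
  · obtain ⟨w', hw', h1, h2⟩ := hclosed x hx y hy z hz h.2
    rwa [← hinj w' hw' w hw (h1.symm.trans h.1)]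
  · rcases h with ⟨rfl, rfl⟩ | ⟨rfl, rfl⟩ | h | h
    · exact ⟨by abel, by simp [dotDiff]⟩
    · exact ⟨by abel, by simp [dotDiff]⟩
    · exact ⟨hadd h hx hy hz, (hdot0 x hx y hy z hz).mpr (hP.dotQ_eq_zero h hx hy hz)⟩
    · exact ⟨hadd' h hx hy hz, (symmRel_resRel.outer _ _ _ _
        ⟨hadd h hz hy hx, (hdot0 z hz y hy x hx).mpr (hP.dotQ_eq_zero h hz hy hx)⟩).2⟩
  · obtain ⟨w, hw, h1, -⟩ := hclosed x hx y hy z hz h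
    exact ⟨w, hw, h1⟩
  · have hx' : x ∈ modes k := by simp only [modes, Finset.mem_union]; tauto
    have h1 := hup x hx' 5 (by
      simp only [Finset.mem_insert, Finset.mem_singleton] at hx
      rcases hx with rfl | rfl | rfl | rfl <;>
        norm_num [hP.c_eq, hP.d_eq, hP.e_eq, hP.f_eq, dotQ])
    push_cast at h1
    nlinarith
  · have h1 := hup (n 1) (n_mem.mpr ⟨le_rfl, hk⟩) (41 * L ^ 2) (by rw [hP.n_one, dotQ]; linarith)
    push_cast at h1
    linarith
  · have h3 := hup (p j) (p_mem.mpr ⟨h1, h2⟩) _ (hP.p_le j h1 h2)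
    push_cast at h3
    linarith
  · have h3 := hlow (n j) (n_mem.mpr ⟨h1, h2⟩) _ (hP.le_dotQ_n h1 h2)
    push_cast at h3
    have h4 : (1 : ℝ) ≤ j := by exact_mod_cast h1
    nlinarith

end Label

section Growth

open Filter Topology

/-! ### Growth along a chain -/

section Flow

variable {α : Type*} {R : α → α → α → α → Prop} {F : Finset α} {A : ℝ → α → ℂ}

theorem IsFlow.scale (h : IsFlow R F (fun _ => 0) A) (δ : ℝ) :
    IsFlow R F (fun _ => 0) (fun t x => (δ : ℂ) * A (δ ^ 2 * t) x) := by
  refine ⟨fun t x hx => by simp [h.zero _ x hx], fun t x hx => ?_⟩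
  have h1 : HasDerivAt (fun τ : ℝ => δ ^ 2 * τ) (δ ^ 2) t := by
    simpa using (hasDerivAt_id t).const_mul (δ ^ 2)
  refine ((HasDerivAt.scomp t (h.deriv (δ ^ 2 * t) x hx) h1).const_mul (δ : ℂ)).congr_deriv ?_
  have h2 : cub R F (fun x => (δ : ℂ) * A (δ ^ 2 * t) x) (fun x => (δ : ℂ) * A (δ ^ 2 * t) x)
      (fun x => (δ : ℂ) * A (δ ^ 2 * t) x) x =
        (δ : ℂ) ^ 3 * cub R F (A (δ ^ 2 * t)) (A (δ ^ 2 * t)) (A (δ ^ 2 * t)) x := by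
    simp only [cub, Finset.mul_sum, mul_ite, mul_zero, map_mul, Complex.conj_ofReal]
    refine Finset.sum_congr rfl fun x _ => Finset.sum_congr rfl fun y _ =>
      Finset.sum_congr rfl fun z _ => ?_
    split_ifs
    · ring
    · rfl
  simp only [field, h2, Complex.real_smul]
  push_cast
  ring

theorem IsFlow.restrict (h : IsFlow R F (fun _ => 0) A) :
    IsFlow (fun x y z w : {x // x ∈ F} => R x y z w) Finset.univ (fun _ => 0)
      (fun t i => A t i) := by
  refine ⟨fun t i hi => absurd (Finset.mem_univ i) hi, fun t i _ => ?_⟩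
  refine (h.deriv t i i.2).congr_deriv ?_
  simp only [field, cub]
  congr 2
  rw [← Finset.sum_coe_sort F]
  refine Finset.sum_congr rfl fun x _ => ?_
  rw [← Finset.sum_coe_sort F]
  refine Finset.sum_congr rfl fun y _ => ?_
  rw [← Finset.sum_coe_sort F]

end Flow

section Sums

variable {ι : Type*} {e : ι ↪ Z2} {l : ℕ}

theorem nsmul_injective_of_pos (hl : 0 < l) : Function.Injective fun i => l • e i := by
  intro i j h
  exact e.injective (smul_right_injective Z2 hl.ne' h)

theorem tsum_weight_eq_sum [Fintype ι] (hl : 0 < l) {a₀ : Z2 → ℂ} {r₀ : ι → ℂ}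
    (h₁ : ∀ i, a₀ (l • e i) = r₀ i) (h₂ : ∀ n, (∀ i, n ≠ l • e i) → a₀ n = 0) (W : Z2 → ℝ) :
    ∑' n, W n * ‖a₀ n‖ ^ 2 = ∑ i, W (l • e i) * ‖r₀ i‖ ^ 2 := by
  rw [tsum_eq_sum (s := Finset.univ.map ⟨fun i => l • e i, nsmul_injective_of_pos hl⟩),
    Finset.sum_map]
  · exact Finset.sum_congr rfl fun i _ => by rw [← h₁ i]; rfl
  · intro n hn
    rw [h₂ n fun i hi => hn (Finset.mem_map.mpr ⟨i, Finset.mem_univ i, hi.symm⟩)]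
    simp

theorem sum_weight_le_tsum [Fintype ι] (hl : 0 < l) {a : Z2 → ℂ} {W : Z2 → ℝ} (hW : ∀ n, 0 ≤ W n)
    (ha : Summable fun n => W n * ‖a n‖ ^ 2) :
    ∑ i, W (l • e i) * ‖a (l • e i)‖ ^ 2 ≤ ∑' n, W n * ‖a n‖ ^ 2 := by
  have h := ha.sum_le_tsum (Finset.univ.map ⟨fun i => l • e i, nsmul_injective_of_pos (e := e) hl⟩)
    fun n _ => mul_nonneg (hW n) (sq_nonneg _)
  rw [Finset.sum_map] at h
  exact h

end Sums

theorem nsq_nsmul (l : ℕ) (n : Z2) : nsq (l • n) = l ^ 2 * nsq n := by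
  have h1 : (l • n).1 = l * n.1 := by simp
  have h2 : (l • n).2 = l * n.2 := by simp
  rw [nsq, nsq, h1, h2]
  push_cast
  ring

namespace Label

theorem sum_modes (J : ℕ) (φ : Label → ℝ) : ∑ x ∈ modes (J + 1), φ x =
    φ c + φ d + φ e + φ f + ∑ j ∈ Finset.range (J + 1), φ (n (j + 1))
      + ∑ j ∈ Finset.range J, φ (p (j + 1)) := by
  have h1 : (Finset.Icc 1 (J + 1)).image n = (Finset.range (J + 1)).image fun j => n (j + 1) := by
    ext x
    simp only [Finset.mem_image, Finset.mem_Icc, Finset.mem_range]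
    constructor
    · rintro ⟨j, hj, rfl⟩
      exact ⟨j - 1, by omega, by congr 1; omega⟩
    · rintro ⟨j, hj, rfl⟩
      exact ⟨j + 1, by omega, rfl⟩
  have h2 : (Finset.Ico 1 (J + 1)).image p = (Finset.range J).image fun j => p (j + 1) := by
    ext x
    simp only [Finset.mem_image, Finset.mem_Ico, Finset.mem_range]
    constructor
    · rintro ⟨j, hj, rfl⟩
      exact ⟨j - 1, by omega, by congr 1; omega⟩
    · rintro ⟨j, hj, rfl⟩
      exact ⟨j + 1, by omega, rfl⟩
  have d1 : Disjoint ({c, d, e, f} : Finset Label)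
      ((Finset.range (J + 1)).image fun j => n (j + 1)) := by
    rw [Finset.disjoint_left]
    simp
  have d2 : Disjoint (({c, d, e, f} : Finset Label) ∪
      ((Finset.range (J + 1)).image fun j => n (j + 1)))
        ((Finset.range J).image fun j => p (j + 1)) := by
    rw [Finset.disjoint_left]
    intro x hx hx'
    obtain ⟨j, -, rfl⟩ := Finset.mem_image.mp hx'
    simp at hx
  rw [modes, h1, h2, Finset.sum_union d2, Finset.sum_union d1,
    Finset.sum_image (fun i _ j _ h => by simpa using h),
    Finset.sum_image (fun i _ j _ h => by simpa using h)]
  congr 2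
  rw [Finset.sum_insert (by simp), Finset.sum_insert (by simp), Finset.sum_insert (by simp),
    Finset.sum_singleton]
  ring

/-- The initial amplitudes of a chain. -/
def start (J : ℕ) (Γ : ℝ) (x : Label) : ℂ := match x with
  | c => Γ
  | d => Γ
  | e => ((Γ / √2 : ℝ) : ℂ)
  | f => ((Γ / √2 : ℝ) : ℂ)
  | n j => if j = 1 then 1 else 0
  | p j => if 1 ≤ j ∧ j ≤ J then 1 else 0

theorem start_of_notMem {J : ℕ} {Γ : ℝ} {x : Label} (hx : x ∉ modes (J + 1)) :
    start J Γ x = 0 := by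
  cases x with
  | c => exact absurd c_mem hx
  | d => exact absurd d_mem hx
  | e => exact absurd e_mem hx
  | f => exact absurd f_mem hx
  | n j =>
    rw [n_mem] at hx
    exact if_neg (by omega)
  | p j =>
    rw [p_mem] at hx
    exact if_neg (by omega)

theorem exists_chain (J : ℕ) (hJ : 16 ≤ J) : ∃ r : ℝ → Label → ℂ,
    IsFlow Rel (modes (J + 1)) (fun _ => 0) r ∧ r 0 = start J (40000 * J ^ 2) ∧
    (∀ t, ∑ j ∈ Finset.range (J + 1), ‖r t (n (j + 1))‖ ^ 2 = 1) ∧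
    ((J : ℝ) - 3) / 432 ≤ ∑ j ∈ Finset.range (J + 1),
      (j : ℝ) * ‖r (J / (18 * (40000 * J ^ 2))) (n (j + 1))‖ ^ 2 := by
  obtain ⟨r, hr0, hr⟩ := exists_isFlow symmRel_rel (F := modes (J + 1)) (fun _ => 0)
    (start J (40000 * J ^ 2)) fun x hx => start_of_notMem hx
  have hg : ((200 * J : ℝ)) ^ 2 = 40000 * J ^ 2 := by ring
  have hc := isChainFlow hr
  have hs : IsChainStart J ((200 * J : ℝ) ^ 2) (fun j t => r t (n j)) (fun j t => r t (p j))
      (fun t => r t c) (fun t => r t d) (fun t => r t e) (fun t => r t f) := by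
    rw [hg]
    refine ⟨?_, fun j hj => ?_, fun j h1 h2 => ?_, ?_, ?_, ?_, ?_⟩ <;> simp only [hr0, start]
    · simp
    · simp [hj]
    · simp [h1, h2]
  refine ⟨r, hr, hr0, hc.sum_norm_sq_n hs, ?_⟩
  have := hc.moment_ge hs hJ rfl
  rwa [hg] at this

end Label

namespace Label

theorem norm_start_sq_le {J : ℕ} {Γ : ℝ} {x : Label}
    (hx : x ∈ ({c, d, e, f} : Finset Label)) : ‖start J Γ x‖ ^ 2 ≤ Γ ^ 2 := by
  have h2 : (Γ / √2) ^ 2 ≤ Γ ^ 2 := by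
    rw [div_pow, Real.sq_sqrt (by norm_num)]
    nlinarith [sq_nonneg Γ]
  simp only [Finset.mem_insert, Finset.mem_singleton] at hx
  rcases hx with rfl | rfl | rfl | rfl <;>
    simp only [start, Complex.norm_real, Real.norm_eq_abs, sq_abs, le_refl, h2]

/-- Weighted `ℓ²` bound of the initial amplitudes of a chain. -/
theorem sum_weight_start_le {J : ℕ} {Γ A B : ℝ} {W : Label → ℝ} (hA0 : 0 ≤ A)
    (hA : ∀ x ∈ ({c, d, e, f} : Finset Label), W x ≤ A)
    (hn : W (n 1) ≤ B) (hp : ∀ j, 1 ≤ j → j < J + 1 → W (p j) ≤ B) :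
    ∑ x ∈ modes (J + 1), W x * ‖start J Γ x‖ ^ 2 ≤ 4 * (A * Γ ^ 2) + (J + 1) * B := by
  have hbase : ∀ x ∈ ({c, d, e, f} : Finset Label), W x * ‖start J Γ x‖ ^ 2 ≤ A * Γ ^ 2 :=
    fun x hx => (mul_le_mul_of_nonneg_right (hA x hx) (sq_nonneg _)).trans
      (mul_le_mul_of_nonneg_left (norm_start_sq_le hx) hA0)
  have h1 : ∑ j ∈ Finset.range (J + 1), W (n (j + 1)) * ‖start J Γ (n (j + 1))‖ ^ 2 ≤ B := by
    rw [Finset.sum_range_succ']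
    simpa [start] using hn
  have h2 : ∑ j ∈ Finset.range J, W (p (j + 1)) * ‖start J Γ (p (j + 1))‖ ^ 2 ≤ J * B := by
    calc ∑ j ∈ Finset.range J, W (p (j + 1)) * ‖start J Γ (p (j + 1))‖ ^ 2
        ≤ ∑ j ∈ Finset.range J, B := by
          refine Finset.sum_le_sum fun j hj => ?_
          have hj' := Finset.mem_range.mp hj
          have h3 : start J Γ (p (j + 1)) = 1 := if_pos (by omega)
          rw [h3]
          simpa using hp (j + 1) (by omega) (by omega)
      _ = J * B := by simp
  rw [sum_modes]
  linarith [hbase c (by simp), hbase d (by simp), hbase e (by simp), hbase f (by simp)]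

/-- Growth of the `s`-th moment from growth of the first moment. -/
theorem rpow_le_sum_rpow_mul {J : ℕ} {s m : ℝ} (hs : 1 ≤ s) (hm : 0 < m) {q y : ℕ → ℝ}
    (hq : ∀ j, 0 ≤ q j) (hsum : ∑ j ∈ Finset.range (J + 1), q j = 1)
    (hmom : m ≤ ∑ j ∈ Finset.range (J + 1), (j : ℝ) * q j)
    (hy : ∀ j ∈ Finset.range (J + 1), q j - m ^ s / (2 * (J + 1) ^ (s + 1)) ≤ y j) :
    m ^ s / 2 ≤ ∑ j ∈ Finset.range (J + 1), ((j : ℝ) + 1) ^ s * y j := by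
  have h1 : m ^ s ≤ ∑ j ∈ Finset.range (J + 1), ((j : ℝ) + 1) ^ s * q j := by
    have h2 := Real.rpow_arith_mean_le_arith_mean_rpow (Finset.range (J + 1)) q (fun j => (j : ℝ))
      (fun j _ => hq j) hsum (fun j _ => Nat.cast_nonneg j) hs
    calc m ^ s ≤ (∑ j ∈ Finset.range (J + 1), q j * (j : ℝ)) ^ s := by
          refine Real.rpow_le_rpow hm.le ?_ (by linarith)
          simpa only [mul_comm] using hmom
      _ ≤ _ := h2
      _ ≤ _ := Finset.sum_le_sum fun j _ => by
          rw [mul_comm]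
          refine mul_le_mul_of_nonneg_right ?_ (hq j)
          exact Real.rpow_le_rpow (Nat.cast_nonneg j) (by linarith) (by linarith)
  have hJ : (0 : ℝ) < J + 1 := by positivity
  calc m ^ s / 2 = m ^ s - ∑ j ∈ Finset.range (J + 1),
        ((J : ℝ) + 1) ^ s * (m ^ s / (2 * (J + 1) ^ (s + 1))) := by
        rw [Finset.sum_const, Finset.card_range, nsmul_eq_mul, Real.rpow_add_one hJ.ne']
        have := Real.rpow_pos_of_pos hJ s
        push_cast
        field_simp
        ring
    _ ≤ ∑ j ∈ Finset.range (J + 1), ((j : ℝ) + 1) ^ s * q j - ∑ j ∈ Finset.range (J + 1),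
        ((j : ℝ) + 1) ^ s * (m ^ s / (2 * (J + 1) ^ (s + 1))) := by
        refine sub_le_sub h1 (Finset.sum_le_sum fun j hj => ?_)
        have hj' : (j : ℝ) ≤ J := by exact_mod_cast Nat.lt_succ_iff.mp (Finset.mem_range.mp hj)
        gcongr
    _ = ∑ j ∈ Finset.range (J + 1),
        ((j : ℝ) + 1) ^ s * (q j - m ^ s / (2 * (J + 1) ^ (s + 1))) := by
        rw [← Finset.sum_sub_distrib]
        exact Finset.sum_congr rfl fun j _ => by ring
    _ ≤ _ := Finset.sum_le_sum fun j hj => mul_le_mul_of_nonneg_left (hy j hj) (by positivity)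

theorem sq_sub_le_sq_div {δ η x y : ℝ} (hδ : 0 < δ) (hη : 0 ≤ η) (hx0 : 0 ≤ x) (hx1 : x ≤ 1)
    (hy0 : 0 ≤ y) (h : δ * x - δ * η / 2 ≤ y) : x ^ 2 - η ≤ y ^ 2 / δ ^ 2 := by
  have h1 : x ≤ y / δ + η / 2 := by
    rw [← sub_le_iff_le_add, le_div_iff₀ hδ]
    linarith
  rw [← div_pow]
  have h2 : 0 ≤ y / δ := by positivity
  rcases le_total x (η / 2) with h3 | h3
  · nlinarith [sq_nonneg (y / δ)]
  · nlinarith [mul_self_le_mul_self (sub_nonneg.mpr h3) (sub_le_iff_le_add.mpr h1)]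

/-- Lower bound of a weighted sum whose amplitudes are close to those of a transferred profile. -/
theorem rpow_mul_le_sum_rpow_mul_sq {J : ℕ} {s m δ Λ : ℝ} (hs : 1 ≤ s) (hm : 0 < m) (hδ : 0 < δ)
    (hΛ : 0 ≤ Λ) {w x y : ℕ → ℝ} (hw : ∀ j < J + 1, Λ / 4 * ((j : ℝ) + 1) ≤ w j)
    (hx : ∀ j, 0 ≤ x j) (hy0 : ∀ j, 0 ≤ y j)
    (hsum : ∑ j ∈ Finset.range (J + 1), x j ^ 2 = 1)
    (hmom : m ≤ ∑ j ∈ Finset.range (J + 1), (j : ℝ) * x j ^ 2)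
    (hy : ∀ j < J + 1, δ * x j - δ * (m ^ s / (2 * (J + 1) ^ (s + 1))) / 2 ≤ y j) :
    δ ^ 2 * Λ ^ s * (m ^ s / (2 * 4 ^ s)) ≤ ∑ j ∈ Finset.range (J + 1), w j ^ s * y j ^ 2 := by
  have hx1 : ∀ j ∈ Finset.range (J + 1), x j ≤ 1 := fun j hj => by
    have h1 : x j ^ 2 ≤ 1 := by
      rw [← hsum]
      exact Finset.single_le_sum (f := fun j => x j ^ 2) (fun _ _ => sq_nonneg _) hj
    nlinarith [hx j]
  have h1 := rpow_le_sum_rpow_mul (J := J) hs hm (q := fun j => x j ^ 2)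
    (y := fun j => y j ^ 2 / δ ^ 2) (fun _ => sq_nonneg _) hsum hmom fun j hj =>
      sq_sub_le_sq_div hδ (by positivity) (hx j) (hx1 j hj) (hy0 j) (hy j (Finset.mem_range.mp hj))
  calc δ ^ 2 * Λ ^ s * (m ^ s / (2 * 4 ^ s)) = δ ^ 2 * (Λ / 4) ^ s * (m ^ s / 2) := by
        rw [Real.div_rpow hΛ (by norm_num)]
        field_simp
    _ ≤ δ ^ 2 * (Λ / 4) ^ s * ∑ j ∈ Finset.range (J + 1), ((j : ℝ) + 1) ^ s * (y j ^ 2 / δ ^ 2) :=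
        mul_le_mul_of_nonneg_left h1 (by positivity)
    _ ≤ _ := by
        rw [Finset.mul_sum]
        refine Finset.sum_le_sum fun j hj => ?_
        have h2 : (Λ / 4 * ((j : ℝ) + 1)) ^ s ≤ w j ^ s :=
          Real.rpow_le_rpow (by positivity) (hw j (Finset.mem_range.mp hj)) (by linarith)
        rw [Real.mul_rpow (by positivity) (by positivity)] at h2
        calc δ ^ 2 * (Λ / 4) ^ s * (((j : ℝ) + 1) ^ s * (y j ^ 2 / δ ^ 2))
            = (Λ / 4) ^ s * ((j : ℝ) + 1) ^ s * y j ^ 2 := by field_simp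
          _ ≤ _ := mul_le_mul_of_nonneg_right h2 (sq_nonneg _)

set_option maxHeartbeats 400000 in
theorem exists_chain_solution {v : Z2 → ℝ} (hv : Tendsto v cofinite (𝓝 0)) {b : ℝ}
    (hb : ∀ n, |v n| ≤ b) {s δ : ℝ} (hs : 1 < s) (hδ : 0 < δ) {J : ℕ} (hJ : 16 ≤ J) :
    ∃ (a : ℝ → Z2 → ℂ) (Λ : ℝ), 0 < Λ ∧ IsSolutionV v a ∧ (∀ t, HsFinite s (a t)) ∧
      ∑' n, ‖a 0 n‖ ^ 2 ≤ δ ^ 2 * (4 * (40000 * J ^ 2) ^ 2 + (J + 1)) ∧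
      0 < HsNormSq s (a 0) ∧ HsNormSq s (a 0) ≤ δ ^ 2 * Λ ^ s * (10 ^ s * (J + 2)) ∧
      δ ^ 2 * Λ ^ s * ((((J : ℝ) - 3) / 432) ^ s / (2 * 4 ^ s)) ≤
        HsNormSq s (a (J / (18 * (40000 * J ^ 2)) / δ ^ 2)) := by
  have hJr : (16 : ℝ) ≤ J := by exact_mod_cast hJ
  obtain ⟨ρ, hρ, hρ0, hmass, hmom⟩ := exists_chain J hJ
  set Γ : ℝ := 40000 * J ^ 2 with hΓ
  have hΓ0 : 0 < Γ := by positivity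
  set T₀ : ℝ := J / (18 * Γ) with hT₀
  obtain ⟨L, hL⟩ : ∃ L : ℕ, L = 80000 * J ^ 2 := ⟨_, rfl⟩
  have hLr : (L : ℝ) = 2 * Γ := by rw [hL, hΓ]; push_cast; ring
  have hL2 : 2 ≤ L := by
    rw [hL]
    nlinarith
  obtain ⟨M, hM, E, hE⟩ := exists_isIntPlacement (show 1 ≤ J + 1 by omega) hL2
  let e' : {x // x ∈ modes (J + 1)} ↪ Z2 :=
    ⟨fun i => E i, fun i j h => Subtype.ext (hE.injOn i i.2 j j.2 h)⟩
  set m : ℝ := ((J : ℝ) - 3) / 432 with hm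
  have hm0 : 0 < m := by
    rw [hm]
    linarith
  set η : ℝ := m ^ s / (2 * (J + 1) ^ (s + 1)) with hη
  have hη0 : 0 < η := by positivity
  have hr := (hρ.scale δ).restrict
  obtain ⟨l₀, hl₀⟩ := exists_shadowing_solution hv hb e' (fun i => hE.ne_zero i i.2)
    (R := fun x y z w => Rel x y z w) (fun x y z w => hE.resRel x x.2 y y.2 z z.2 w w.2)
    (fun x y z h => by
      obtain ⟨w, hw, h1⟩ := hE.closed x x.2 y y.2 z z.2 h
      exact ⟨⟨w, hw⟩, h1⟩) hr (T := T₀ / δ ^ 2) (ε := δ * η / 2) (by positivity) (by positivity)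
  obtain ⟨a, ha, haf, ha0, ha0', haT⟩ := hl₀ (max l₀ 1) (le_max_left _ _)
  set l := max l₀ 1 with hl
  have hl1 : 0 < l := by omega
  have hlr : (1 : ℝ) ≤ l := by exact_mod_cast hl1
  have hMr : (1 : ℝ) ≤ M := by exact_mod_cast hM
  have hLr2 : (2 : ℝ) ≤ L := by exact_mod_cast hL2
  set Λ : ℝ := l ^ 2 * (41 * L ^ 2 * M ^ 2) with hΛ
  have hlM : (1 : ℝ) ≤ l ^ 2 * M ^ 2 := one_le_mul_of_one_le_of_one_le (one_le_pow₀ hlr)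
    (one_le_pow₀ hMr)
  have hΛ1 : 1 ≤ Λ := by nlinarith
  clear_value Λ l η m T₀ Γ
  have hamp : ∀ i : {x // x ∈ modes (J + 1)}, ‖(δ : ℂ) * ρ (δ ^ 2 * 0) i‖ ^ 2 =
      δ ^ 2 * ‖start J Γ i‖ ^ 2 := by
    intro i
    rw [mul_zero, hρ0, norm_mul, mul_pow, Complex.norm_real, Real.norm_eq_abs, sq_abs]
  have hsum0 : ∀ W : Z2 → ℝ, ∑' n, W n * ‖a 0 n‖ ^ 2 =
      δ ^ 2 * ∑ x ∈ modes (J + 1), W (l • E x) * ‖start J Γ x‖ ^ 2 := by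
    intro W
    rw [tsum_weight_eq_sum hl1 ha0 ha0' W, ← Finset.sum_coe_sort (modes (J + 1)),
      Finset.mul_sum]
    refine Finset.sum_congr rfl fun i _ => ?_
    rw [hamp i]
    change W (l • E i) * _ = _
    ring
  have hwt : ∀ x, (1 : ℝ) ≤ 1 + nsq (l • E x) := fun x => by linarith [nsq_nonneg (l • E x)]
  refine ⟨a, Λ, by linarith, ha, fun t => haf s t, ?_, ?_, ?_, ?_⟩
  · have h1 := hsum0 fun _ => 1
    simp only [one_mul] at h1
    rw [h1]
    refine mul_le_mul_of_nonneg_left ?_ (sq_nonneg δ)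
    have := sum_weight_start_le (J := J) (Γ := Γ) (A := 1) (B := 1) (W := fun _ => 1) zero_le_one
      (fun _ _ => le_rfl) le_rfl fun _ _ _ => le_rfl
    simp only [one_mul] at this
    linarith
  · rw [HsNormSq, hsum0 fun k => (1 + nsq k) ^ s]
    refine mul_pos (by positivity)
      (Finset.sum_pos' (fun x _ => ?_) ⟨n 1, n_mem.mpr ⟨le_rfl, by omega⟩, ?_⟩)
    · have := hwt x
      positivity
    · have := hwt (n 1)
      have h1 : start J Γ (n 1) = 1 := by simp [start]
      rw [h1]
      simp only [norm_one, one_pow, mul_one]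
      positivity
  · rw [HsNormSq, hsum0 fun k => (1 + nsq k) ^ s, mul_assoc]
    refine mul_le_mul_of_nonneg_left ?_ (sq_nonneg δ)
    have hs0 : 0 ≤ s := by linarith
    have hB : ∀ x, nsq (E x) ≤ 9 * (41 * L ^ 2 * M ^ 2) → (1 + nsq (l • E x)) ^ s ≤
        10 ^ s * Λ ^ s := by
      intro x hx
      rw [← Real.mul_rpow (by norm_num) (by linarith)]
      refine Real.rpow_le_rpow (by linarith [hwt x]) ?_ hs0
      rw [nsq_nsmul]
      have : (l : ℝ) ^ 2 * nsq (E x) ≤ l ^ 2 * (9 * (41 * L ^ 2 * M ^ 2)) := by gcongr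
      linarith
    have hA : ∀ x ∈ ({c, d, e, f} : Finset Label), (1 + nsq (l • E x)) ^ s ≤ Λ ^ s / L ^ 2 := by
      intro x hx
      have h1 : 1 + nsq (l • E x) ≤ Λ / L ^ 2 := by
        rw [nsq_nsmul, hΛ, le_div_iff₀ (by positivity)]
        have h2 : (l : ℝ) ^ 2 * nsq (E x) ≤ l ^ 2 * (14 * M ^ 2) := by
          gcongr
          exact hE.nsq_base x hx
        have h3 : 1 + (l : ℝ) ^ 2 * nsq (E x) ≤ 41 * (l ^ 2 * M ^ 2) := by linarith
        calc (1 + (l : ℝ) ^ 2 * nsq (E x)) * L ^ 2 ≤ 41 * (l ^ 2 * M ^ 2) * L ^ 2 := by gcongr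
          _ = _ := by ring
      calc (1 + nsq (l • E x)) ^ s ≤ (Λ / L ^ 2) ^ s :=
            Real.rpow_le_rpow (by linarith [hwt x]) h1 hs0
        _ = Λ ^ s / ((L : ℝ) ^ 2) ^ s := Real.div_rpow (by linarith) (by positivity) s
        _ ≤ Λ ^ s / L ^ 2 := by
            refine div_le_div_of_nonneg_left (by positivity) (by positivity) ?_
            exact Real.self_le_rpow_of_one_le (by nlinarith) hs.le
    have h1 := sum_weight_start_le (J := J) (Γ := Γ) (A := Λ ^ s / L ^ 2) (B := 10 ^ s * Λ ^ s)
      (W := fun x => (1 + nsq (l • E x)) ^ s) (by positivity) hA (hB _ hE.nsq_n_one)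
      fun j h2 h3 => hB _ (hE.nsq_p j h2 h3)
    refine h1.trans ?_
    have h2 : 4 * (Λ ^ s / L ^ 2 * Γ ^ 2) = Λ ^ s := by
      rw [hLr]
      field_simp
      norm_num
    have h3 : (1 : ℝ) ≤ 10 ^ s := Real.one_le_rpow (by norm_num) hs0
    have h4 : 0 < Λ ^ s := by positivity
    rw [h2]
    nlinarith
  · have hT : δ ^ 2 * (T₀ / δ ^ 2) = T₀ := by field_simp
    have h1 := sum_weight_le_tsum (e := e') hl1 (a := a (T₀ / δ ^ 2))
      (W := fun k => (1 + nsq k) ^ s) (fun k => by have := nsq_nonneg k; positivity)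
      (haf s (T₀ / δ ^ 2))
    refine le_trans ?_ h1
    let φ : Label → ℝ := fun x => (1 + nsq (l • E x)) ^ s * ‖a (T₀ / δ ^ 2) (l • E x)‖ ^ 2
    have hφ : ∀ x, 0 ≤ φ x := fun x => by
      have := hwt x
      positivity
    have h2 : ∑ i, (1 + nsq (l • e' i)) ^ s * ‖a (T₀ / δ ^ 2) (l • e' i)‖ ^ 2 =
        ∑ x ∈ modes (J + 1), φ x := by
      rw [← Finset.sum_coe_sort (modes (J + 1))]
      rfl
    have h3 : ∑ j ∈ Finset.range (J + 1), φ (n (j + 1)) ≤ ∑ x ∈ modes (J + 1), φ x := by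
      rw [sum_modes]
      have := Finset.sum_nonneg fun j (_ : j ∈ Finset.range J) => hφ (p (j + 1))
      linarith [hφ c, hφ d, hφ e, hφ f]
    rw [h2]
    refine le_trans ?_ h3
    refine rpow_mul_le_sum_rpow_mul_sq (w := fun j => 1 + nsq (l • E (n (j + 1))))
      (x := fun j => ‖ρ T₀ (n (j + 1))‖) (y := fun j => ‖a (T₀ / δ ^ 2) (l • E (n (j + 1)))‖)
      hs.le hm0 hδ (zero_le_one.trans hΛ1) (fun j hj => ?_) (fun _ => norm_nonneg _)
      (fun _ => norm_nonneg _) (hmass T₀) hmom fun j hj => ?_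
    · have h4 := hE.nsq_n (j + 1) (by omega) (by omega)
      push_cast at h4
      have h5 : (l : ℝ) ^ 2 * (((j : ℝ) + 1) * (41 * L ^ 2 * M ^ 2) / 4) ≤
          l ^ 2 * nsq (E (n (j + 1))) := mul_le_mul_of_nonneg_left h4 (sq_nonneg _)
      simp only [nsq_nsmul, hΛ]
      linarith
    · have h4 := haT ⟨n (j + 1), n_mem.mpr ⟨by omega, by omega⟩⟩
      simp only [hT, norm_mul, Complex.norm_real, Real.norm_eq_abs, abs_of_pos hδ] at h4
      rw [hη] at h4
      exact h4

end Label

theorem summable_sq_of_summable_weight {s₀ : ℝ} (hs₀ : 0 ≤ s₀) {v : Z2 → ℝ}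
    (hV : Summable fun n : Z2 => (1 + nsq n) ^ s₀ * v n ^ 2) : Summable fun n => v n ^ 2 :=
  hV.of_nonneg_of_le (fun _ => sq_nonneg _) fun n =>
    le_mul_of_one_le_left (sq_nonneg _)
      (Real.one_le_rpow (by linarith [nsq_nonneg n]) hs₀)

theorem tendsto_zero_of_summable_sq {ι : Type*} {v : ι → ℝ} (h : Summable fun n => v n ^ 2) :
    Tendsto v cofinite (𝓝 0) := by
  have h1 := (Real.continuous_sqrt.tendsto 0).comp h.tendsto_cofinite_zero
  rw [Real.sqrt_zero] at h1
  rw [tendsto_zero_iff_abs_tendsto_zero]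
  simpa only [Function.comp_def, Real.sqrt_sq_eq_abs] using h1

theorem abs_le_sqrt_tsum_sq {ι : Type*} {v : ι → ℝ} (h : Summable fun n => v n ^ 2) (n : ι) :
    |v n| ≤ √(∑' k, v k ^ 2) :=
  Real.abs_le_sqrt (h.le_tsum n fun _ _ => sq_nonneg _)

/-- The amplification factor of a chain of length `J ≥ K ^ (3 / (s - 1))`. -/
theorem sq_mul_le_growth {s K J : ℝ} (hs : 1 < s) (hK : 3 * 24000 ^ s ≤ K) (hK0 : 0 < K)
    (hJ : 16 ≤ J) (hJK : K ^ (3 / (s - 1)) ≤ J) :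
    K ^ 2 * (10 ^ s * (J + 2)) ≤ ((J - 3) / 432) ^ s / (2 * 4 ^ s) := by
  have hJ0 : 0 < J := by linarith
  have hs1 : 0 < s - 1 := by linarith
  have h1 : K ^ 3 ≤ J ^ (s - 1) := by
    calc K ^ 3 = (K ^ (3 / (s - 1))) ^ (s - 1) := by
          rw [← Real.rpow_mul hK0.le, div_mul_cancel₀ _ hs1.ne']
          exact_mod_cast (Real.rpow_natCast K 3).symm
      _ ≤ _ := Real.rpow_le_rpow (by positivity) hJK hs1.le
  have h2 : J ^ s = J ^ (s - 1) * J := by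
    rw [← Real.rpow_add_one hJ0.ne', sub_add_cancel]
  have h3 : (J / 600) ^ s ≤ ((J - 3) / 432) ^ s :=
    Real.rpow_le_rpow (by positivity) (by linarith) (by linarith)
  rw [Real.div_rpow hJ0.le (by norm_num)] at h3
  have h4 : (24000 : ℝ) ^ s = 600 ^ s * (4 ^ s * 10 ^ s) := by
    rw [← Real.mul_rpow (by norm_num) (by norm_num), ← Real.mul_rpow (by norm_num) (by norm_num)]
    norm_num
  rw [le_div_iff₀ (by positivity)]
  refine le_trans ?_ h3
  rw [le_div_iff₀ (by positivity)]
  calc K ^ 2 * (10 ^ s * (J + 2)) * (2 * 4 ^ s) * 600 ^ s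
      = K ^ 2 * (2 * (J + 2) * 24000 ^ s) := by rw [h4]; ring
    _ ≤ K ^ 2 * (3 * J * 24000 ^ s) := by gcongr ?_ * (?_ * _); linarith
    _ = K ^ 2 * J * (3 * 24000 ^ s) := by ring
    _ ≤ K ^ 2 * J * K := by gcongr
    _ = K ^ 3 * J := by ring
    _ ≤ J ^ (s - 1) * J := by gcongr
    _ = J ^ s := h2.symm

theorem time_le_rpow {β K J : ℝ} (hK : 160000 ≤ K) (hJ0 : 0 < J)
    (hJK : J ≤ 2 * K ^ β) :
    J / (18 * (40000 * J ^ 2)) / (1 / (120000 * J ^ 2 * K)) ^ 2 ≤ K ^ (3 * β + 3) := by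
  have hK0 : 0 < K := by linarith
  calc J / (18 * (40000 * J ^ 2)) / (1 / (120000 * J ^ 2 * K)) ^ 2 = 20000 * J ^ 3 * K ^ 2 := by
        field_simp
        norm_num
    _ ≤ 20000 * (2 * K ^ β) ^ 3 * K ^ 2 := by gcongr
    _ = 160000 * (K ^ β) ^ 3 * K ^ 2 := by ring
    _ ≤ K * (K ^ β) ^ 3 * K ^ 2 := by gcongr
    _ = (K ^ β) ^ 3 * K ^ 3 := by ring
    _ = K ^ (3 * β + 3) := by
        rw [Real.rpow_add hK0, mul_comm 3 β, Real.rpow_mul hK0.le]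
        norm_cast

theorem mass_le_sq {K J : ℝ} (hK : 0 < K) (hJ : 1 ≤ J) :
    (1 / (120000 * J ^ 2 * K)) ^ 2 * (4 * (40000 * J ^ 2) ^ 2 + (J + 1)) ≤ (K ^ (-1 : ℝ)) ^ 2 := by
  have hJ0 : 0 < J := by linarith
  have h1 : J ≤ J ^ 4 := le_self_pow₀ hJ (by norm_num)
  have h2 : 4 * (40000 * J ^ 2) ^ 2 + (J + 1) ≤ (120000 * J ^ 2) ^ 2 := by nlinarith
  calc _ ≤ (1 / (120000 * J ^ 2 * K)) ^ 2 * (120000 * J ^ 2) ^ 2 := by gcongr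
    _ = (K ^ (-1 : ℝ)) ^ 2 := by
        rw [Real.rpow_neg_one]
        field_simp

end Growth

/-- **Theorem 1.4 (Guardia).** Fix `s₀ > 0`, `s > 1` and `V ∈ H^{s₀}(𝕋²)` with real Fourier
coefficients `v`. There are `c, σ > 0` such that for every sufficiently large `K > 1` there
exist a global solution of the cubic defocusing NLS with convolution potential, with finite
`H^s` norms, and a time `0 < T ≤ K^c` with `‖a(T)‖_{H^s} ≥ K ‖a(0)‖_{H^s}` and
`‖a(0)‖_{L²} ≤ K^{-σ}`. -/
theorem growth_of_sobolev_norms_NLS_with_convolution_potential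
    (s₀ s : ℝ) (hs₀ : 0 < s₀) (hs : 1 < s)
    (v : Z2 → ℝ) (hV : Summable fun n : Z2 => (1 + nsq n) ^ s₀ * v n ^ 2) :
    ∃ c > (0 : ℝ), ∃ σ > (0 : ℝ), ∃ K₀ > (1 : ℝ), ∀ K : ℝ, K₀ ≤ K →
      ∃ (a : ℝ → Z2 → ℂ) (T : ℝ),
        IsSolutionV v a ∧
        (∀ t : ℝ, HsFinite s (a t)) ∧
        0 < HsNorm s (a 0) ∧
        0 < T ∧ T ≤ K ^ c ∧
        K * HsNorm s (a 0) ≤ HsNorm s (a T) ∧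
        L2Norm (a 0) ≤ K ^ (-σ) := by
  have hv := summable_sq_of_summable_weight hs₀.le hV
  have hβ : 0 < 3 / (s - 1) := div_pos (by norm_num) (by linarith)
  set β := 3 / (s - 1) with hβ_def
  refine ⟨3 * β + 3, by linarith, 1, one_pos,
    max 160000 (max (3 * 24000 ^ s) (16 ^ (1 / β))), lt_max_of_lt_left (by norm_num),
    fun K hK => ?_⟩
  obtain ⟨hK1, hK'⟩ := max_le_iff.mp hK
  obtain ⟨hK2, hK3⟩ := max_le_iff.mp hK'
  have hK0 : 0 < K := by linarith
  have hKβ : 16 ≤ K ^ β := by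
    calc (16 : ℝ) = (16 ^ (1 / β)) ^ β := by
          rw [← Real.rpow_mul (by norm_num), one_div_mul_cancel hβ.ne', Real.rpow_one]
      _ ≤ K ^ β := Real.rpow_le_rpow (by positivity) hK3 hβ.le
  obtain ⟨J, hJ⟩ : ∃ J : ℕ, J = ⌈K ^ β⌉₊ := ⟨_, rfl⟩
  have hJ1 : K ^ β ≤ J := hJ ▸ Nat.le_ceil _
  have hJ2 : (J : ℝ) ≤ 2 * K ^ β := by
    have := Nat.ceil_lt_add_one (show 0 ≤ K ^ β by linarith)
    rw [← hJ] at this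
    linarith
  have hJ16 : (16 : ℝ) ≤ J := hKβ.trans hJ1
  have hJ0 : (0 : ℝ) < J := by linarith
  obtain ⟨a, Λ, hΛ, ha, haf, hmass, hpos, hup, hlow⟩ :=
    Label.exists_chain_solution (tendsto_zero_of_summable_sq hv) (abs_le_sqrt_tsum_sq hv) hs
      (δ := 1 / (120000 * J ^ 2 * K)) (by positivity) (J := J) (by exact_mod_cast hJ16)
  refine ⟨a, _, ha, haf, Real.rpow_pos_of_pos hpos _, by positivity,
    time_le_rpow hK1 hJ0 hJ2, ?_, ?_⟩
  · have h1 := sq_mul_le_growth hs hK2 hK0 hJ16 hJ1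
    rw [HsNorm, HsNorm, ← Real.sqrt_eq_rpow, ← Real.sqrt_eq_rpow]
    refine Real.le_sqrt_of_sq_le (le_trans ?_ hlow)
    rw [mul_pow, Real.sq_sqrt hpos.le]
    refine (mul_le_mul_of_nonneg_left hup (sq_nonneg K)).trans ?_
    rw [mul_left_comm]
    exact mul_le_mul_of_nonneg_left h1 (by positivity)
  · rw [L2Norm, ← Real.sqrt_eq_rpow]
    exact (Real.sqrt_le_left (by positivity)).mpr (hmass.trans (mass_le_sq hK0 (by linarith)))
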